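/- arXiv:math/0010016 — 3 statements merged into one kernel-verified Lean document; each statement's English description precedes it below -/
import Mathlib

section
/- There is a constant C depending only on N such that for every u ∈ P₁(z,M) and every x ∈ B(z,1/2), |u(x)| ≤ C·M·dist(x,∂Ω)². -/
open MeasureTheory Metric Set Filter
open scoped RealInnerProductSpace

noncomputable section

/-- The Laplacian of `φ` at `x`, as the sum of the pure second derivatives. -/
def lap (N : ℕ) (φ : EuclideanSpace ℝ (Fin N) → ℝ) (x : EuclideanSpace ℝ (Fin N)) : ℝ :=
  ∑ i : Fin N,
    fderiv ℝ (fun y => fderiv ℝ φ y (EuclideanSpace.single i 1)) x (EuclideanSpace.single i 1)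

/-- Membership in the class `P_r(z, M)`. -/
def MemP (N : ℕ) (r : ℝ) (z : EuclideanSpace ℝ (Fin N)) (M : ℝ)
    (Ω : Set (EuclideanSpace ℝ (Fin N))) (u : EuclideanSpace ℝ (Fin N) → ℝ) : Prop :=
  IsOpen Ω ∧ ContDiff ℝ 1 u ∧
    (∀ φ : EuclideanSpace ℝ (Fin N) → ℝ, ContDiff ℝ (⊤ : ℕ∞) φ → tsupport φ ⊆ ball z r →
      ∫ x, u x * lap N φ x = ∫ x in Ω, φ x) ∧
    (∀ x ∈ ball z r \ Ω, u x = 0 ∧ gradient u x = 0) ∧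
    (∀ x ∈ ball z r, |u x| ≤ M) ∧
    z ∈ frontier Ω

/-- Membership in the class `P_∞(0, M)` of global solutions with quadratic growth. -/
def MemPinf (N : ℕ) (M : ℝ) (Ω : Set (EuclideanSpace ℝ (Fin N)))
    (u : EuclideanSpace ℝ (Fin N) → ℝ) : Prop :=
  IsOpen Ω ∧ ContDiff ℝ 1 u ∧
    (∀ φ : EuclideanSpace ℝ (Fin N) → ℝ, ContDiff ℝ (⊤ : ℕ∞) φ → HasCompactSupport φ →
      ∫ x, u x * lap N φ x = ∫ x in Ω, φ x) ∧
    (∀ x ∈ Ωᶜ, u x = 0 ∧ gradient u x = 0) ∧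
    (0 : EuclideanSpace ℝ (Fin N)) ∈ frontier Ω ∧
    (∀ x, |u x| ≤ M * (‖x‖ ^ 2 + 1))

/-- The minimum diameter of a set: the smallest width of a slab containing it. -/
def MD (N : ℕ) (D : Set (EuclideanSpace ℝ (Fin N))) : ℝ :=
  ⨅ e : {e : EuclideanSpace ℝ (Fin N) // ‖e‖ = 1},
    ((⨆ x : D, ⟪(x : EuclideanSpace ℝ (Fin N)), (e : EuclideanSpace ℝ (Fin N))⟫) -
      ⨅ x : D, ⟪(x : EuclideanSpace ℝ (Fin N)), (e : EuclideanSpace ℝ (Fin N))⟫)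

/-- The density function `δ_r(u)`. -/
def deltaFn (N : ℕ) (u : EuclideanSpace ℝ (Fin N) → ℝ) (r : ℝ) : ℝ :=
  MD N ({x | u x = 0 ∧ gradient u x = 0} ∩ ball 0 r) / r

/-- Half-space solutions `x ↦ (max(⟪x,e⟫,0))²/2`. -/
def IsHalfSpaceSol (N : ℕ) (u : EuclideanSpace ℝ (Fin N) → ℝ) : Prop :=
  ∃ e : EuclideanSpace ℝ (Fin N), ‖e‖ = 1 ∧ ∀ x, u x = (max ⟪x, e⟫ 0) ^ 2 / 2

/-- `∂Ω ∩ B` is the graph of a `C¹` function. -/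
def IsC1Graph (N : ℕ) (Ω B : Set (EuclideanSpace ℝ (Fin N))) : Prop :=
  ∃ (e : EuclideanSpace ℝ (Fin N)) (f : EuclideanSpace ℝ (Fin N) → ℝ),
    ‖e‖ = 1 ∧ ContDiff ℝ 1 f ∧
    Ω ∩ B = {x ∈ B | f (x - ⟪x, e⟫ • e) < ⟪x, e⟫} ∧
    frontier Ω ∩ B = {x ∈ B | ⟪x, e⟫ = f (x - ⟪x, e⟫ • e)}

/-- `∂Ω ∩ B` is the graph of a real-analytic function. -/
def IsAnalyticGraph (N : ℕ) (Ω B : Set (EuclideanSpace ℝ (Fin N))) : Prop :=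
  ∃ (e : EuclideanSpace ℝ (Fin N)) (f : EuclideanSpace ℝ (Fin N) → ℝ),
    ‖e‖ = 1 ∧ (∀ x, AnalyticAt ℝ f x) ∧
    Ω ∩ B = {x ∈ B | f (x - ⟪x, e⟫ • e) < ⟪x, e⟫} ∧
    frontier Ω ∩ B = {x ∈ B | ⟪x, e⟫ = f (x - ⟪x, e⟫ • e)}

/-- The Alt–Caffarelli–Friedman functional `φ(r, v)` centered at the origin. -/
def acf (N : ℕ) (v : EuclideanSpace ℝ (Fin N) → ℝ) (r : ℝ) : ℝ :=
  r ^ (-4 : ℤ) *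
    (∫ x in ball (0 : EuclideanSpace ℝ (Fin N)) r,
      ‖gradient (fun y => max (v y) 0) x‖ ^ 2 * ‖x‖ ^ ((2 : ℤ) - (N : ℤ))) *
    ∫ x in ball (0 : EuclideanSpace ℝ (Fin N)) r,
      ‖gradient (fun y => max (-v y) 0) x‖ ^ 2 * ‖x‖ ^ ((2 : ℤ) - (N : ℤ))

/-- `S_j(z, u) = sup_{B(z, 2^{-j})} |u|`. -/
def Sj (N : ℕ) (z : EuclideanSpace ℝ (Fin N)) (u : EuclideanSpace ℝ (Fin N) → ℝ) (j : ℕ) : ℝ :=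
  sSup ((fun x => |u x|) '' ball z ((2 : ℝ) ^ (-(j : ℤ))))

section

open scoped Topology Convolution

/-- A smooth profile equal to `t ^ (-N / 2)` for `t ≥ 1` and vanishing for `t ≤ 1 / 2`. -/
def radialProfile (N : ℕ) (t : ℝ) : ℝ :=
  Real.smoothTransition (2 * t - 1) * t ^ (-(N : ℝ) / 2)

lemma radialProfile_of_le {N : ℕ} {t : ℝ} (ht : t ≤ 1 / 2) : radialProfile N t = 0 := by
  rw [radialProfile, Real.smoothTransition.zero_of_nonpos (by linarith), zero_mul]

lemma contDiff_radialProfile (N : ℕ) : ContDiff ℝ (⊤ : ℕ∞) (radialProfile N) := by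
  rw [contDiff_iff_contDiffAt]
  intro t
  rcases lt_or_ge t (1 / 2) with ht | ht
  · have h : radialProfile N =ᶠ[𝓝 t] fun _ => 0 := by
      filter_upwards [Iio_mem_nhds ht] with s hs
      exact radialProfile_of_le (le_of_lt hs)
    exact contDiffAt_const.congr_of_eventuallyEq h
  · refine ContDiffAt.mul ?_ (Real.contDiffAt_rpow_const_of_ne (by linarith))
    exact (Real.smoothTransition.contDiff.comp (by fun_prop)).contDiffAt

/-- The Laplacian, as a function of `‖x‖ ^ 2`, of a radial function whose profile has
derivative `radialProfile N`. -/
def radialDensity (N : ℕ) (t : ℝ) : ℝ :=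
  4 * t * deriv (radialProfile N) t + 2 * N * radialProfile N t

lemma contDiff_radialDensity (N : ℕ) : ContDiff ℝ (⊤ : ℕ∞) (radialDensity N) := by
  have h := contDiff_radialProfile N
  have h' := (contDiff_infty_iff_deriv.1 h).2
  unfold radialDensity
  fun_prop

lemma radialDensity_eq {N : ℕ} {t : ℝ} (ht : 0 < t) :
    radialDensity N t =
      4 * t * deriv (fun s => Real.smoothTransition (2 * s - 1)) t * t ^ (-(N : ℝ) / 2) := by
  have h1 : DifferentiableAt ℝ (fun s => Real.smoothTransition (2 * s - 1)) t :=
    ((Real.smoothTransition.contDiff (n := 1)).comp (by fun_prop)).differentiable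
      one_ne_zero |>.differentiableAt
  have h2 := Real.hasDerivAt_rpow_const (x := t) (p := -(N : ℝ) / 2) (Or.inl ht.ne')
  have h3 := h1.hasDerivAt.mul h2
  have h4 : deriv (radialProfile N) t = _ := h3.deriv
  rw [radialDensity, h4, radialProfile, Real.rpow_sub_one ht.ne']
  field_simp
  ring

lemma radialDensity_of_le {N : ℕ} {t : ℝ} (ht : t < 1 / 2) : radialDensity N t = 0 := by
  have h : radialProfile N =ᶠ[𝓝 t] fun _ => 0 := by
    filter_upwards [Iio_mem_nhds ht] with s hs
    exact radialProfile_of_le (le_of_lt hs)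
  rw [radialDensity, h.deriv_eq, radialProfile_of_le ht.le]
  simp

lemma radialDensity_of_lt {N : ℕ} {t : ℝ} (ht : 1 < t) : radialDensity N t = 0 := by
  have h : (fun s => Real.smoothTransition (2 * s - 1)) =ᶠ[𝓝 t] fun _ => 1 := by
    filter_upwards [Ioi_mem_nhds ht] with s hs
    have : 1 < s := hs
    exact Real.smoothTransition.one_of_one_le (by linarith)
  rw [radialDensity_eq (by linarith), h.deriv_eq]
  simp

lemma radialDensity_nonneg {N : ℕ} {t : ℝ} : 0 ≤ radialDensity N t := by
  rcases lt_or_ge t (1 / 2) with ht | ht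
  · rw [radialDensity_of_le ht]
  · rw [radialDensity_eq (by linarith)]
    have h : Monotone (fun s => Real.smoothTransition (2 * s - 1)) := by
      intro a b hab
      exact Real.smoothTransition.monotone (by linarith)
    have := h.deriv_nonneg (x := t)
    positivity

lemma exists_radialDensity_pos (N : ℕ) : ∃ t, 0 < t ∧ 0 < radialDensity N t := by
  have hd : Differentiable ℝ (fun s => Real.smoothTransition (2 * s - 1)) :=
    ((Real.smoothTransition.contDiff (n := 1)).comp (by fun_prop)).differentiable
      one_ne_zero
  obtain ⟨c, hc, h⟩ := exists_deriv_eq_slope (fun s => Real.smoothTransition (2 * s - 1))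
    (show (1 / 2 : ℝ) < 1 by norm_num) hd.continuous.continuousOn hd.differentiableOn
  have hc0 : 0 < c := by linarith [hc.1]
  refine ⟨c, hc0, ?_⟩
  rw [radialDensity_eq hc0, h]
  norm_num
  positivity

/-- The derivative of the profile of the compactly supported kernel. -/
def kernelSlope (N : ℕ) (t : ℝ) : ℝ := radialProfile N t - 2 ^ N * radialProfile N (4 * t)

lemma contDiff_kernelSlope (N : ℕ) : ContDiff ℝ (⊤ : ℕ∞) (kernelSlope N) := by
  have h := contDiff_radialProfile N
  unfold kernelSlope
  fun_prop

lemma kernelSlope_eq {N : ℕ} {t : ℝ} (ht : 0 < t) :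
    kernelSlope N t = (Real.smoothTransition (2 * t - 1) - Real.smoothTransition (8 * t - 1)) *
      t ^ (-(N : ℝ) / 2) := by
  have h4 : (4 : ℝ) ^ (-(N : ℝ) / 2) = (2 ^ N)⁻¹ := by
    rw [show (4 : ℝ) = 2 ^ (2 : ℝ) by norm_num, ← Real.rpow_mul (by norm_num),
      show (2 : ℝ) * (-(N : ℝ) / 2) = -N by ring, Real.rpow_neg (by norm_num), Real.rpow_natCast]
  rw [kernelSlope, radialProfile, radialProfile, Real.mul_rpow (by norm_num) ht.le, h4,
    show 2 * (4 * t) - 1 = 8 * t - 1 by ring]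
  field_simp

lemma kernelSlope_nonpos {N : ℕ} (t : ℝ) : kernelSlope N t ≤ 0 := by
  rcases le_or_gt t 0 with ht | ht
  · rw [kernelSlope, radialProfile_of_le (by linarith), radialProfile_of_le (by linarith)]
    simp
  · rw [kernelSlope_eq ht]
    have : Real.smoothTransition (2 * t - 1) ≤ Real.smoothTransition (8 * t - 1) :=
      Real.smoothTransition.monotone (by linarith)
    exact mul_nonpos_of_nonpos_of_nonneg (by linarith) (by positivity)

lemma kernelSlope_of_le {N : ℕ} {t : ℝ} (ht : 1 ≤ t) : kernelSlope N t = 0 := by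
  rw [kernelSlope_eq (by linarith), Real.smoothTransition.one_of_one_le (by linarith),
    Real.smoothTransition.one_of_one_le (by linarith)]
  simp

/-- The profile, as a function of `‖x‖ ^ 2`, of the compactly supported kernel. -/
def kernelProfile (N : ℕ) (t : ℝ) : ℝ := ∫ s in (1 : ℝ)..t, kernelSlope N s

lemma hasDerivAt_kernelProfile (N : ℕ) (t : ℝ) :
    HasDerivAt (kernelProfile N) (kernelSlope N t) t :=
  intervalIntegral.integral_hasDerivAt_right
    ((contDiff_kernelSlope N).continuous.intervalIntegrable _ _)
    ((contDiff_kernelSlope N).continuous.stronglyMeasurableAtFilter _ _)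
    (contDiff_kernelSlope N).continuous.continuousAt

lemma contDiff_kernelProfile (N : ℕ) : ContDiff ℝ (⊤ : ℕ∞) (kernelProfile N) := by
  rw [contDiff_infty_iff_deriv]
  refine ⟨fun t => (hasDerivAt_kernelProfile N t).differentiableAt, ?_⟩
  rw [show deriv (kernelProfile N) = kernelSlope N from
    funext fun t => (hasDerivAt_kernelProfile N t).deriv]
  exact contDiff_kernelSlope N

lemma antitone_kernelProfile (N : ℕ) : Antitone (kernelProfile N) :=
  antitone_of_deriv_nonpos (fun t => (hasDerivAt_kernelProfile N t).differentiableAt) fun t => by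
    rw [(hasDerivAt_kernelProfile N t).deriv]
    exact kernelSlope_nonpos t

lemma kernelProfile_of_le {N : ℕ} {t : ℝ} (ht : 1 ≤ t) : kernelProfile N t = 0 := by
  rw [kernelProfile, intervalIntegral.integral_congr (g := fun _ => 0)]
  · simp
  · intro s hs
    rw [uIcc_of_le ht] at hs
    exact kernelSlope_of_le hs.1

lemma kernelProfile_nonneg {N : ℕ} (t : ℝ) : 0 ≤ kernelProfile N t := by
  rw [← kernelProfile_of_le (N := N) (le_max_right t 1)]
  exact antitone_kernelProfile N (le_max_left t 1)

lemma kernelProfile_zero_pos (N : ℕ) : 0 < kernelProfile N 0 := by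
  refine lt_of_le_of_ne (kernelProfile_nonneg 0) fun h0 => ?_
  have h : kernelProfile N =ᶠ[𝓝 (1 / 4)] fun _ => 0 := by
    filter_upwards [Ioi_mem_nhds (show (0 : ℝ) < 1 / 4 by norm_num)] with s hs
    exact le_antisymm (h0 ▸ antitone_kernelProfile N (le_of_lt hs)) (kernelProfile_nonneg s)
  have h1 := h.deriv_eq
  rw [(hasDerivAt_kernelProfile N _).deriv, kernelSlope_eq (by norm_num),
    Real.smoothTransition.zero_of_nonpos (by norm_num),
    Real.smoothTransition.one_of_one_le (by norm_num)] at h1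
  have : (0 : ℝ) < (1 / 4 : ℝ) ^ (-(N : ℝ) / 2) := by positivity
  simp only [deriv_const] at h1
  linarith

lemma lap_radial {N : ℕ} {κ κ' κ'' : ℝ → ℝ} (h1 : ∀ t, HasDerivAt κ (κ' t) t)
    (h2 : ∀ t, HasDerivAt κ' (κ'' t) t) (x : EuclideanSpace ℝ (Fin N)) :
    lap N (fun y => κ (‖y‖ ^ 2)) x = 4 * ‖x‖ ^ 2 * κ'' (‖x‖ ^ 2) + 2 * N * κ' (‖x‖ ^ 2) := by
  have hsq : ∀ y : EuclideanSpace ℝ (Fin N), HasFDerivAt (fun y => ‖y‖ ^ 2)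
      (2 • innerSL ℝ y) y := fun y => (hasStrictFDerivAt_norm_sq y).hasFDerivAt
  have hin : ∀ (i : Fin N) (y : EuclideanSpace ℝ (Fin N)),
      ⟪y, EuclideanSpace.single i (1 : ℝ)⟫ = y i := by
    intro i y
    rw [EuclideanSpace.inner_single_right]
    simp
  have hd : ∀ (i : Fin N) (y : EuclideanSpace ℝ (Fin N)),
      fderiv ℝ (fun y => κ (‖y‖ ^ 2)) y (EuclideanSpace.single i 1) =
        κ' (‖y‖ ^ 2) * (2 * y i) := by
    intro i y
    have h : HasFDerivAt (fun y => κ (‖y‖ ^ 2)) _ y := (h1 _).comp_hasFDerivAt y (hsq y)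
    rw [h.fderiv]
    simp [hin]
  have hc : ∀ (i : Fin N) (y : EuclideanSpace ℝ (Fin N)), HasFDerivAt (fun y => 2 * y i)
      ((2 : ℝ) • (EuclideanSpace.proj i : EuclideanSpace ℝ (Fin N) →L[ℝ] ℝ)) y := by
    intro i y
    exact (EuclideanSpace.proj i : EuclideanSpace ℝ (Fin N) →L[ℝ] ℝ).hasFDerivAt.const_mul 2
  have hdd : ∀ i : Fin N, fderiv ℝ (fun y => fderiv ℝ (fun y => κ (‖y‖ ^ 2)) y
      (EuclideanSpace.single i 1)) x (EuclideanSpace.single i 1) =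
        4 * κ'' (‖x‖ ^ 2) * x i ^ 2 + 2 * κ' (‖x‖ ^ 2) := by
    intro i
    simp_rw [hd]
    have h : HasFDerivAt (fun y => κ' (‖y‖ ^ 2) * (2 * y i)) _ x :=
      ((h2 _).comp_hasFDerivAt x (hsq x)).mul (hc i x)
    rw [h.fderiv]
    simp [hin]
    ring
  simp_rw [lap, hdd, Finset.sum_add_distrib, ← Finset.mul_sum, ← EuclideanSpace.real_norm_sq_eq]
  simp
  ring

/-- A rotation invariant mollifier `ρ` and a compactly supported kernel `k` whose Laplacian is the
difference of `ρ` and its rescaling by a factor two. -/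
structure IsMollifierKernel (N : ℕ) (k ρ : EuclideanSpace ℝ (Fin N) → ℝ) : Prop where
  smooth_kernel : ContDiff ℝ (⊤ : ℕ∞) k
  smooth_mollifier : ContDiff ℝ (⊤ : ℕ∞) ρ
  kernel_eq_zero : ∀ x, 1 < ‖x‖ → k x = 0
  mollifier_eq_zero : ∀ x, 1 < ‖x‖ → ρ x = 0
  kernel_nonneg : ∀ x, 0 ≤ k x
  mollifier_nonneg : ∀ x, 0 ≤ ρ x
  kernel_pos : 0 < k 0
  mollifier_neg : ∀ x, ρ (-x) = ρ x
  integral_mollifier : ∫ x, ρ x = 1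
  lap_kernel : ∀ x, lap N k x = ρ x - 2 ^ N * ρ ((2 : ℝ) • x)

lemma hasCompactSupport_of_norm {N : ℕ} {f : EuclideanSpace ℝ (Fin N) → ℝ}
    (hf : ∀ x, 1 < ‖x‖ → f x = 0) : HasCompactSupport f :=
  HasCompactSupport.intro (isCompact_closedBall 0 1) fun x hx => hf x (by simpa using hx)

theorem exists_isMollifierKernel {N : ℕ} (hN : 2 ≤ N) :
    ∃ k ρ : EuclideanSpace ℝ (Fin N) → ℝ, IsMollifierKernel N k ρ := by
  set ρ : EuclideanSpace ℝ (Fin N) → ℝ := fun x => radialDensity N (‖x‖ ^ 2) with hρ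
  have hρs : ContDiff ℝ (⊤ : ℕ∞) ρ := (contDiff_radialDensity N).comp (contDiff_norm_sq ℝ)
  have hρ0 : ∀ x, 1 < ‖x‖ → ρ x = 0 := fun x hx => radialDensity_of_lt (by nlinarith)
  have hI : 0 < ∫ x, ρ x := by
    obtain ⟨t, ht, hpos⟩ := exists_radialDensity_pos N
    refine hρs.continuous.integral_pos_of_hasCompactSupport_nonneg_nonzero
      (hasCompactSupport_of_norm hρ0) (fun x => radialDensity_nonneg)
      (x := EuclideanSpace.single ⟨0, by omega⟩ (√t)) ?_
    simp only [hρ, PiLp.norm_single, Real.norm_eq_abs, sq_abs, Real.sq_sqrt ht.le]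
    exact hpos.ne'
  set c := ∫ x, ρ x with hc
  have hlap : ∀ x : EuclideanSpace ℝ (Fin N), lap N (fun y => c⁻¹ * kernelProfile N (‖y‖ ^ 2)) x =
      c⁻¹ * ρ x - 2 ^ N * (c⁻¹ * ρ ((2 : ℝ) • x)) := by
    intro x
    have hp : ∀ t, HasDerivAt (radialProfile N) (deriv (radialProfile N) t) t := fun t =>
      ((contDiff_radialProfile N).differentiable (by simp) t).hasDerivAt
    have hs : ∀ t, HasDerivAt (kernelSlope N)
        (deriv (radialProfile N) t - 2 ^ N * (deriv (radialProfile N) (4 * t) * 4)) t := fun t =>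
      (hp t).sub (((hp (4 * t)).comp t (by simpa using (hasDerivAt_id t).const_mul 4)).const_mul _)
    rw [lap_radial (κ := fun t => c⁻¹ * kernelProfile N t)
      (fun t => (hasDerivAt_kernelProfile N t).const_mul c⁻¹) (fun t => (hs t).const_mul c⁻¹)]
    simp only [hρ, norm_smul, radialDensity, kernelSlope, mul_pow]
    norm_num
    ring
  refine ⟨fun x => c⁻¹ * kernelProfile N (‖x‖ ^ 2), fun x => c⁻¹ * ρ x, ?_, ?_, ?_, ?_, ?_, ?_, ?_,
    ?_, ?_, hlap⟩
  · exact contDiff_const.mul ((contDiff_kernelProfile N).comp (contDiff_norm_sq ℝ))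
  · exact contDiff_const.mul hρs
  · intro x hx
    rw [kernelProfile_of_le (by nlinarith), mul_zero]
  · intro x hx
    simp only [hρ0 x hx, mul_zero]
  · exact fun x => mul_nonneg (inv_nonneg.2 hI.le) (kernelProfile_nonneg _)
  · exact fun x => mul_nonneg (inv_nonneg.2 hI.le) radialDensity_nonneg
  · have := kernelProfile_zero_pos N
    rw [norm_zero, zero_pow two_ne_zero]
    positivity
  · intro x
    simp [hρ]
  · rw [integral_const_mul]
    exact inv_mul_cancel₀ hI.ne'

variable {N : ℕ}

/-- The directional derivative of `φ` along `e`. -/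
def dirDeriv (e : EuclideanSpace ℝ (Fin N)) (φ : EuclideanSpace ℝ (Fin N) → ℝ) :
    EuclideanSpace ℝ (Fin N) → ℝ :=
  fun x => fderiv ℝ φ x e

lemma lap_eq_sum_dirDeriv (φ : EuclideanSpace ℝ (Fin N) → ℝ) (x : EuclideanSpace ℝ (Fin N)) :
    lap N φ x = ∑ i, dirDeriv (EuclideanSpace.single i 1)
      (dirDeriv (EuclideanSpace.single i 1) φ) x := rfl

lemma contDiff_dirDeriv {φ : EuclideanSpace ℝ (Fin N) → ℝ} (h : ContDiff ℝ (⊤ : ℕ∞) φ)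
    (e : EuclideanSpace ℝ (Fin N)) : ContDiff ℝ (⊤ : ℕ∞) (dirDeriv e φ) :=
  (h.fderiv_right (m := (⊤ : ℕ∞)) (by simp)).clm_apply contDiff_const

lemma dirDeriv_dirDeriv {φ : EuclideanSpace ℝ (Fin N) → ℝ} (h : ContDiff ℝ (⊤ : ℕ∞) φ)
    (a b x : EuclideanSpace ℝ (Fin N)) :
    dirDeriv a (dirDeriv b φ) x = fderiv ℝ (fderiv ℝ φ) x a b := by
  have hd : DifferentiableAt ℝ (fderiv ℝ φ) x :=
    (h.fderiv_right (m := (⊤ : ℕ∞)) (by simp)).differentiable (by simp) x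
  have h1 := hd.hasFDerivAt.clm_apply (hasFDerivAt_const b x)
  simp [show dirDeriv b φ = fun y => fderiv ℝ φ y b from rfl, dirDeriv, h1.fderiv]

lemma dirDeriv_comm {φ : EuclideanSpace ℝ (Fin N) → ℝ} (h : ContDiff ℝ (⊤ : ℕ∞) φ)
    (a b : EuclideanSpace ℝ (Fin N)) :
    dirDeriv a (dirDeriv b φ) = dirDeriv b (dirDeriv a φ) := by
  funext x
  rw [dirDeriv_dirDeriv h, dirDeriv_dirDeriv h]
  exact ((contDiff_infty.1 h 2).contDiffAt.isSymmSndFDerivAt (by simp)).eq a b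

lemma dirDeriv_sum {ι : Type*} (t : Finset ι) {f : ι → EuclideanSpace ℝ (Fin N) → ℝ}
    (h : ∀ i ∈ t, ContDiff ℝ (⊤ : ℕ∞) (f i)) (e : EuclideanSpace ℝ (Fin N)) :
    dirDeriv e (fun x => ∑ i ∈ t, f i x) = fun x => ∑ i ∈ t, dirDeriv e (f i) x := by
  funext x
  simp only [dirDeriv]
  rw [fderiv_fun_sum fun i hi => (h i hi).differentiable (by simp) x]
  simp

lemma dirDeriv_lap {φ : EuclideanSpace ℝ (Fin N) → ℝ} (h : ContDiff ℝ (⊤ : ℕ∞) φ)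
    (e : EuclideanSpace ℝ (Fin N)) : dirDeriv e (lap N φ) = lap N (dirDeriv e φ) := by
  have h1 := dirDeriv_sum Finset.univ (f := fun i : Fin N => dirDeriv (EuclideanSpace.single i 1)
    (dirDeriv (EuclideanSpace.single i 1) φ))
    (fun i _ => contDiff_dirDeriv (contDiff_dirDeriv h _) _) e
  refine h1.trans ?_
  funext x
  rw [lap_eq_sum_dirDeriv]
  refine Finset.sum_congr rfl fun i _ => ?_
  rw [dirDeriv_comm (contDiff_dirDeriv h _), dirDeriv_comm h]

lemma dirDeriv_comp_smul_sub {φ : EuclideanSpace ℝ (Fin N) → ℝ} (h : ContDiff ℝ (⊤ : ℕ∞) φ)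
    (s : ℝ) (e x y : EuclideanSpace ℝ (Fin N)) :
    dirDeriv e (fun y => φ (s • (x - y))) y = -s * dirDeriv e φ (s • (x - y)) := by
  have h1 : HasFDerivAt (fun y => s • (x - y)) (s • -ContinuousLinearMap.id ℝ _) y :=
    ((hasFDerivAt_id y).const_sub x).const_smul s
  have h2 : HasFDerivAt (fun y => φ (s • (x - y))) _ y :=
    (h.differentiable (by simp) (s • (x - y))).hasFDerivAt.comp y h1
  simp only [dirDeriv, h2.fderiv]
  simp

lemma dirDeriv_comp_smul {φ : EuclideanSpace ℝ (Fin N) → ℝ} (h : ContDiff ℝ (⊤ : ℕ∞) φ)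
    (s : ℝ) (e y : EuclideanSpace ℝ (Fin N)) :
    dirDeriv e (fun y => φ (s • y)) y = s * dirDeriv e φ (s • y) := by
  have h1 : HasFDerivAt (fun y => s • y) (s • ContinuousLinearMap.id ℝ _) y :=
    (hasFDerivAt_id y).const_smul s
  have h2 : HasFDerivAt (fun y => φ (s • y)) _ y :=
    (h.differentiable (by simp) (s • y)).hasFDerivAt.comp y h1
  simp only [dirDeriv, h2.fderiv]
  simp

lemma dirDeriv_const_mul {φ : EuclideanSpace ℝ (Fin N) → ℝ} (h : ContDiff ℝ (⊤ : ℕ∞) φ)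
    (c : ℝ) (e : EuclideanSpace ℝ (Fin N)) :
    dirDeriv e (fun y => c * φ y) = fun y => c * dirDeriv e φ y := by
  funext y
  simp only [dirDeriv, fderiv_const_mul (h.differentiable (by simp) y)]
  simp

lemma lap_comp_smul_sub {φ : EuclideanSpace ℝ (Fin N) → ℝ} (h : ContDiff ℝ (⊤ : ℕ∞) φ)
    (s : ℝ) (x y : EuclideanSpace ℝ (Fin N)) :
    lap N (fun y => φ (s • (x - y))) y = s ^ 2 * lap N φ (s • (x - y)) := by
  simp only [lap_eq_sum_dirDeriv, Finset.mul_sum]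
  refine Finset.sum_congr rfl fun i _ => ?_
  set e : EuclideanSpace ℝ (Fin N) := EuclideanSpace.single i 1
  have h1 : dirDeriv e (fun y => φ (s • (x - y))) = fun y => -s * dirDeriv e φ (s • (x - y)) :=
    funext fun y => dirDeriv_comp_smul_sub h s e x y
  have h2 := contDiff_dirDeriv h e
  rw [h1, dirDeriv_const_mul (φ := fun y => dirDeriv e φ (s • (x - y))) (by fun_prop)]
  simp only [dirDeriv_comp_smul_sub h2]
  ring

lemma hasDerivAt_line {φ : EuclideanSpace ℝ (Fin N) → ℝ} (h : ContDiff ℝ (⊤ : ℕ∞) φ)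
    (x e : EuclideanSpace ℝ (Fin N)) (t : ℝ) :
    HasDerivAt (fun t : ℝ => φ (x + t • e)) (dirDeriv e φ (x + t • e)) t := by
  have h1 : HasDerivAt (fun t : ℝ => x + t • e) e t := by
    simpa using ((hasDerivAt_id t).smul_const e).const_add x
  exact (h.differentiable (by simp) (x + t • e)).hasFDerivAt.comp_hasDerivAt t h1

/-- Smooth functions supported in the closed unit ball. -/
structure IsUnitBump (σ : EuclideanSpace ℝ (Fin N) → ℝ) : Prop where
  smooth : ContDiff ℝ (⊤ : ℕ∞) σ
  eq_zero : ∀ x, 1 < ‖x‖ → σ x = 0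

namespace IsUnitBump

variable {σ : EuclideanSpace ℝ (Fin N) → ℝ}

lemma hasCompactSupport (h : IsUnitBump σ) : HasCompactSupport σ :=
  hasCompactSupport_of_norm h.eq_zero

lemma dirDeriv (h : IsUnitBump σ) (e : EuclideanSpace ℝ (Fin N)) :
    IsUnitBump (_root_.dirDeriv e σ) := by
  refine ⟨contDiff_dirDeriv h.smooth e, fun x hx => ?_⟩
  have h0 : σ =ᶠ[𝓝 x] fun _ => 0 := by
    filter_upwards [continuous_norm.continuousAt.preimage_mem_nhds (Ioi_mem_nhds hx)] with y hy
    exact h.eq_zero y hy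
  simp [_root_.dirDeriv, h0.fderiv_eq]

lemma exists_bound (h : IsUnitBump σ) : ∃ B, 0 < B ∧ ∀ x, |σ x| ≤ B := by
  obtain ⟨B, hB⟩ := h.hasCompactSupport.exists_bound_of_continuous h.smooth.continuous
  exact ⟨max B 1, by positivity, fun x => (hB x).trans (le_max_left _ _)⟩

lemma comp_smul_sub_eq_zero (h : IsUnitBump σ) {s : ℝ} (hs : 0 < s)
    {x y : EuclideanSpace ℝ (Fin N)} (hy : y ∉ closedBall x (1 / s)) : σ (s • (x - y)) = 0 := by
  apply h.eq_zero
  rw [mem_closedBall, dist_comm, dist_eq_norm, not_le, div_lt_iff₀ hs] at hy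
  rw [norm_smul, Real.norm_of_nonneg hs.le]
  linarith

lemma hasCompactSupport_comp_smul_sub (h : IsUnitBump σ) {s : ℝ} (hs : 0 < s)
    (x : EuclideanSpace ℝ (Fin N)) : HasCompactSupport fun y => σ (s • (x - y)) :=
  HasCompactSupport.intro (isCompact_closedBall x (1 / s))
    fun _ hy => h.comp_smul_sub_eq_zero hs hy

lemma continuous_comp_smul_sub (h : IsUnitBump σ) (s : ℝ) (x : EuclideanSpace ℝ (Fin N)) :
    Continuous fun y => σ (s • (x - y)) :=
  h.smooth.continuous.comp (by fun_prop)

lemma integrable_mul (h : IsUnitBump σ) {v : EuclideanSpace ℝ (Fin N) → ℝ}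
    (hv : LocallyIntegrable v) {s : ℝ} (hs : 0 < s) (x : EuclideanSpace ℝ (Fin N)) :
    Integrable fun y => v y * σ (s • (x - y)) :=
  hv.integrable_smul_right_of_hasCompactSupport (h.continuous_comp_smul_sub s x)
    (h.hasCompactSupport_comp_smul_sub hs x)

lemma hasCompactSupport_comp_smul (h : IsUnitBump σ) {s : ℝ} (hs : 0 < s) :
    HasCompactSupport fun y => σ (s • y) :=
  HasCompactSupport.intro (isCompact_closedBall 0 (1 / s)) fun y hy => by
    have := h.comp_smul_sub_eq_zero (x := 0) (y := -y) hs (by simpa using hy)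
    simpa using this

lemma contDiff_comp_smul (h : IsUnitBump σ) (s : ℝ) :
    ContDiff ℝ (⊤ : ℕ∞) fun y => σ (s • y) :=
  h.smooth.comp (by fun_prop)

end IsUnitBump

/-- The rescaled convolution `s ^ m * ∫ v(y) σ(s(x - y)) dy`. -/
def scaledConv (m : ℕ) (σ v : EuclideanSpace ℝ (Fin N) → ℝ) (s : ℝ)
    (x : EuclideanSpace ℝ (Fin N)) : ℝ :=
  s ^ m * ∫ y, v y * σ (s • (x - y))

section scaledConv

variable {σ v : EuclideanSpace ℝ (Fin N) → ℝ} {s : ℝ}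

lemma scaledConv_eq_convolution (m : ℕ) (σ v : EuclideanSpace ℝ (Fin N) → ℝ) (s : ℝ) :
    scaledConv m σ v s =
      fun x => s ^ m * (v ⋆[ContinuousLinearMap.mul ℝ ℝ, volume] fun y => σ (s • y)) x := rfl

lemma contDiff_scaledConv (m : ℕ) (h : IsUnitBump σ) (hv : LocallyIntegrable v) (hs : 0 < s) :
    ContDiff ℝ (⊤ : ℕ∞) (scaledConv m σ v s) := by
  rw [scaledConv_eq_convolution]
  exact contDiff_const.mul
    ((h.hasCompactSupport_comp_smul hs).contDiff_convolution_right _ hv (h.contDiff_comp_smul s))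

lemma dirDeriv_scaledConv (m : ℕ) (h : IsUnitBump σ) (hv : LocallyIntegrable v) (hs : 0 < s)
    (e : EuclideanSpace ℝ (Fin N)) :
    dirDeriv e (scaledConv m σ v s) = scaledConv (m + 1) (dirDeriv e σ) v s := by
  funext x
  have hc := h.hasCompactSupport_comp_smul hs
  have hd := (h.contDiff_comp_smul s).of_le (m := 1) (by simp)
  have h1 := (hc.hasFDerivAt_convolution_right (ContinuousLinearMap.mul ℝ ℝ) hv hd x).const_mul
    (s ^ m)
  rw [scaledConv_eq_convolution, dirDeriv, h1.fderiv, smul_apply,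
    convolution_precompR_apply _ hv (hc.fderiv ℝ) (hd.continuous_fderiv one_ne_zero),
    convolution_def, scaledConv, pow_succ, mul_assoc, ← integral_const_mul, smul_eq_mul]
  congr 1
  refine integral_congr_ae (Eventually.of_forall fun y => ?_)
  have := dirDeriv_comp_smul h.smooth s e (x - y)
  simp only [dirDeriv, ContinuousLinearMap.mul_apply'] at this ⊢
  rw [this]
  ring

lemma lap_scaledConv (m : ℕ) (h : IsUnitBump σ) (hv : LocallyIntegrable v) (hs : 0 < s)
    (x : EuclideanSpace ℝ (Fin N)) :
    lap N (scaledConv m σ v s) x = scaledConv (m + 2) (lap N σ) v s x := by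
  simp only [lap_eq_sum_dirDeriv, dirDeriv_scaledConv m h hv hs,
    dirDeriv_scaledConv (m + 1) (h.dirDeriv _) hv hs]
  simp only [scaledConv, ← Finset.mul_sum]
  rw [← integral_finsetSum _ fun i _ => ((h.dirDeriv _).dirDeriv _).integrable_mul hv hs x]
  simp only [lap_eq_sum_dirDeriv, Finset.mul_sum]

end scaledConv

/-- The Laplacian of `ψ` is the difference of `σ` and a rescaling of `σ`. -/
structure IsKernelPair (m : ℕ) (ψ σ : EuclideanSpace ℝ (Fin N) → ℝ) : Prop where
  left : IsUnitBump ψ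
  right : IsUnitBump σ
  lap_eq : ∀ x, lap N ψ x = σ x - 2 ^ m * σ ((2 : ℝ) • x)

namespace IsKernelPair

variable {m : ℕ} {ψ σ v : EuclideanSpace ℝ (Fin N) → ℝ} {s : ℝ}

lemma dirDeriv (h : IsKernelPair m ψ σ) (e : EuclideanSpace ℝ (Fin N)) :
    IsKernelPair (m + 1) (_root_.dirDeriv e ψ) (_root_.dirDeriv e σ) := by
  refine ⟨h.left.dirDeriv e, h.right.dirDeriv e, fun x => ?_⟩
  have hs := h.right.smooth
  rw [← dirDeriv_lap h.left.smooth, show lap N ψ = fun x => σ x - 2 ^ m * σ ((2 : ℝ) • x) from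
    funext h.lap_eq]
  have h1 := dirDeriv_const_mul (h.right.contDiff_comp_smul 2) (2 ^ m) e
  have h2 := dirDeriv_comp_smul hs 2 e x
  have h3 := congrFun h1 x
  have hd1 := hs.differentiable (by simp) x
  have hd2 := ((contDiff_const (c := (2 : ℝ) ^ m)).mul
    (h.right.contDiff_comp_smul 2)).differentiable (by simp) x
  simp only [_root_.dirDeriv] at h1 h2 h3 ⊢
  rw [fderiv_fun_sub hd1 hd2, sub_apply, h3, h2]
  ring

lemma scaledConv_lap (h : IsKernelPair m ψ σ) (hv : LocallyIntegrable v) (hs : 0 < s)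
    (x : EuclideanSpace ℝ (Fin N)) :
    scaledConv (m + 2) (lap N ψ) v s x =
      s ^ 2 * (scaledConv m σ v s x - scaledConv m σ v (2 * s) x) := by
  have h1 := h.right.integrable_mul hv hs x
  have h2 := h.right.integrable_mul hv (show 0 < 2 * s by positivity) x
  simp only [scaledConv, h.lap_eq, smul_smul, mul_sub]
  rw [show (fun y => v y * σ (s • (x - y)) - v y * (2 ^ m * σ ((2 * s) • (x - y)))) =
    fun y => v y * σ (s • (x - y)) - 2 ^ m * (v y * σ ((2 * s) • (x - y))) by funext y; ring,
    integral_sub h1 (h2.const_mul _), integral_const_mul]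
  ring

end IsKernelPair

lemma IsMollifierKernel.isKernelPair {k ρ : EuclideanSpace ℝ (Fin N) → ℝ}
    (h : IsMollifierKernel N k ρ) : IsKernelPair N k ρ :=
  ⟨⟨h.smooth_kernel, h.kernel_eq_zero⟩, ⟨h.smooth_mollifier, h.mollifier_eq_zero⟩, h.lap_kernel⟩

lemma locallyIntegrable_indicator_one {S : Set (EuclideanSpace ℝ (Fin N))}
    (hS : MeasurableSet S) : LocallyIntegrable (S.indicator fun _ => (1 : ℝ)) :=
  (locallyIntegrable_const (1 : ℝ)).indicator hS

lemma MemP.scaledConv_sub {z x : EuclideanSpace ℝ (Fin N)} {M r s : ℝ}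
    {Ω : Set (EuclideanSpace ℝ (Fin N))} {u : EuclideanSpace ℝ (Fin N) → ℝ}
    (hu : MemP N r z M Ω u) {m : ℕ} {ψ σ : EuclideanSpace ℝ (Fin N) → ℝ}
    (h : IsKernelPair m ψ σ) (hs : 0 < s) (hx : closedBall x (1 / s) ⊆ ball z r) :
    scaledConv m σ u s x - scaledConv m σ u (2 * s) x =
      (s ^ 2)⁻¹ * scaledConv m ψ (Ω.indicator fun _ => 1) s x := by
  obtain ⟨hΩ, hu1, heq, -⟩ := hu
  have hsm : ContDiff ℝ (⊤ : ℕ∞) fun y => ψ (s • (x - y)) := h.left.smooth.comp (by fun_prop)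
  have hsupp : tsupport (fun y => ψ (s • (x - y))) ⊆ ball z r := by
    refine (closure_minimal ?_ isClosed_closedBall).trans hx
    intro y hy
    by_contra hyx
    exact hy (h.left.comp_smul_sub_eq_zero hs hyx)
  have h1 := heq _ hsm hsupp
  have h2 := h.scaledConv_lap hu1.continuous.locallyIntegrable hs x
  simp only [lap_comp_smul_sub h.left.smooth] at h1
  rw [eq_inv_mul_iff_mul_eq₀ (by positivity), ← h2]
  simp only [scaledConv]
  rw [pow_add, mul_assoc, ← integral_const_mul, ← integral_indicator hΩ.measurableSet] at *
  congr 1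
  rw [show (fun y => Ω.indicator (fun _ => (1 : ℝ)) y * ψ (s • (x - y))) =
    Ω.indicator fun y => ψ (s • (x - y)) by
      funext y; by_cases hy : y ∈ Ω <;> simp [hy]]
  rw [← h1]
  congr 1
  funext y
  ring

lemma volume_closedBall_one_div (x : EuclideanSpace ℝ (Fin N)) {s : ℝ} (hs : 0 < s) (c : ℝ)
    (hc : 0 ≤ c) : volume.real (closedBall x (c / s)) =
      c ^ N * volume.real (ball (0 : EuclideanSpace ℝ (Fin N)) 1) / s ^ N := by
  rw [Measure.addHaar_real_closedBall _ _ (by positivity), finrank_euclideanSpace_fin, div_pow]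
  ring

lemma abs_scaledConv_le {m : ℕ} {σ v : EuclideanSpace ℝ (Fin N) → ℝ} {s M B : ℝ}
    {x : EuclideanSpace ℝ (Fin N)} (h : IsUnitBump σ) (hs : 0 < s) (hM : 0 ≤ M)
    (hv : ∀ y ∈ closedBall x (1 / s), |v y| ≤ M) (hB : ∀ w, |σ w| ≤ B) :
    |scaledConv m σ v s x| ≤
      s ^ m * (M * B * (volume.real (ball (0 : EuclideanSpace ℝ (Fin N)) 1) / s ^ N)) := by
  rw [scaledConv, abs_mul, abs_of_pos (by positivity : 0 < s ^ m)]
  gcongr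
  rw [← setIntegral_eq_integral_of_forall_compl_eq_zero (s := closedBall x (1 / s))
    fun y hy => by rw [h.comp_smul_sub_eq_zero hs hy, mul_zero]]
  have h1 := norm_setIntegral_le_of_norm_le_const (μ := volume) (s := closedBall x (1 / s))
    (f := fun y => v y * σ (s • (x - y))) (C := M * B) measure_closedBall_lt_top fun y hy => by
      rw [norm_mul]
      exact mul_le_mul (hv y hy) (hB _) (norm_nonneg _) hM
  rw [volume_closedBall_one_div x hs 1 zero_le_one] at h1
  simpa using h1

lemma abs_indicator_one_le (S : Set (EuclideanSpace ℝ (Fin N))) (y : EuclideanSpace ℝ (Fin N)) :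
    |S.indicator (fun _ => (1 : ℝ)) y| ≤ 1 := by
  by_cases hy : y ∈ S <;> simp [hy]

lemma scaledConv_indicator (m : ℕ) (σ : EuclideanSpace ℝ (Fin N) → ℝ)
    {S : Set (EuclideanSpace ℝ (Fin N))} (hS : MeasurableSet S) (s : ℝ)
    (x : EuclideanSpace ℝ (Fin N)) :
    scaledConv m σ (S.indicator fun _ => 1) s x = s ^ m * ∫ y in S, σ (s • (x - y)) := by
  rw [scaledConv, ← integral_indicator hS]
  congr 2
  funext y
  by_cases hy : y ∈ S <;> simp [hy]

lemma abs_scaledConv_sub_le {m : ℕ} {σ v : EuclideanSpace ℝ (Fin N) → ℝ} {s L : ℝ}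
    {x x' : EuclideanSpace ℝ (Fin N)} (h : IsUnitBump σ) (hs : 0 < s)
    (hv : LocallyIntegrable v) (hv1 : ∀ y, |v y| ≤ 1)
    (hL : ∀ a b, |σ a - σ b| ≤ L * ‖a - b‖) (hx : ‖x - x'‖ ≤ 1 / s) :
    |scaledConv m σ v s x - scaledConv m σ v s x'| ≤ s ^ m * (L * (s * ‖x - x'‖) *
      (2 ^ N * volume.real (ball (0 : EuclideanSpace ℝ (Fin N)) 1) / s ^ N)) := by
  rw [scaledConv, scaledConv, ← mul_sub, abs_mul, abs_of_pos (by positivity : 0 < s ^ m),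
    ← integral_sub (h.integrable_mul hv hs x) (h.integrable_mul hv hs x')]
  gcongr
  rw [← setIntegral_eq_integral_of_forall_compl_eq_zero (s := closedBall x' (2 / s))]
  · have h1 := norm_setIntegral_le_of_norm_le_const (μ := volume) (s := closedBall x' (2 / s))
      (f := fun y => v y * σ (s • (x - y)) - v y * σ (s • (x' - y)))
      (C := L * (s * ‖x - x'‖)) measure_closedBall_lt_top fun y hy => by
        rw [← mul_sub, norm_mul]
        have h2 := hL (s • (x - y)) (s • (x' - y))
        rw [← smul_sub, norm_smul, sub_sub_sub_cancel_right, Real.norm_of_nonneg hs.le] at h2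
        exact (mul_le_of_le_one_left (norm_nonneg _) (hv1 y)).trans h2
    rw [volume_closedBall_one_div x' hs 2 zero_le_two] at h1
    exact h1
  · intro y hy
    have h2 : (2 : ℝ) / s = 1 / s + 1 / s := by ring
    rw [mem_closedBall, not_le, h2] at hy
    have hs' : 0 < 1 / s := by positivity
    have h3 : y ∉ closedBall x (1 / s) := by
      rw [mem_closedBall, not_le]
      have := dist_triangle y x x'
      rw [dist_eq_norm x x'] at this
      linarith
    have h4 : y ∉ closedBall x' (1 / s) := by
      rw [mem_closedBall, not_le]
      linarith
    rw [h.comp_smul_sub_eq_zero hs h3, h.comp_smul_sub_eq_zero hs h4]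
    simp

lemma ContDiff.exists_bound_of_hasCompactSupport {F : Type*} [NormedAddCommGroup F]
    [NormedSpace ℝ F] {f : EuclideanSpace ℝ (Fin N) → F} (h : ContDiff ℝ (⊤ : ℕ∞) f)
    (hc : HasCompactSupport f) : ∃ C, ∀ x, ‖f x‖ ≤ C :=
  hc.exists_bound_of_continuous h.continuous

lemma ContDiff.exists_lipschitz_of_hasCompactSupport {F : Type*} [NormedAddCommGroup F]
    [NormedSpace ℝ F] {f : EuclideanSpace ℝ (Fin N) → F} (h : ContDiff ℝ (⊤ : ℕ∞) f)
    (hc : HasCompactSupport f) : ∃ L : ℝ, ∀ x y, ‖f x - f y‖ ≤ L * ‖x - y‖ := by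
  obtain ⟨L, hL⟩ := ContDiff.lipschitzWith_of_hasCompactSupport hc h (by simp)
  exact ⟨L, hL.norm_sub_le⟩

lemma abs_apply_apply_le (T : EuclideanSpace ℝ (Fin N) →L[ℝ] EuclideanSpace ℝ (Fin N) →L[ℝ] ℝ)
    {e : EuclideanSpace ℝ (Fin N)} (he : ‖e‖ = 1) : |T e e| ≤ ‖T‖ := by
  simpa [he] using T.le_opNorm₂ e e

lemma exists_bound_apply_apply
    {T : EuclideanSpace ℝ (Fin N) → EuclideanSpace ℝ (Fin N) →L[ℝ] EuclideanSpace ℝ (Fin N) →L[ℝ] ℝ}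
    (hT : ContDiff ℝ (⊤ : ℕ∞) T) (hc : HasCompactSupport T) :
    ∃ B : ℝ, ∀ e, ‖e‖ = 1 → ∀ x, |T x e e| ≤ B := by
  obtain ⟨B, hB⟩ := hT.exists_bound_of_hasCompactSupport hc
  exact ⟨B, fun e he x => (abs_apply_apply_le _ he).trans (hB x)⟩

lemma exists_lipschitz_apply_apply
    {T : EuclideanSpace ℝ (Fin N) → EuclideanSpace ℝ (Fin N) →L[ℝ] EuclideanSpace ℝ (Fin N) →L[ℝ] ℝ}
    (hT : ContDiff ℝ (⊤ : ℕ∞) T) (hc : HasCompactSupport T) :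
    ∃ L : ℝ, ∀ e, ‖e‖ = 1 → ∀ x y, |T x e e - T y e e| ≤ L * ‖x - y‖ := by
  obtain ⟨L, hL⟩ := hT.exists_lipschitz_of_hasCompactSupport hc
  exact ⟨L, fun e he x y => (abs_apply_apply_le (T x - T y) he).trans (hL x y)⟩

lemma IsUnitBump.exists_uniform_bound {σ : EuclideanSpace ℝ (Fin N) → ℝ} (h : IsUnitBump σ) :
    ∃ B, 0 < B ∧ ∀ e, ‖e‖ = 1 → (∀ x, |σ x| ≤ B) ∧ (∀ x, |_root_.dirDeriv e σ x| ≤ B) ∧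
      (∀ x, |_root_.dirDeriv e (_root_.dirDeriv e σ) x| ≤ B) ∧
      ∀ a b, |_root_.dirDeriv e (_root_.dirDeriv e σ) a -
        _root_.dirDeriv e (_root_.dirDeriv e σ) b| ≤ B * ‖a - b‖ := by
  have hs1 : ContDiff ℝ (⊤ : ℕ∞) (fderiv ℝ σ) := h.smooth.fderiv_right (by simp)
  have hs2 : ContDiff ℝ (⊤ : ℕ∞) (fderiv ℝ (fderiv ℝ σ)) := hs1.fderiv_right (by simp)
  have hc1 := h.hasCompactSupport.fderiv ℝ
  have hc2 := hc1.fderiv ℝ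
  obtain ⟨B0, h0⟩ := h.smooth.exists_bound_of_hasCompactSupport h.hasCompactSupport
  obtain ⟨B1, h1⟩ := hs1.exists_bound_of_hasCompactSupport hc1
  obtain ⟨B2, h2⟩ := exists_bound_apply_apply hs2 hc2
  obtain ⟨B3, h3⟩ := exists_lipschitz_apply_apply hs2 hc2
  obtain ⟨B, hB⟩ : ∃ B : ℝ, B = |B0| + |B1| + |B2| + |B3| + 1 := ⟨_, rfl⟩
  have a0 := le_abs_self B0
  have a1 := le_abs_self B1
  have a2 := le_abs_self B2
  have a3 := le_abs_self B3
  have b0 := abs_nonneg B0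
  have b1 := abs_nonneg B1
  have b2 := abs_nonneg B2
  have b3 := abs_nonneg B3
  refine ⟨B, by linarith, fun e he => ⟨fun x => ?_, fun x => ?_, fun x => ?_, fun a b => ?_⟩⟩
  · exact (h0 x).trans (by linarith)
  · have h4 : ‖fderiv ℝ σ x e‖ ≤ ‖fderiv ℝ σ x‖ * ‖e‖ := (fderiv ℝ σ x).le_opNorm e
    rw [he, mul_one] at h4
    exact h4.trans ((h1 x).trans (by linarith))
  · rw [dirDeriv_dirDeriv h.smooth]
    exact (h2 e he x).trans (by linarith)
  · rw [dirDeriv_dirDeriv h.smooth, dirDeriv_dirDeriv h.smooth]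
    exact (h3 e he a b).trans (mul_le_mul_of_nonneg_right (by linarith) (norm_nonneg _))

lemma scaledConv_mollifier_const {k ρ : EuclideanSpace ℝ (Fin N) → ℝ}
    (h : IsMollifierKernel N k ρ) {s : ℝ} (hs : 0 < s) (x : EuclideanSpace ℝ (Fin N)) :
    s ^ N * ∫ y, ρ (s • (x - y)) = 1 := by
  rw [integral_sub_left_eq_self (fun y => ρ (s • y)) volume x,
    Measure.integral_comp_smul_of_nonneg volume ρ s (hR := hs.le), h.integral_mollifier,
    finrank_euclideanSpace_fin]
  simp [hs.ne']

lemma scaledConv_mollifier_sub {k ρ v : EuclideanSpace ℝ (Fin N) → ℝ}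
    (h : IsMollifierKernel N k ρ) (hv : LocallyIntegrable v) {s : ℝ} (hs : 0 < s) (c : ℝ)
    (x : EuclideanSpace ℝ (Fin N)) :
    scaledConv N ρ (fun y => v y - c) s x = scaledConv N ρ v s x - c := by
  have h1 := h.isKernelPair.right.integrable_mul hv hs x
  have h2 := h.isKernelPair.right.integrable_mul (locallyIntegrable_const c) hs x
  have h3 := scaledConv_mollifier_const h hs x
  simp only [scaledConv, sub_mul]
  rw [integral_sub h1 h2, integral_const_mul, mul_sub]
  linear_combination (-c) * h3

lemma tendsto_scaledConv_mollifier {k ρ v : EuclideanSpace ℝ (Fin N) → ℝ}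
    (h : IsMollifierKernel N k ρ) (hv : Continuous v) (x : EuclideanSpace ℝ (Fin N)) :
    Tendsto (fun s => scaledConv N ρ v s x) atTop (𝓝 (v x)) := by
  obtain ⟨B, hB0, hB⟩ := h.isKernelPair.right.exists_bound
  set V := volume.real (ball (0 : EuclideanSpace ℝ (Fin N)) 1)
  rw [Metric.tendsto_atTop]
  intro ε hε
  have hV : 0 ≤ V := measureReal_nonneg
  obtain ⟨δ, hδ, hvδ⟩ := Metric.continuous_iff.1 hv x (ε / (2 * (B * V + 1))) (by positivity)
  refine ⟨2 / δ, fun s hs => ?_⟩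
  have hs0 : 0 < s := lt_of_lt_of_le (by positivity) hs
  have hsδ : 1 / s < δ := by
    rw [ge_iff_le, div_le_iff₀ hδ] at hs
    rw [div_lt_iff₀ hs0]
    linarith
  rw [Real.dist_eq, ← scaledConv_mollifier_sub h hv.locallyIntegrable hs0]
  refine (abs_scaledConv_le h.isKernelPair.right hs0 (M := ε / (2 * (B * V + 1)))
    (by positivity) (fun y hy => ?_) hB).trans_lt ?_
  · exact (hvδ y ((mem_closedBall.1 hy).trans_lt hsδ)).le
  · have h1 : s ^ N * (ε / (2 * (B * V + 1)) * B * (V / s ^ N)) =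
        ε * ((B * V) / (2 * (B * V + 1))) := by
      field_simp
    change s ^ N * (ε / (2 * (B * V + 1)) * B * (V / s ^ N)) < ε
    rw [h1]
    apply mul_lt_of_lt_one_right hε
    rw [div_lt_one (by positivity)]
    nlinarith [mul_nonneg hB0.le hV]

lemma tendsto_scaledConv_of_isLittleO {σ v : EuclideanSpace ℝ (Fin N) → ℝ} (h : IsUnitBump σ)
    {p : EuclideanSpace ℝ (Fin N)} (hv : HasFDerivAt v (0 : EuclideanSpace ℝ (Fin N) →L[ℝ] ℝ) p)
    (hp : v p = 0) :
    Tendsto (fun s => scaledConv (N + 1) σ v s p) atTop (𝓝 0) := by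
  obtain ⟨B, hB0, hB⟩ := h.exists_bound
  set V := volume.real (ball (0 : EuclideanSpace ℝ (Fin N)) 1)
  rw [Metric.tendsto_atTop]
  intro ε hε
  have hV : 0 ≤ V := measureReal_nonneg
  have hc : 0 < ε / (2 * (B * V + 1)) := by positivity
  have hlo := (hasFDerivAt_iff_isLittleO.1 hv).def hc
  obtain ⟨δ, hδ, hvδ⟩ := Metric.eventually_nhds_iff.1 hlo
  refine ⟨2 / δ, fun s hs => ?_⟩
  have hs0 : 0 < s := lt_of_lt_of_le (by positivity) hs
  have hsδ : 1 / s < δ := by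
    rw [ge_iff_le, div_le_iff₀ hδ] at hs
    rw [div_lt_iff₀ hs0]
    linarith
  rw [Real.dist_eq, sub_zero]
  refine (abs_scaledConv_le h hs0 (M := ε / (2 * (B * V + 1)) * (1 / s))
    (by positivity) (fun y hy => ?_) hB).trans_lt ?_
  · have h1 := hvδ ((mem_closedBall.1 hy).trans_lt hsδ)
    simp only [hp, sub_zero, zero_apply, Real.norm_eq_abs] at h1
    refine h1.trans ?_
    gcongr
    rw [← dist_eq_norm]
    exact hy
  · have h1 : s ^ (N + 1) * (ε / (2 * (B * V + 1)) * (1 / s) * B * (V / s ^ N)) =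
        ε * ((B * V) / (2 * (B * V + 1))) := by
      field_simp
      ring
    change s ^ (N + 1) * (ε / (2 * (B * V + 1)) * (1 / s) * B * (V / s ^ N)) < ε
    rw [h1]
    apply mul_lt_of_lt_one_right hε
    rw [div_lt_one (by positivity)]
    nlinarith [mul_nonneg hB0.le hV]

lemma hasCompactSupport_dirDeriv {f : EuclideanSpace ℝ (Fin N) → ℝ} (h : HasCompactSupport f)
    (e : EuclideanSpace ℝ (Fin N)) : HasCompactSupport (dirDeriv e f) :=
  h.fderiv_apply ℝ e

lemma integral_mul_dirDeriv {f g : EuclideanSpace ℝ (Fin N) → ℝ}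
    (hf : ContDiff ℝ (⊤ : ℕ∞) f) (hg : ContDiff ℝ (⊤ : ℕ∞) g) (hfc : HasCompactSupport f)
    (hgc : HasCompactSupport g) (e : EuclideanSpace ℝ (Fin N)) :
    ∫ x, f x * dirDeriv e g x = -∫ x, dirDeriv e f x * g x := by
  refine integral_mul_fderiv_eq_neg_fderiv_mul_of_integrable ?_ ?_ ?_
    (fun x _ => hf.differentiable (by simp) x) (fun x _ => hg.differentiable (by simp) x)
  · exact ((contDiff_dirDeriv hf e).continuous.mul hg.continuous).integrable_of_hasCompactSupport
      hgc.mul_left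
  · exact (hf.continuous.mul (contDiff_dirDeriv hg e).continuous).integrable_of_hasCompactSupport
      hfc.mul_right
  · exact (hf.continuous.mul hg.continuous).integrable_of_hasCompactSupport hgc.mul_left

section Hessian

variable {G : EuclideanSpace ℝ (Fin N) → ℝ}

lemma integral_dirDeriv_dirDeriv_sq (hG : ContDiff ℝ (⊤ : ℕ∞) G) (hc : HasCompactSupport G)
    (a b : EuclideanSpace ℝ (Fin N)) :
    ∫ x, dirDeriv a (dirDeriv b G) x ^ 2 =
      ∫ x, dirDeriv a (dirDeriv a G) x * dirDeriv b (dirDeriv b G) x := by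
  have h1 := integral_mul_dirDeriv (contDiff_dirDeriv (contDiff_dirDeriv hG b) a)
    (contDiff_dirDeriv hG b) (hasCompactSupport_dirDeriv (hasCompactSupport_dirDeriv hc b) a)
    (hasCompactSupport_dirDeriv hc b) a
  have h2 := integral_mul_dirDeriv (contDiff_dirDeriv (contDiff_dirDeriv hG a) a)
    (contDiff_dirDeriv hG b) (hasCompactSupport_dirDeriv (hasCompactSupport_dirDeriv hc a) a)
    (hasCompactSupport_dirDeriv hc b) b
  rw [h2]
  simp only [sq]
  rw [h1, dirDeriv_comm (contDiff_dirDeriv hG a) b a, dirDeriv_comm hG b a]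

lemma dirDeriv_dirDeriv_sq_le (hG : ContDiff ℝ (⊤ : ℕ∞) G) {e : EuclideanSpace ℝ (Fin N)}
    (he : ‖e‖ = 1) (x : EuclideanSpace ℝ (Fin N)) :
    dirDeriv e (dirDeriv e G) x ^ 2 ≤ ∑ q : Fin N × Fin N,
      dirDeriv (EuclideanSpace.single q.1 1) (dirDeriv (EuclideanSpace.single q.2 1) G) x ^ 2 := by
  have hsum : e = ∑ i, e i • EuclideanSpace.single i (1 : ℝ) := by
    ext j
    simp [Finset.sum_apply, Pi.single_apply]
  have h1 : dirDeriv e (dirDeriv e G) x = ∑ q : Fin N × Fin N, (e q.1 * e q.2) *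
      dirDeriv (EuclideanSpace.single q.1 1) (dirDeriv (EuclideanSpace.single q.2 1) G) x := by
    simp only [dirDeriv_dirDeriv hG]
    conv_lhs => rw [hsum]
    simp only [map_sum, map_smul, sum_apply, smul_apply, smul_eq_mul, Fintype.sum_prod_type,
      Finset.mul_sum]
    rw [Finset.sum_comm]
    refine Finset.sum_congr rfl fun i _ => Finset.sum_congr rfl fun j _ => ?_
    ring
  have h2 : ∑ q : Fin N × Fin N, (e q.1 * e q.2) ^ 2 = 1 := by
    simp only [mul_pow, Fintype.sum_prod_type]
    rw [← Finset.sum_mul_sum, ← EuclideanSpace.real_norm_sq_eq, he]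
    norm_num
  rw [h1]
  refine (Finset.sum_mul_sq_le_sq_mul_sq _ _ _).trans ?_
  rw [h2, one_mul]

lemma integral_dirDeriv_dirDeriv_sq_le (hG : ContDiff ℝ (⊤ : ℕ∞) G) (hc : HasCompactSupport G)
    {e : EuclideanSpace ℝ (Fin N)} (he : ‖e‖ = 1) :
    ∫ x, dirDeriv e (dirDeriv e G) x ^ 2 ≤ ∫ x, lap N G x ^ 2 := by
  have hs : ∀ a b : EuclideanSpace ℝ (Fin N), ContDiff ℝ (⊤ : ℕ∞) (dirDeriv a (dirDeriv b G)) :=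
    fun a b => contDiff_dirDeriv (contDiff_dirDeriv hG b) a
  have hcs : ∀ a b : EuclideanSpace ℝ (Fin N), HasCompactSupport (dirDeriv a (dirDeriv b G)) :=
    fun a b => hasCompactSupport_dirDeriv (hasCompactSupport_dirDeriv hc b) a
  have hmul : ∀ a b c d : EuclideanSpace ℝ (Fin N), Integrable fun x =>
      dirDeriv a (dirDeriv b G) x * dirDeriv c (dirDeriv d G) x := fun a b c d =>
    ((hs a b).continuous.mul (hs c d).continuous).integrable_of_hasCompactSupport
      (hcs c d).mul_left
  have hsq : ∀ a b : EuclideanSpace ℝ (Fin N), Integrable fun x =>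
      dirDeriv a (dirDeriv b G) x ^ 2 := fun a b => by simpa only [sq] using hmul a b a b
  calc ∫ x, dirDeriv e (dirDeriv e G) x ^ 2
      ≤ ∫ x, ∑ q : Fin N × Fin N, dirDeriv (EuclideanSpace.single q.1 1)
          (dirDeriv (EuclideanSpace.single q.2 1) G) x ^ 2 :=
        integral_mono (hsq e e) (integrable_finsetSum _ fun q _ => hsq _ _)
          fun x => dirDeriv_dirDeriv_sq_le hG he x
    _ = ∑ q : Fin N × Fin N, ∫ x, dirDeriv (EuclideanSpace.single q.1 1)
          (dirDeriv (EuclideanSpace.single q.1 1) G) x * dirDeriv (EuclideanSpace.single q.2 1)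
          (dirDeriv (EuclideanSpace.single q.2 1) G) x := by
        rw [integral_finsetSum _ fun q _ => hsq _ _]
        exact Finset.sum_congr rfl fun q _ => integral_dirDeriv_dirDeriv_sq hG hc _ _
    _ = ∫ x, lap N G x ^ 2 := by
        rw [← integral_finsetSum _ fun q _ => hmul _ _ _ _]
        congr 1
        funext x
        rw [lap_eq_sum_dirDeriv, sq, Finset.sum_mul_sum, Fintype.sum_prod_type]

end Hessian

lemma sq_intervalIntegral_le {g : ℝ → ℝ} (hg : Continuous g) {t : ℝ} (ht : 0 < t) :
    (∫ τ in (0 : ℝ)..t, g τ) ^ 2 ≤ t * ∫ τ in (0 : ℝ)..t, g τ ^ 2 := by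
  set I := ∫ τ in (0 : ℝ)..t, g τ with hI
  have h0 : 0 ≤ ∫ τ in (0 : ℝ)..t, (t * g τ - I) ^ 2 :=
    intervalIntegral.integral_nonneg ht.le fun _ _ => sq_nonneg _
  have h1 : ∫ τ in (0 : ℝ)..t, (t * g τ - I) ^ 2 =
      t ^ 2 * (∫ τ in (0 : ℝ)..t, g τ ^ 2) - t * I ^ 2 := by
    have : ∀ τ, (t * g τ - I) ^ 2 = t ^ 2 * g τ ^ 2 - (2 * t * I) * g τ + I ^ 2 := fun τ => by ring
    simp only [this]
    rw [intervalIntegral.integral_add, intervalIntegral.integral_sub,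
      intervalIntegral.integral_const_mul, intervalIntegral.integral_const_mul,
      intervalIntegral.integral_const, ← hI]
    · simp only [smul_eq_mul]
      ring
    all_goals exact Continuous.intervalIntegrable (by fun_prop) _ _
  rw [h1] at h0
  have h2 : 0 ≤ t * (t * (∫ τ in (0 : ℝ)..t, g τ ^ 2) - I ^ 2) := by linarith
  have := nonneg_of_mul_nonneg_right h2 ht
  linarith

lemma integral_intervalIntegral_translate {h : EuclideanSpace ℝ (Fin N) → ℝ} (hc : Continuous h)
    (hs : HasCompactSupport h) {t : ℝ} (ht : 0 < t) (e : EuclideanSpace ℝ (Fin N)) :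
    Integrable (fun x => ∫ τ in (0 : ℝ)..t, h (x + τ • e)) ∧
      ∫ x, ∫ τ in (0 : ℝ)..t, h (x + τ • e) = t * ∫ x, h x := by
  simp only [intervalIntegral.integral_of_le ht.le]
  have hi : Integrable h := hc.integrable_of_hasCompactSupport hs
  have hprod : Integrable (Function.uncurry fun τ x => h (x + τ • e))
      ((volume.restrict (Ioc 0 t)).prod volume) := by
    rw [integrable_prod_iff (Continuous.aestronglyMeasurable (by fun_prop))]
    refine ⟨Eventually.of_forall fun τ => hi.comp_add_right (τ • e), ?_⟩
    simp only [Function.uncurry_apply_pair]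
    have : ∀ τ : ℝ, ∫ x, ‖h (x + τ • e)‖ = ∫ x, ‖h x‖ := fun τ =>
      integral_add_right_eq_self (fun x => ‖h x‖) (τ • e)
    simp only [this]
    exact integrable_const _
  refine ⟨hprod.integral_prod_right, ?_⟩
  rw [← integral_integral_swap hprod]
  have : ∀ τ : ℝ, ∫ x, h (x + τ • e) = ∫ x, h x := fun τ => integral_add_right_eq_self h (τ • e)
  simp [this, ht.le]

lemma integral_translate_sub_sq_le {F : EuclideanSpace ℝ (Fin N) → ℝ}
    (hF : ContDiff ℝ (⊤ : ℕ∞) F) (hc : HasCompactSupport F) {t : ℝ} (ht : 0 < t)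
    (e : EuclideanSpace ℝ (Fin N)) :
    ∫ x, (F (x + t • e) - F x) ^ 2 ≤ t ^ 2 * ∫ x, dirDeriv e F x ^ 2 := by
  have hd := (contDiff_dirDeriv hF e).continuous
  have hdc := hasCompactSupport_dirDeriv hc e
  have h1 : ∀ x, (F (x + t • e) - F x) ^ 2 ≤
      t * ∫ τ in (0 : ℝ)..t, dirDeriv e F (x + τ • e) ^ 2 := by
    intro x
    have h2 := intervalIntegral.integral_eq_sub_of_hasDerivAt (a := 0) (b := t)
      (fun τ _ => hasDerivAt_line hF x e τ) (Continuous.intervalIntegrable (by fun_prop) _ _)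
    rw [zero_smul, add_zero] at h2
    rw [← h2]
    exact sq_intervalIntegral_le (by fun_prop) ht
  have hsc : HasCompactSupport fun x => dirDeriv e F x ^ 2 := by
    simp only [sq]
    exact hdc.mul_left
  obtain ⟨hi, heq⟩ := integral_intervalIntegral_translate
    (h := fun x => dirDeriv e F x ^ 2) (hd.pow 2) hsc ht e
  refine (integral_mono_of_nonneg (Eventually.of_forall fun x => sq_nonneg _)
    (hi.const_mul t) (Eventually.of_forall h1)).trans ?_
  rw [integral_const_mul, heq]
  exact le_of_eq (by ring)

lemma integral_second_difference_sq_le {G : EuclideanSpace ℝ (Fin N) → ℝ}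
    (hG : ContDiff ℝ (⊤ : ℕ∞) G) (hc : HasCompactSupport G) {t : ℝ} (ht : 0 < t)
    {e : EuclideanSpace ℝ (Fin N)} (he : ‖e‖ = 1) :
    ∫ x, (G (x + t • e + t • e) - 2 * G (x + t • e) + G x) ^ 2 ≤ t ^ 4 * ∫ x, lap N G x ^ 2 := by
  have htr : ContDiff ℝ (⊤ : ℕ∞) fun x => G (x + t • e) := hG.comp (by fun_prop)
  have hD : ContDiff ℝ (⊤ : ℕ∞) fun x => G (x + t • e) - G x := htr.sub hG
  have hDc : HasCompactSupport fun x => G (x + t • e) - G x :=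
    (hc.comp_homeomorph (Homeomorph.addRight (t • e))).sub hc
  have hdD : dirDeriv e (fun x => G (x + t • e) - G x) =
      fun x => dirDeriv e G (x + t • e) - dirDeriv e G x := by
    funext x
    simp only [dirDeriv]
    rw [fderiv_fun_sub (htr.differentiable (by simp) x) (hG.differentiable (by simp) x),
      fderiv_comp_add_right]
    rfl
  calc ∫ x, (G (x + t • e + t • e) - 2 * G (x + t • e) + G x) ^ 2
      = ∫ x, ((G (x + t • e + t • e) - G (x + t • e)) - (G (x + t • e) - G x)) ^ 2 := by
        congr 1; funext x; ring
    _ ≤ t ^ 2 * ∫ x, dirDeriv e (fun x => G (x + t • e) - G x) x ^ 2 :=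
        integral_translate_sub_sq_le hD hDc ht e
    _ ≤ t ^ 2 * (t ^ 2 * ∫ x, dirDeriv e (dirDeriv e G) x ^ 2) := by
        rw [hdD]
        refine mul_le_mul_of_nonneg_left ?_ (sq_nonneg t)
        exact integral_translate_sub_sq_le (contDiff_dirDeriv hG e)
          (hasCompactSupport_dirDeriv hc e) ht e
    _ ≤ t ^ 2 * (t ^ 2 * ∫ x, lap N G x ^ 2) := by
        refine mul_le_mul_of_nonneg_left (mul_le_mul_of_nonneg_left ?_ (sq_nonneg t)) (sq_nonneg t)
        exact integral_dirDeriv_dirDeriv_sq_le hG hc he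
    _ = t ^ 4 * ∫ x, lap N G x ^ 2 := by ring

lemma tendsto_volume_diff_translate {S : Set (EuclideanSpace ℝ (Fin N))} (hS : MeasurableSet S)
    (hfin : volume S ≠ ⊤) (e : EuclideanSpace ℝ (Fin N)) :
    Tendsto (fun t : ℝ => volume.real (S \ {x | x + t • e ∈ S})) (𝓝 0) (𝓝 0) := by
  let f : ℝ → C(EuclideanSpace ℝ (Fin N), EuclideanSpace ℝ (Fin N)) :=
    fun t => ⟨fun x => x + t • e, by fun_prop⟩
  have hf : Continuous f := ContinuousMap.continuous_of_continuous_uncurry f (by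
    change Continuous fun q : ℝ × EuclideanSpace ℝ (Fin N) => q.2 + q.1 • e
    fun_prop)
  have hmp : ∀ t, MeasurePreserving (f t) := fun t => measurePreserving_add_right volume (t • e)
  have h1 := tendsto_measure_symmDiff_preimage_nhds_zero (hf.tendsto 0)
    (Eventually.of_forall hmp) (hmp 0) hS.nullMeasurableSet hfin
  have h2 := (ENNReal.tendsto_toReal ENNReal.zero_ne_top).comp h1
  simp only [ENNReal.toReal_zero] at h2
  refine squeeze_zero' (Eventually.of_forall fun _ => measureReal_nonneg) ?_ h2
  filter_upwards with t
  have h0 : (f 0) ⁻¹' S = S := by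
    ext x
    simp [f]
  rw [h0]
  have hpre : volume ((f t) ⁻¹' S) ≠ ⊤ := by
    rw [(hmp t).measure_preimage hS.nullMeasurableSet]
    exact hfin
  exact measureReal_mono (fun x hx => Or.inr ⟨hx.1, fun h => hx.2 h⟩)
    (measure_symmDiff_ne_top hpre hfin)

lemma tendsto_volume_inter_translate {S : Set (EuclideanSpace ℝ (Fin N))} (hS : MeasurableSet S)
    (hfin : volume S ≠ ⊤) (e : EuclideanSpace ℝ (Fin N)) :
    Tendsto (fun t : ℝ => volume.real {x | x ∈ S ∧ x + t • e ∈ S ∧ x + t • e + t • e ∈ S})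
      (𝓝 0) (𝓝 (volume.real S)) := by
  have h1 := tendsto_volume_diff_translate hS hfin e
  have h2 := tendsto_volume_diff_translate hS hfin ((2 : ℝ) • e)
  have h3 := (tendsto_const_nhds (x := volume.real S)).sub (h1.add h2)
  rw [add_zero, sub_zero] at h3
  refine tendsto_of_tendsto_of_tendsto_of_le_of_le h3 tendsto_const_nhds (fun t => ?_) fun t =>
    measureReal_mono (fun x hx => hx.1) hfin
  simp only
  have hsub : S ⊆ ({x | x ∈ S ∧ x + t • e ∈ S ∧ x + t • e + t • e ∈ S} ∪
      (S \ {x | x + t • e ∈ S} ∪ S \ {x | x + t • (2 : ℝ) • e ∈ S})) := by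
    intro x hx
    by_cases ha : x + t • e ∈ S
    · by_cases hb : x + t • (2 : ℝ) • e ∈ S
      · refine Or.inl ⟨hx, ha, ?_⟩
        rwa [show x + t • e + t • e = x + t • (2 : ℝ) • e by module]
      · exact Or.inr (Or.inr ⟨hx, hb⟩)
    · exact Or.inr (Or.inl ⟨hx, ha⟩)
  have hle := measureReal_mono (μ := volume) hsub (ne_top_of_le_ne_top hfin
    (measure_mono (by rintro x (hx | hx | hx) <;> exact hx.1)))
  have := measureReal_union_le (μ := volume) {x | x ∈ S ∧ x + t • e ∈ S ∧ x + t • e + t • e ∈ S}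
    (S \ {x | x + t • e ∈ S} ∪ S \ {x | x + t • (2 : ℝ) • e ∈ S})
  have := measureReal_union_le (μ := volume) (S \ {x | x + t • e ∈ S})
    (S \ {x | x + t • (2 : ℝ) • e ∈ S})
  linarith

lemma abs_scaledConv_indicator_one_le (q : ℕ) {σ : EuclideanSpace ℝ (Fin N) → ℝ} {s B : ℝ}
    (h : IsUnitBump σ) (hs : 0 < s) (hB : ∀ w, |σ w| ≤ B) (S : Set (EuclideanSpace ℝ (Fin N)))
    (x : EuclideanSpace ℝ (Fin N)) :
    |scaledConv (N + q) σ (S.indicator fun _ => 1) s x| ≤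
      s ^ q * (B * volume.real (ball (0 : EuclideanSpace ℝ (Fin N)) 1)) := by
  refine (abs_scaledConv_le h hs zero_le_one (fun y _ => abs_indicator_one_le S y) hB).trans ?_
  rw [pow_add, one_mul]
  refine le_of_eq ?_
  field_simp

lemma hasCompactSupport_scaledConv (m : ℕ) {σ v : EuclideanSpace ℝ (Fin N) → ℝ} {s : ℝ}
    (h : IsUnitBump σ) (hv : HasCompactSupport v) (hs : 0 < s) :
    HasCompactSupport (scaledConv m σ v s) := by
  rw [scaledConv_eq_convolution]
  exact (HasCompactSupport.convolution (μ := volume) (ContinuousLinearMap.mul ℝ ℝ) hv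
    (h.hasCompactSupport_comp_smul hs)).mul_left (f := fun _ => s ^ m)

/-- A partial sum of the series representing the Newtonian potential of `v`. -/
def partialPotential (k v : EuclideanSpace ℝ (Fin N) → ℝ) (s : ℝ) (n : ℕ)
    (x : EuclideanSpace ℝ (Fin N)) : ℝ :=
  ∑ i ∈ Finset.range n, ((s * 2 ^ i) ^ 2)⁻¹ * scaledConv N k v (s * 2 ^ i) x

section partialPotential

variable {k ρ v : EuclideanSpace ℝ (Fin N) → ℝ} {s : ℝ}

lemma contDiff_partialPotential (h : IsUnitBump k) (hv : LocallyIntegrable v) (hs : 0 < s)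
    (n : ℕ) : ContDiff ℝ (⊤ : ℕ∞) (partialPotential k v s n) :=
  ContDiff.sum fun _ _ => contDiff_const.mul (contDiff_scaledConv N h hv (by positivity))

lemma hasCompactSupport_partialPotential (h : IsUnitBump k) (hv : HasCompactSupport v)
    (hs : 0 < s) (n : ℕ) : HasCompactSupport (partialPotential k v s n) := by
  induction n with
  | zero =>
    have : partialPotential k v s 0 = 0 := by
      funext x
      simp [partialPotential]
    rw [this]
    exact HasCompactSupport.zero
  | succ n ih =>
    have : partialPotential k v s (n + 1) = partialPotential k v s n +
        fun x => ((s * 2 ^ n) ^ 2)⁻¹ * scaledConv N k v (s * 2 ^ n) x := by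
      funext x
      simp [partialPotential, Finset.sum_range_succ]
    rw [this]
    exact ih.add ((hasCompactSupport_scaledConv N h hv (by positivity)).mul_left
      (f := fun _ => ((s * 2 ^ n) ^ 2)⁻¹))

lemma lap_partialPotential (h : IsKernelPair N k ρ) (hv : LocallyIntegrable v) (hs : 0 < s)
    (n : ℕ) (x : EuclideanSpace ℝ (Fin N)) :
    lap N (partialPotential k v s n) x = scaledConv N ρ v s x - scaledConv N ρ v (s * 2 ^ n) x := by
  have hsm : ∀ i : ℕ, ContDiff ℝ (⊤ : ℕ∞) (scaledConv N k v (s * 2 ^ i)) := fun i =>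
    contDiff_scaledConv N h.left hv (by positivity)
  have h1 : ∀ e, dirDeriv e (partialPotential k v s n) = fun x => ∑ i ∈ Finset.range n,
      ((s * 2 ^ i) ^ 2)⁻¹ * dirDeriv e (scaledConv N k v (s * 2 ^ i)) x := fun e => by
    unfold partialPotential
    rw [dirDeriv_sum _ fun i _ => contDiff_const.mul (hsm i)]
    simp only [dirDeriv_const_mul (hsm _)]
  have h2 : ∀ e, dirDeriv e (dirDeriv e (partialPotential k v s n)) = fun x =>
      ∑ i ∈ Finset.range n,
      ((s * 2 ^ i) ^ 2)⁻¹ * dirDeriv e (dirDeriv e (scaledConv N k v (s * 2 ^ i))) x := fun e => by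
    rw [h1, dirDeriv_sum _ fun i _ => contDiff_const.mul (contDiff_dirDeriv (hsm i) e)]
    simp only [dirDeriv_const_mul (contDiff_dirDeriv (hsm _) e)]
  have h3 : ∀ i : ℕ, ((s * 2 ^ i) ^ 2)⁻¹ * lap N (scaledConv N k v (s * 2 ^ i)) x =
      scaledConv N ρ v (s * 2 ^ i) x - scaledConv N ρ v (s * 2 ^ (i + 1)) x := fun i => by
    rw [lap_scaledConv N h.left hv (by positivity), h.scaledConv_lap hv (by positivity),
      inv_mul_cancel_left₀ (by positivity), pow_succ]
    ring_nf
  rw [lap_eq_sum_dirDeriv]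
  simp only [h2]
  rw [Finset.sum_comm]
  simp only [← Finset.mul_sum, ← lap_eq_sum_dirDeriv, h3]
  rw [Finset.sum_range_sub']
  simp

end partialPotential

section energy

variable {k ρ : EuclideanSpace ℝ (Fin N) → ℝ} {s : ℝ} {S : Set (EuclideanSpace ℝ (Fin N))}

lemma scaledConv_mollifier_indicator_mem (h : IsMollifierKernel N k ρ) (S) (hS : MeasurableSet S)
    (hs : 0 < s) (x : EuclideanSpace ℝ (Fin N)) :
    0 ≤ scaledConv N ρ (S.indicator fun _ => 1) s x ∧
      scaledConv N ρ (S.indicator fun _ => 1) s x ≤ 1 := by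
  have h1 : Integrable fun y => ρ (s • (x - y)) := by
    simpa using h.isKernelPair.right.integrable_mul (locallyIntegrable_const (1 : ℝ)) hs x
  rw [scaledConv_indicator N ρ hS, ← scaledConv_mollifier_const h hs x]
  refine ⟨mul_nonneg (by positivity) (integral_nonneg fun y => h.mollifier_nonneg _), ?_⟩
  exact mul_le_mul_of_nonneg_left (setIntegral_le_integral h1
    (Eventually.of_forall fun y => h.mollifier_nonneg _)) (by positivity)

lemma integral_scaledConv_mollifier_indicator (h : IsMollifierKernel N k ρ)
    (hS : MeasurableSet S) (hfin : volume S ≠ ⊤) (hs : 0 < s) :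
    Integrable (scaledConv N ρ (S.indicator fun _ => 1) s) ∧
      ∫ x, scaledConv N ρ (S.indicator fun _ => 1) s x = volume.real S := by
  have h1 : Integrable (S.indicator fun _ => (1 : ℝ)) :=
    (integrable_indicator_iff hS).2 (integrableOn_const hfin)
  have h2 : Integrable fun y => ρ (s • y) :=
    (h.isKernelPair.right.contDiff_comp_smul s).continuous.integrable_of_hasCompactSupport
      (h.isKernelPair.right.hasCompactSupport_comp_smul hs)
  have h3 := scaledConv_mollifier_const h hs 0
  rw [integral_sub_left_eq_self (fun y => ρ (s • y)) volume 0] at h3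
  rw [scaledConv_eq_convolution]
  refine ⟨(h1.integrable_convolution _ h2).const_mul _, ?_⟩
  rw [integral_const_mul, integral_convolution _ h1 h2, integral_indicator hS]
  simp only [integral_const, smul_eq_mul, mul_one, ContinuousLinearMap.mul_apply']
  rw [mul_left_comm, h3, mul_one, measureReal_restrict_apply_univ]

lemma integral_lap_partialPotential_sq_le (h : IsMollifierKernel N k ρ) (hS : MeasurableSet S)
    (hfin : volume S ≠ ⊤) (hs : 0 < s) (n : ℕ) :
    ∫ x, lap N (partialPotential k (S.indicator fun _ => 1) s n) x ^ 2 ≤ 2 * volume.real S := by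
  have hs' : 0 < s * 2 ^ n := by positivity
  obtain ⟨i1, e1⟩ := integral_scaledConv_mollifier_indicator h hS hfin hs
  obtain ⟨i2, e2⟩ := integral_scaledConv_mollifier_indicator h hS hfin hs'
  calc ∫ x, lap N (partialPotential k (S.indicator fun _ => 1) s n) x ^ 2
      ≤ ∫ x, (scaledConv N ρ (S.indicator fun _ => 1) s x +
          scaledConv N ρ (S.indicator fun _ => 1) (s * 2 ^ n) x) := by
        refine integral_mono_of_nonneg (Eventually.of_forall fun x => sq_nonneg _) (i1.add i2)
          (Eventually.of_forall fun x => ?_)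
        simp only
        rw [lap_partialPotential h.isKernelPair (locallyIntegrable_indicator_one hS) hs]
        obtain ⟨a1, a2⟩ := scaledConv_mollifier_indicator_mem h S hS hs x
        obtain ⟨b1, b2⟩ := scaledConv_mollifier_indicator_mem h S hS hs' x
        nlinarith
    _ = 2 * volume.real S := by
        rw [integral_add i1 i2, e1, e2, two_mul]

end energy

lemma exists_second_difference_eq {w : EuclideanSpace ℝ (Fin N) → ℝ}
    (hw : ContDiff ℝ (⊤ : ℕ∞) w) (x e : EuclideanSpace ℝ (Fin N)) {t : ℝ} (ht : 0 < t) :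
    ∃ τ ∈ Icc 0 (2 * t), w (x + t • e + t • e) - 2 * w (x + t • e) + w x =
      t ^ 2 * dirDeriv e (dirDeriv e w) (x + τ • e) := by
  have hd : ∀ τ : ℝ, HasDerivAt (fun τ : ℝ => w (x + t • e + τ • e) - w (x + τ • e))
      (dirDeriv e w (x + t • e + τ • e) - dirDeriv e w (x + τ • e)) τ := fun τ =>
    (hasDerivAt_line hw _ e τ).sub (hasDerivAt_line hw x e τ)
  obtain ⟨τ, hτ, h1⟩ := exists_hasDerivAt_eq_slope _ _ ht
    (fun τ _ => (hd τ).continuousAt.continuousWithinAt) fun τ _ => hd τ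
  have hd2 := fun σ : ℝ => hasDerivAt_line (contDiff_dirDeriv hw e) (x + τ • e) e σ
  obtain ⟨σ, hσ, h2⟩ := exists_hasDerivAt_eq_slope _ _ ht
    (fun σ _ => (hd2 σ).continuousAt.continuousWithinAt) fun σ _ => hd2 σ
  refine ⟨τ + σ, ⟨by linarith [hτ.1, hσ.1], by linarith [hτ.2, hσ.2]⟩, ?_⟩
  rw [add_smul, ← add_assoc, h2]
  rw [sub_zero, eq_div_iff ht.ne'] at h1
  simp only [zero_smul, add_zero, sub_zero] at h1 ⊢
  rw [add_right_comm x (τ • e) (t • e)]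
  field_simp
  linear_combination -h1

/-- A common bound for the derivatives of a mollifier kernel that enter the estimates. -/
structure IsKernelBound (k ρ : EuclideanSpace ℝ (Fin N) → ℝ) (B : ℝ) : Prop where
  pos : 0 < B
  kernel_le : ∀ x, |k x| ≤ B
  dirDeriv_kernel_le : ∀ e, ‖e‖ = 1 → ∀ x, |dirDeriv e k x| ≤ B
  dirDeriv_dirDeriv_kernel_le : ∀ e, ‖e‖ = 1 → ∀ x, |dirDeriv e (dirDeriv e k) x| ≤ B
  dirDeriv_dirDeriv_kernel_sub_le : ∀ e, ‖e‖ = 1 → ∀ x y,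
    |dirDeriv e (dirDeriv e k) x - dirDeriv e (dirDeriv e k) y| ≤ B * ‖x - y‖
  dirDeriv_dirDeriv_mollifier_le : ∀ e, ‖e‖ = 1 → ∀ x, |dirDeriv e (dirDeriv e ρ) x| ≤ B

lemma IsMollifierKernel.exists_isKernelBound [NeZero N] {k ρ : EuclideanSpace ℝ (Fin N) → ℝ}
    (h : IsMollifierKernel N k ρ) : ∃ B, IsKernelBound k ρ B := by
  obtain ⟨B, hB, h1⟩ := h.isKernelPair.left.exists_uniform_bound
  obtain ⟨B', hB', h2⟩ := h.isKernelPair.right.exists_uniform_bound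
  have he : ‖EuclideanSpace.single (0 : Fin N) (1 : ℝ)‖ = 1 := by simp
  exact ⟨B + B', by positivity, fun x => ((h1 _ he).1 x).trans (by linarith),
    fun e he x => ((h1 e he).2.1 x).trans (by linarith),
    fun e he x => ((h1 e he).2.2.1 x).trans (by linarith),
    fun e he x y => ((h1 e he).2.2.2 x y).trans
      (mul_le_mul_of_nonneg_right (by linarith) (norm_nonneg _)),
    fun e he x => ((h2 e he).2.2.1 x).trans (by linarith)⟩

section estimates

variable {z x p e : EuclideanSpace ℝ (Fin N)} {M r s B : ℝ}
  {Ω : Set (EuclideanSpace ℝ (Fin N))} {u k ρ : EuclideanSpace ℝ (Fin N) → ℝ}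

lemma MemP.continuous (hu : MemP N r z M Ω u) : Continuous u := hu.2.1.continuous

lemma MemP.abs_scaledConv_step_le (hu : MemP N r z M Ω u) {q : ℕ}
    {ψ σ : EuclideanSpace ℝ (Fin N) → ℝ} (h : IsKernelPair (N + q) ψ σ) (hB : ∀ x, |ψ x| ≤ B)
    (hs : 0 < s) (hx : closedBall x (1 / s) ⊆ ball z r) :
    |scaledConv (N + q) σ u s x - scaledConv (N + q) σ u (2 * s) x| ≤
      (s ^ 2)⁻¹ * (s ^ q * (B * volume.real (ball (0 : EuclideanSpace ℝ (Fin N)) 1))) := by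
  rw [hu.scaledConv_sub h hs hx, abs_mul, abs_of_pos (by positivity : 0 < (s ^ 2)⁻¹)]
  gcongr
  exact abs_scaledConv_indicator_one_le q h.left hs hB Ω x

lemma one_div_mul_two_pow_le (hs : 0 < s) (n : ℕ) : 1 / (s * 2 ^ n) ≤ 1 / s :=
  one_div_le_one_div_of_le hs (le_mul_of_one_le_right hs.le (one_le_pow₀ one_le_two))

lemma tendsto_mul_two_pow (hs : 0 < s) : Tendsto (fun n : ℕ => s * 2 ^ n) atTop atTop :=
  (tendsto_pow_atTop_atTop_of_one_lt one_lt_two).const_mul_atTop hs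

lemma MemP.abs_sub_mollifier_le (hu : MemP N r z M Ω u) (h : IsMollifierKernel N k ρ)
    (hB : IsKernelBound k ρ B) (hs : 0 < s) (hx : closedBall x (1 / s) ⊆ ball z r) :
    |scaledConv N ρ u s x - u x| ≤
      2 * (B * volume.real (ball (0 : EuclideanSpace ℝ (Fin N)) 1)) / s ^ 2 := by
  set V := volume.real (ball (0 : EuclideanSpace ℝ (Fin N)) 1)
  have hBV : 0 ≤ B * V := mul_nonneg hB.pos.le measureReal_nonneg
  have h1 : ∀ n : ℕ, dist (scaledConv N ρ u (s * 2 ^ n) x) (scaledConv N ρ u (s * 2 ^ (n + 1)) x) ≤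
      2 * (B * V) / s ^ 2 / 2 / 2 ^ n := by
    intro n
    have h2 := hu.abs_scaledConv_step_le (q := 0) h.isKernelPair hB.kernel_le
      (show 0 < s * 2 ^ n by positivity)
      ((closedBall_subset_closedBall (one_div_mul_two_pow_le hs n)).trans hx)
    rw [Real.dist_eq, pow_succ, ← mul_assoc, mul_comm _ (2 : ℝ)]
    refine h2.trans ?_
    rw [pow_zero, one_mul, mul_pow, ← pow_mul]
    change (s ^ 2 * 2 ^ (n * 2))⁻¹ * (B * V) ≤ _
    rw [show 2 * (B * V) / s ^ 2 / 2 / 2 ^ n = (s ^ 2 * 2 ^ n)⁻¹ * (B * V) by field_simp]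
    gcongr
    · exact one_le_two
    · omega
  have h3 := dist_le_of_le_geometric_two_of_tendsto₀ h1
    ((tendsto_scaledConv_mollifier h hu.continuous x).comp (tendsto_mul_two_pow hs))
  simpa [Real.dist_eq] using h3

lemma MemP.abs_dirDeriv_mollifier_le (hu : MemP N r z M Ω u) (h : IsMollifierKernel N k ρ)
    (hB : IsKernelBound k ρ B) (hs : 0 < s) (hp : closedBall p (1 / s) ⊆ ball z r)
    (hup : u p = 0) (hdp : HasFDerivAt u (0 : EuclideanSpace ℝ (Fin N) →L[ℝ] ℝ) p)
    (he : ‖e‖ = 1) :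
    |scaledConv (N + 1) (dirDeriv e ρ) u s p| ≤
      2 * (B * volume.real (ball (0 : EuclideanSpace ℝ (Fin N)) 1)) / s := by
  set V := volume.real (ball (0 : EuclideanSpace ℝ (Fin N)) 1)
  have hpair := h.isKernelPair.dirDeriv e
  have h1 : ∀ n : ℕ, dist (scaledConv (N + 1) (dirDeriv e ρ) u (s * 2 ^ n) p)
      (scaledConv (N + 1) (dirDeriv e ρ) u (s * 2 ^ (n + 1)) p) ≤
      2 * (B * V) / s / 2 / 2 ^ n := by
    intro n
    have h2 := hu.abs_scaledConv_step_le hpair (hB.dirDeriv_kernel_le e he)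
      (show 0 < s * 2 ^ n by positivity)
      ((closedBall_subset_closedBall (one_div_mul_two_pow_le hs n)).trans hp)
    rw [Real.dist_eq, pow_succ, ← mul_assoc, mul_comm _ (2 : ℝ)]
    refine h2.trans (le_of_eq ?_)
    change _ * (_ * (B * V)) = _
    field_simp
  have h3 := dist_le_of_le_geometric_two_of_tendsto₀ h1
    ((tendsto_scaledConv_of_isLittleO hpair.right hdp hup).comp (tendsto_mul_two_pow hs))
  simpa [Real.dist_eq] using h3

lemma MemP.abs_dirDeriv_dirDeriv_mollifier_le (hu : MemP N r z M Ω u)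
    (h : IsMollifierKernel N k ρ) (hB : IsKernelBound k ρ B) (hs : 0 < s) (hM : 0 ≤ M)
    (hx : closedBall x (1 / s) ⊆ ball z r) (he : ‖e‖ = 1) :
    |scaledConv (N + 2) (dirDeriv e (dirDeriv e ρ)) u s x| ≤
      s ^ 2 * (M * B * volume.real (ball (0 : EuclideanSpace ℝ (Fin N)) 1)) := by
  refine (abs_scaledConv_le ((h.isKernelPair.right.dirDeriv e).dirDeriv e) hs hM
    (fun y hy => hu.2.2.2.2.1 y (hx hy)) (hB.dirDeriv_dirDeriv_mollifier_le e he)).trans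
    (le_of_eq ?_)
  rw [pow_add]
  field_simp

lemma MemP.abs_hessian_sub_le (hu : MemP N r z M Ω u) (h : IsMollifierKernel N k ρ)
    (hB : IsKernelBound k ρ B) (hs : 0 < s) (hM : 0 ≤ M)
    (hp : closedBall p (2 / s) ⊆ ball z r) (he : ‖e‖ = 1) (n : ℕ)
    (hx : ‖x - p‖ ≤ 1 / (s * 2 ^ n)) :
    |scaledConv (N + 2) (dirDeriv e (dirDeriv e ρ)) u (s * 2 ^ n) x -
      scaledConv (N + 2) (dirDeriv e (dirDeriv e ρ)) u (s * 2 ^ n) p| ≤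
      (2 * s ^ 2 * M + 2 ^ N) * (B * volume.real (ball (0 : EuclideanSpace ℝ (Fin N)) 1)) := by
  set V := volume.real (ball (0 : EuclideanSpace ℝ (Fin N)) 1) with hV
  have hV0 : 0 ≤ V := measureReal_nonneg
  have hB0 := hB.pos
  set w := scaledConv (N + 2) (dirDeriv e (dirDeriv e ρ)) u with hw
  have hpair := (h.isKernelPair.dirDeriv e).dirDeriv e
  have h12 : 1 / s + 1 / s = 2 / s := by ring
  have hs1 : 0 < 1 / s := by positivity
  have hxs : ‖x - p‖ ≤ 1 / s := hx.trans (one_div_mul_two_pow_le hs n)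
  have hball : ∀ y, ‖y - p‖ ≤ 1 / s → closedBall y (1 / s) ⊆ ball z r := fun y hy =>
    (closedBall_subset_closedBall' (by rw [dist_eq_norm]; linarith)).trans hp
  have hpp : ‖p - p‖ ≤ 1 / s := by simpa using hs1.le
  have key : ∀ i ≤ n, |w (s * 2 ^ i) x - w (s * 2 ^ i) p| ≤
      2 * s ^ 2 * M * (B * V) + 2 ^ N * (B * V) * (2 ^ i / 2 ^ n) := by
    intro i
    induction i with
    | zero =>
      intro _
      have h1 := hu.abs_dirDeriv_dirDeriv_mollifier_le h hB hs hM (hball x hxs) he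
      have h2 := hu.abs_dirDeriv_dirDeriv_mollifier_le h hB hs hM (hball p hpp) he
      rw [← hV, ← hw] at h1 h2
      have h3 : 0 ≤ 2 ^ N * (B * V) * (2 ^ 0 / 2 ^ n) := by positivity
      rw [pow_zero, mul_one]
      rw [pow_zero] at h3
      have h4 := abs_sub (w s x) (w s p)
      linarith
    | succ i ih =>
      intro hi
      have hsi : 0 < s * 2 ^ i := by positivity
      have hsub : ∀ y, ‖y - p‖ ≤ 1 / s → closedBall y (1 / (s * 2 ^ i)) ⊆ ball z r := fun y hy =>
        (closedBall_subset_closedBall (one_div_mul_two_pow_le hs i)).trans (hball y hy)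
      have h1 := hu.scaledConv_sub hpair hsi (hsub x hxs)
      have h2 := hu.scaledConv_sub hpair hsi (hsub p hpp)
      have hxi : ‖x - p‖ ≤ 1 / (s * 2 ^ i) := hx.trans
        (one_div_le_one_div_of_le hsi (by gcongr; exacts [one_le_two, by omega]))
      have h3 := abs_scaledConv_sub_le (m := N + 2) hpair.left hsi
        (locallyIntegrable_indicator_one hu.1.measurableSet) (abs_indicator_one_le Ω)
        (hB.dirDeriv_dirDeriv_kernel_sub_le e he) hxi
      have h4 : ((s * 2 ^ i) ^ 2)⁻¹ * ((s * 2 ^ i) ^ (N + 2) * (B * (s * 2 ^ i * ‖x - p‖) *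
          (2 ^ N * V / (s * 2 ^ i) ^ N))) ≤ 2 ^ N * (B * V) * (2 ^ i / 2 ^ n) := by
        have h5 : s * 2 ^ i * ‖x - p‖ ≤ 2 ^ i / 2 ^ n := by
          rw [le_div_iff₀ (by positivity)] at hx
          rw [le_div_iff₀ (by positivity)]
          have : (0 : ℝ) < 2 ^ i := by positivity
          nlinarith
        calc _ = 2 ^ N * (B * V) * (s * 2 ^ i * ‖x - p‖) := by
              rw [pow_add]
              field_simp
          _ ≤ _ := by gcongr
      have h6 : |(w (s * 2 ^ i) x - w (2 * (s * 2 ^ i)) x) -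
          (w (s * 2 ^ i) p - w (2 * (s * 2 ^ i)) p)| ≤ 2 ^ N * (B * V) * (2 ^ i / 2 ^ n) := by
        refine le_trans ?_ h4
        rw [h1, h2, ← mul_sub, abs_mul, abs_of_pos (by positivity : 0 < ((s * 2 ^ i) ^ 2)⁻¹)]
        gcongr
      have h7 := ih (by omega)
      have h8 : s * 2 ^ (i + 1) = 2 * (s * 2 ^ i) := by ring
      have h9 : 2 ^ N * (B * V) * (2 ^ (i + 1) / 2 ^ n) =
        2 ^ N * (B * V) * (2 ^ i / 2 ^ n) + 2 ^ N * (B * V) * (2 ^ i / 2 ^ n) := by ring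
      rw [h8, h9]
      rw [abs_le] at h6 h7 ⊢
      constructor <;> linarith [h6.1, h6.2, h7.1, h7.2]
  have := key n le_rfl
  rw [div_self (by positivity), mul_one] at this
  linarith

lemma integral_dirDeriv_eq_zero {f : EuclideanSpace ℝ (Fin N) → ℝ} (hf : ContDiff ℝ (⊤ : ℕ∞) f)
    (hc : HasCompactSupport f) (e : EuclideanSpace ℝ (Fin N)) : ∫ x, dirDeriv e f x = 0 := by
  have hi := (contDiff_dirDeriv hf e).continuous.integrable_of_hasCompactSupport (μ := volume)
    (hasCompactSupport_dirDeriv hc e)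
  have hi' := hf.continuous.integrable_of_hasCompactSupport (μ := volume) hc
  have h1 := integral_mul_fderiv_eq_neg_fderiv_mul_of_integrable (𝕜 := ℝ) (μ := volume)
    (f := fun _ : EuclideanSpace ℝ (Fin N) => (1 : ℝ)) (g := f) (v := e) (by simp)
    (by simpa using! hi) (by simpa using hi')
    (fun x _ => differentiableAt_const _) (fun x _ => hf.differentiable (by simp) x)
  simpa [dirDeriv] using h1

lemma MemP.abs_hessian_step_le (hu : MemP N r z M Ω u) (h : IsMollifierKernel N k ρ)
    (hB : IsKernelBound k ρ B) (hs : 0 < s) (hp : closedBall p (1 / s) ⊆ ball z r)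
    (he : ‖e‖ = 1) :
    |scaledConv (N + 2) (dirDeriv e (dirDeriv e ρ)) u s p -
      scaledConv (N + 2) (dirDeriv e (dirDeriv e ρ)) u (2 * s) p| ≤
      B * (s ^ N * volume.real (ball p (2 / s) \ Ω)) := by
  have hpair := (h.isKernelPair.dirDeriv e).dirDeriv e
  set ψ := dirDeriv e (dirDeriv e k) with hψ
  have hintg : Integrable fun y => ψ (s • (p - y)) := by
    simpa using hpair.left.integrable_mul (locallyIntegrable_const (1 : ℝ)) hs p
  have hzero : ∫ y, ψ (s • (p - y)) = 0 := by
    rw [integral_sub_left_eq_self (fun y => ψ (s • y)) volume p, Measure.integral_comp_smul,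
      hψ, integral_dirDeriv_eq_zero (h.isKernelPair.left.dirDeriv e).smooth
        (h.isKernelPair.left.dirDeriv e).hasCompactSupport, smul_zero]
  have hsplit := integral_add_compl hu.1.measurableSet hintg
  have hT : ∫ y in Ωᶜ, ψ (s • (p - y)) = ∫ y in ball p (2 / s) \ Ω, ψ (s • (p - y)) := by
    refine (setIntegral_eq_of_subset_of_forall_sdiff_eq_zero hu.1.measurableSet.compl
      (fun y hy => hy.2) fun y hy => hpair.left.comp_smul_sub_eq_zero hs fun hy' => ?_)
    refine hy.2 ⟨closedBall_subset_ball ?_ hy', hy.1⟩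
    gcongr
    exact one_lt_two
  have hle := norm_setIntegral_le_of_norm_le_const (μ := volume) (s := ball p (2 / s) \ Ω)
    (f := fun y => ψ (s • (p - y))) (C := B)
    ((measure_mono sdiff_subset).trans_lt measure_ball_lt_top)
    fun y _ => hB.dirDeriv_dirDeriv_kernel_le e he _
  rw [hu.scaledConv_sub (m := N + 2) hpair hs hp, scaledConv_indicator _ _ hu.1.measurableSet,
    show ∫ y in Ω, ψ (s • (p - y)) = -∫ y in ball p (2 / s) \ Ω, ψ (s • (p - y)) by linarith,
    pow_add _ N 2, mul_neg, mul_neg, abs_neg, ← mul_assoc, abs_mul,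
    show (s ^ 2)⁻¹ * (s ^ N * s ^ 2) = s ^ N by field_simp, abs_of_pos (pow_pos hs N),
    mul_left_comm]
  exact mul_le_mul_of_nonneg_left hle (by positivity)

lemma MemP.mollifier_sub_eq (hu : MemP N r z M Ω u) (h : IsMollifierKernel N k ρ) (hs : 0 < s)
    (hp : ball p (2 / s) ⊆ ball z r) (n : ℕ) (hx : x ∈ ball p (1 / s)) :
    scaledConv N ρ u s x - scaledConv N ρ u (s * 2 ^ n) x =
      (∑ i ∈ Finset.range n, ((s * 2 ^ i) ^ 2)⁻¹) * (∫ y, k y) -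
        partialPotential k ((ball p (2 / s) \ Ω).indicator fun _ => 1) s n x := by
  have hmeas : MeasurableSet (ball p (2 / s) \ Ω) := measurableSet_ball.diff hu.1.measurableSet
  have h12 : 1 / s + 1 / s = 2 / s := by ring
  have hterm : ∀ i : ℕ, scaledConv N ρ u (s * 2 ^ i) x - scaledConv N ρ u (s * 2 ^ (i + 1)) x =
      ((s * 2 ^ i) ^ 2)⁻¹ * (∫ y, k y) - ((s * 2 ^ i) ^ 2)⁻¹ *
        scaledConv N k ((ball p (2 / s) \ Ω).indicator fun _ => 1) (s * 2 ^ i) x := by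
    intro i
    have hsi : 0 < s * 2 ^ i := by positivity
    have hsub : closedBall x (1 / (s * 2 ^ i)) ⊆ ball p (2 / s) :=
      (closedBall_subset_closedBall (one_div_mul_two_pow_le hs i)).trans
        (closedBall_subset_ball' (by linarith [mem_ball.1 hx]))
    have hk := h.isKernelPair.left
    have h1 := hk.integrable_mul (locallyIntegrable_indicator_one hu.1.measurableSet) hsi x
    have h2 := hk.integrable_mul (locallyIntegrable_indicator_one hmeas) hsi x
    have h3 : (s * 2 ^ i) ^ N * ∫ y, k ((s * 2 ^ i) • (x - y)) = ∫ y, k y := by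
      rw [integral_sub_left_eq_self (fun y => k ((s * 2 ^ i) • y)) volume x,
        Measure.integral_comp_smul_of_nonneg volume k _ (hR := hsi.le),
        finrank_euclideanSpace_fin, smul_eq_mul, mul_inv_cancel_left₀ (by positivity)]
    rw [show s * 2 ^ (i + 1) = 2 * (s * 2 ^ i) by ring, hu.scaledConv_sub h.isKernelPair hsi
      (hsub.trans hp), ← mul_sub, ← h3, scaledConv, scaledConv, eq_comm, ← mul_sub]
    congr 2
    rw [sub_eq_iff_eq_add, ← integral_add h1 h2]
    congr 1
    funext y
    by_cases hy : y ∈ closedBall x (1 / (s * 2 ^ i))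
    · by_cases hyΩ : y ∈ Ω <;> simp [hyΩ, mem_ball.1 (hsub hy)]
    · simp [hk.comp_smul_sub_eq_zero hsi hy]
  have hsum := Finset.sum_range_sub' (fun i => scaledConv N ρ u (s * 2 ^ i) x) n
  simp only [hterm, Finset.sum_sub_distrib, ← Finset.sum_mul, pow_zero, mul_one] at hsum
  exact hsum.symm

end estimates

section decay

variable {z x p e : EuclideanSpace ℝ (Fin N)} {M r s B : ℝ}
  {Ω : Set (EuclideanSpace ℝ (Fin N))} {u k ρ : EuclideanSpace ℝ (Fin N) → ℝ}

lemma sq_mul_volume_le_of_second_difference {G : EuclideanSpace ℝ (Fin N) → ℝ}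
    (hG : ContDiff ℝ (⊤ : ℕ∞) G) (hc : HasCompactSupport G) {t c : ℝ} (ht : 0 < t)
    (he : ‖e‖ = 1) {A : Set (EuclideanSpace ℝ (Fin N))} (hA : MeasurableSet A)
    (hAfin : volume A ≠ ⊤) (hc0 : 0 ≤ c)
    (h : ∀ x ∈ A, c ≤ |G (x + t • e + t • e) - 2 * G (x + t • e) + G x|) :
    c ^ 2 * volume.real A ≤ t ^ 4 * ∫ x, lap N G x ^ 2 := by
  refine le_trans ?_ (integral_second_difference_sq_le hG hc ht he)
  have hcont : Continuous fun x => (G (x + t • e + t • e) - 2 * G (x + t • e) + G x) ^ 2 := by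
    have := hG.continuous
    fun_prop
  have hcomp : HasCompactSupport
      fun x => (G (x + t • e + t • e) - 2 * G (x + t • e) + G x) ^ 2 := by
    have h1 : HasCompactSupport fun x => G (x + t • e) :=
      hc.comp_homeomorph (Homeomorph.addRight (t • e))
    have h2 : HasCompactSupport fun x => G (x + t • e + t • e) :=
      h1.comp_homeomorph (Homeomorph.addRight (t • e))
    have h3 := (h2.sub (h1.mul_left (f := fun _ => (2 : ℝ)))).add hc
    simp only [sq]
    exact h3.mul_left
  have hintg : Integrable fun x => (G (x + t • e + t • e) - 2 * G (x + t • e) + G x) ^ 2 :=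
    hcont.integrable_of_hasCompactSupport hcomp
  calc c ^ 2 * volume.real A = ∫ _ in A, c ^ 2 := by simp [mul_comm]
    _ ≤ ∫ x in A, (G (x + t • e + t • e) - 2 * G (x + t • e) + G x) ^ 2 := by
        refine setIntegral_mono_on (integrableOn_const hAfin) hintg.integrableOn hA fun x hx => ?_
        rw [← sq_abs (_ + _)]
        exact pow_le_pow_left₀ hc0 (h x hx) 2
    _ ≤ _ := setIntegral_le_integral hintg (Eventually.of_forall fun x => sq_nonneg _)

/-- If the mollified second derivative is large near `p`, the volume of the complement of `Ω` decays
from one scale to the next. -/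
lemma MemP.decay (hu : MemP N r z M Ω u) (h : IsMollifierKernel N k ρ)
    (hB : IsKernelBound k ρ B) (hs : 0 < s) (hp : ball p (2 / s) ⊆ ball z r) (he : ‖e‖ = 1)
    {b : ℝ} (hb : 0 ≤ b) (hess : ∀ x ∈ ball p (1 / s),
      b ≤ |scaledConv (N + 2) (dirDeriv e (dirDeriv e ρ)) u s x|) :
    b ^ 2 * volume.real (ball p (1 / s) \ Ω) ≤ 2 * volume.real (ball p (2 / s) \ Ω) := by
  set V := volume.real (ball (0 : EuclideanSpace ℝ (Fin N)) 1)
  set T := ball p (1 / s) \ Ω with hTdef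
  set S := ball p (2 / s) \ Ω with hSdef
  have hTm : MeasurableSet T := measurableSet_ball.diff hu.1.measurableSet
  have hSm : MeasurableSet S := measurableSet_ball.diff hu.1.measurableSet
  have hTfin : volume T ≠ ⊤ := ((measure_mono sdiff_subset).trans_lt measure_ball_lt_top).ne
  have hSfin : volume S ≠ ⊤ := ((measure_mono sdiff_subset).trans_lt measure_ball_lt_top).ne
  have hsub : ball p (1 / s) ⊆ ball p (2 / s) := ball_subset_ball (by gcongr; exact one_le_two)
  have hχ := locallyIntegrable_indicator_one hSm
  have hχc : HasCompactSupport (S.indicator fun _ => (1 : ℝ)) :=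
    HasCompactSupport.intro (isCompact_closedBall p (2 / s)) fun x hx =>
      indicator_of_notMem (fun hx' => hx (ball_subset_closedBall hx'.1)) _
  have hU := contDiff_scaledConv N h.isKernelPair.right hu.continuous.locallyIntegrable hs
  have hUee : dirDeriv e (dirDeriv e (scaledConv N ρ u s)) =
      scaledConv (N + 2) (dirDeriv e (dirDeriv e ρ)) u s := by
    rw [dirDeriv_scaledConv N h.isKernelPair.right hu.continuous.locallyIntegrable hs,
      dirDeriv_scaledConv (N + 1) (h.isKernelPair.right.dirDeriv e)
        hu.continuous.locallyIntegrable hs]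
  have h12 : 1 / s + 1 / s = 2 / s := by ring
  have hstep : ∀ t : ℝ, 0 < t → b ^ 2 * volume.real {x | x ∈ T ∧ x + t • e ∈ T ∧
      x + t • e + t • e ∈ T} ≤ 2 * volume.real S := by
    intro t ht
    set A := {x | x ∈ T ∧ x + t • e ∈ T ∧ x + t • e + t • e ∈ T} with hA
    have hAm : MeasurableSet A := by
      refine hTm.inter (MeasurableSet.inter (s₂ := {x | x + t • e + t • e ∈ T}) ?_ ?_)
      · exact (measurable_id.add_const (t • e)) hTm
      · exact ((measurable_id.add_const (t • e)).add_const (t • e)) hTm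
    have hAfin : volume A ≠ ⊤ := ne_top_of_le_ne_top hTfin (measure_mono fun x hx => hx.1)
    have hn : ∀ n : ℕ, (max 0 (t ^ 2 * b - 4 * (2 * (B * V) / (s * 2 ^ n) ^ 2))) ^ 2 *
        volume.real A ≤ t ^ 4 * (2 * volume.real S) := by
      intro n
      have hsn : 0 < s * 2 ^ n := by positivity
      refine (sq_mul_volume_le_of_second_difference
        (contDiff_partialPotential h.isKernelPair.left hχ hs n)
        (hasCompactSupport_partialPotential h.isKernelPair.left hχc hs n) ht he hAm hAfin
        (le_max_left _ _) fun x hx => ?_).trans (mul_le_mul_of_nonneg_left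
          (integral_lap_partialPotential_sq_le h hSm hSfin hs n) (by positivity))
      refine max_le (abs_nonneg _) ?_
      obtain ⟨τ, hτ, hdiff⟩ := exists_second_difference_eq hU x e ht
      have hseg : x + τ • e ∈ ball p (1 / s) := by
        have hconv := (convex_ball p (1 / s)).add_smul_mem hx.1.1
          (y := t • e + t • e) (by simpa [add_assoc] using hx.2.2.1)
          (t := τ / (2 * t)) ⟨div_nonneg hτ.1 (by positivity),
            (div_le_one (by positivity)).2 hτ.2⟩
        convert hconv using 2
        rw [← two_smul ℝ (t • e), smul_smul, smul_smul]
        congr 1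
        field_simp
      have hlow := hess _ hseg
      rw [← hUee] at hlow
      have hval : ∀ y ∈ T, |scaledConv N ρ u (s * 2 ^ n) y| ≤ 2 * (B * V) / (s * 2 ^ n) ^ 2 := by
        intro y hy
        have huy : u y = 0 := (hu.2.2.2.1 y ⟨hp (hsub hy.1), hy.2⟩).1
        have := hu.abs_sub_mollifier_le (x := y) h hB hsn
          (((closedBall_subset_closedBall (one_div_mul_two_pow_le hs n)).trans
            (closedBall_subset_ball' (by linarith [mem_ball.1 hy.1]))).trans hp)
        rwa [huy, sub_zero] at this
      have e0 := hu.mollifier_sub_eq h hs hp n hx.1.1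
      have e1 := hu.mollifier_sub_eq h hs hp n hx.2.1.1
      have e2 := hu.mollifier_sub_eq h hs hp n hx.2.2.1
      have v0 := abs_le.1 (hval _ hx.1)
      have v1 := abs_le.1 (hval _ hx.2.1)
      have v2 := abs_le.1 (hval _ hx.2.2)
      have hbig : t ^ 2 * b ≤ |scaledConv N ρ u s (x + t • e + t • e) -
          2 * scaledConv N ρ u s (x + t • e) + scaledConv N ρ u s x| := by
        rw [hdiff, abs_mul, abs_of_pos (by positivity : 0 < t ^ 2)]
        exact mul_le_mul_of_nonneg_left hlow (by positivity)
      rw [← hSdef] at e0 e1 e2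
      set g := partialPotential k (S.indicator fun _ => 1) s n
      have heq : g (x + t • e + t • e) - 2 * g (x + t • e) + g x =
          (scaledConv N ρ u (s * 2 ^ n) (x + t • e + t • e) -
            2 * scaledConv N ρ u (s * 2 ^ n) (x + t • e) + scaledConv N ρ u (s * 2 ^ n) x) -
          (scaledConv N ρ u s (x + t • e + t • e) -
            2 * scaledConv N ρ u s (x + t • e) + scaledConv N ρ u s x) := by
        linarith
      rw [heq, abs_sub_comm]
      have h4 : |scaledConv N ρ u (s * 2 ^ n) (x + t • e + t • e) -
            2 * scaledConv N ρ u (s * 2 ^ n) (x + t • e) + scaledConv N ρ u (s * 2 ^ n) x| ≤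
          4 * (2 * (B * V) / (s * 2 ^ n) ^ 2) := by
        rw [abs_le]
        constructor <;> linarith [v0.1, v0.2, v1.1, v1.2, v2.1, v2.2]
      exact (sub_le_sub hbig h4).trans (abs_sub_abs_le_abs_sub _ _)
    have hlim : Tendsto (fun n : ℕ =>
        (max 0 (t ^ 2 * b - 4 * (2 * (B * V) / (s * 2 ^ n) ^ 2))) ^ 2 * volume.real A) atTop
        (𝓝 ((max 0 (t ^ 2 * b - 4 * 0)) ^ 2 * volume.real A)) := by
      refine ((((tendsto_const_nhds (x := (0 : ℝ))).max (tendsto_const_nhds.sub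
        (Tendsto.const_mul 4 ?_))).pow 2).mul_const _)
      exact ((tendsto_pow_atTop two_ne_zero).comp (tendsto_mul_two_pow hs)).const_div_atTop _
    have hfin := le_of_tendsto' hlim hn
    rw [mul_zero, sub_zero, max_eq_right (by positivity)] at hfin
    have ht4 : 0 < t ^ 4 := by positivity
    refine le_of_mul_le_mul_left ?_ ht4
    linarith [show (t ^ 2 * b) ^ 2 * volume.real A = t ^ 4 * (b ^ 2 * volume.real A) by ring]
  have hlim := (((tendsto_volume_inter_translate hTm hTfin e).const_mul (b ^ 2)).mono_left
    (nhdsWithin_le_nhds (s := Ioi 0)))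
  exact le_of_tendsto hlim (eventually_nhdsWithin_of_forall fun t ht => hstep t ht)

end decay

lemma abs_le_of_decay {a l : ℕ → ℝ} {C L K : ℝ} (hC : 0 ≤ C) (ha : ∀ j, |a j - a (j + 1)| ≤ C * l j)
    (hl0 : ∀ j, 0 ≤ l j) (hlL : ∀ j, l j ≤ L) (hdec : ∀ j, K ≤ |a j| → l (j + 1) ≤ l j / 2)
    (j : ℕ) : |a j| ≤ max |a 0| K + 3 * (C * L) := by
  have key : ∀ j, |a j| + 2 * (C * l j) ≤ max |a 0| K + 3 * (C * L) := by
    intro j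
    induction j with
    | zero =>
      have := mul_le_mul_of_nonneg_left (hlL 0) hC
      have := mul_nonneg hC (hl0 0)
      linarith [le_max_left |a 0| K]
    | succ j ih =>
      have h1 := ha j
      have h2 := abs_sub_abs_le_abs_sub (a (j + 1)) (a j)
      rw [abs_sub_comm (a (j + 1))] at h2
      rcases le_or_gt K |a j| with hK | hK
      · have := mul_le_mul_of_nonneg_left (hdec j hK) hC
        linarith
      · have := mul_le_mul_of_nonneg_left (hlL j) hC
        have := mul_le_mul_of_nonneg_left (hlL (j + 1)) hC
        linarith [le_max_right |a 0| K]
  linarith [key j, mul_nonneg hC (hl0 j)]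

section growth

variable {z x p e : EuclideanSpace ℝ (Fin N)} {M r s B : ℝ}
  {Ω : Set (EuclideanSpace ℝ (Fin N))} {u k ρ : EuclideanSpace ℝ (Fin N) → ℝ}

/-- The mollified second derivatives at scale `1 / (s * 2 ^ n)` are bounded near `p`, uniformly
in `n`. -/
lemma MemP.abs_hessian_le (hu : MemP N r z M Ω u) (h : IsMollifierKernel N k ρ)
    (hB : IsKernelBound k ρ B) (hs : 0 < s) (hM : 0 ≤ M)
    (hp : closedBall p (2 / s) ⊆ ball z r) (he : ‖e‖ = 1) (n : ℕ)
    (hx : ‖x - p‖ ≤ 1 / (s * 2 ^ n)) :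
    |scaledConv (N + 2) (dirDeriv e (dirDeriv e ρ)) u (s * 2 ^ n) x| ≤
      (5 * s ^ 2 * M + 5 * 2 ^ N) * (B * volume.real (ball (0 : EuclideanSpace ℝ (Fin N)) 1)) +
        2 ^ (N + 1) := by
  set V := volume.real (ball (0 : EuclideanSpace ℝ (Fin N)) 1)
  set D : ℝ := (2 * s ^ 2 * M + 2 ^ N) * (B * V) with hD
  have hB0 := hB.pos
  have hV : 0 ≤ V := measureReal_nonneg
  have hsub : ∀ (c : ℝ) (n : ℕ), 0 ≤ c → c ≤ 2 →
      closedBall p (c / (s * 2 ^ n)) ⊆ closedBall p (2 / s) := fun c n hc hc2 =>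
    closedBall_subset_closedBall (div_le_div₀ zero_le_two hc2 hs
      (le_mul_of_one_le_right hs.le (one_le_pow₀ one_le_two)))
  set a : ℕ → ℝ := fun n => scaledConv (N + 2) (dirDeriv e (dirDeriv e ρ)) u (s * 2 ^ n) p with ha
  set l : ℕ → ℝ := fun n => (s * 2 ^ n) ^ N * volume.real (ball p (2 / (s * 2 ^ n)) \ Ω) with hl
  have hsucc : ∀ n : ℕ, s * 2 ^ (n + 1) = 2 * (s * 2 ^ n) := fun n => by ring
  have hbd : |a n| ≤ max |a 0| (D + 2 ^ (N + 1)) + 3 * (B * (2 ^ N * V)) := by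
    refine abs_le_of_decay (l := l) hB0.le (fun j => ?_) (fun j => ?_) (fun j => ?_)
      (fun j hj => ?_) n
    · have := hu.abs_hessian_step_le h hB (s := s * 2 ^ j) (by positivity)
        ((hsub 1 j zero_le_one one_le_two).trans hp) he
      rwa [← hsucc] at this
    · positivity
    · have h1 : volume.real (ball p (2 / (s * 2 ^ j)) \ Ω) ≤
          volume.real (closedBall p (2 / (s * 2 ^ j))) :=
        measureReal_mono (sdiff_subset.trans ball_subset_closedBall) measure_closedBall_lt_top.ne
      rw [volume_closedBall_one_div p (by positivity) 2 zero_le_two,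
        le_div_iff₀ (by positivity)] at h1
      linarith
    · have hb : (2 : ℝ) ^ (N + 1) ≤ |a j| - D := by linarith
      have hb0 : (0 : ℝ) ≤ 2 ^ (N + 1) := by positivity
      have hdec := hu.decay h hB (s := s * 2 ^ j) (by positivity)
        ((ball_subset_closedBall.trans (hsub 2 j zero_le_two le_rfl)).trans hp) he hb0
        fun y hy => ?_
      · have h21 : 2 / (s * 2 ^ (j + 1)) = 1 / (s * 2 ^ j) := by
          rw [hsucc]; field_simp
        simp only [hl, h21]
        set v1 := volume.real (ball p (1 / (s * 2 ^ j)) \ Ω)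
        set v2 := volume.real (ball p (2 / (s * 2 ^ j)) \ Ω)
        have hv1 : 0 ≤ v1 := measureReal_nonneg
        have h2 : 2 * 2 ^ N * v1 ≤ v2 := by
          have h3 : (1 : ℝ) ≤ 2 ^ N := one_le_pow₀ one_le_two
          have h4 : ((2 : ℝ) ^ (N + 1)) ^ 2 = 4 * 2 ^ N * 2 ^ N := by ring
          rw [h4] at hdec
          have h5 := mul_le_mul_of_nonneg_right h3 (by positivity : 0 ≤ 4 * 2 ^ N * v1)
          linarith
        rw [hsucc, mul_pow 2 (s * 2 ^ j)]
        have h6 := mul_le_mul_of_nonneg_left h2 (by positivity : 0 ≤ (s * 2 ^ j) ^ N)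
        linarith
      · have h1 := hu.abs_hessian_sub_le h hB hs hM hp he j
          (x := y) (by rw [← dist_eq_norm]; exact (mem_ball.1 hy).le)
        have h2 := abs_sub_abs_le_abs_sub (a j)
          (scaledConv (N + 2) (dirDeriv e (dirDeriv e ρ)) u (s * 2 ^ j) y)
        rw [abs_sub_comm] at h1
        linarith
  have h0 : |a 0| ≤ s ^ 2 * (M * B * V) := by
    simpa [ha] using hu.abs_dirDeriv_dirDeriv_mollifier_le h hB hs hM
      (by simpa using (hsub 1 0 zero_le_one one_le_two).trans hp) he
  have hx' := hu.abs_hessian_sub_le h hB hs hM hp he n hx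
  have h2 := abs_sub_abs_le_abs_sub
    (scaledConv (N + 2) (dirDeriv e (dirDeriv e ρ)) u (s * 2 ^ n) x) (a n)
  have hmax : max |a 0| (D + 2 ^ (N + 1)) ≤ s ^ 2 * (M * B * V) + D + 2 ^ (N + 1) := by
    have : 0 ≤ D := by positivity
    refine max_le ?_ ?_
    · linarith [pow_pos (two_pos (α := ℝ)) (N + 1)]
    · linarith [(by positivity : 0 ≤ s ^ 2 * (M * B * V))]
  have hfin : (5 * s ^ 2 * M + 5 * 2 ^ N) * (B * V) + 2 ^ (N + 1) =
      s ^ 2 * (M * B * V) + 2 * D + 2 ^ (N + 1) + 3 * (B * (2 ^ N * V)) := by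
    rw [hD]; ring
  rw [hfin]
  linarith

lemma abs_line_le {w : EuclideanSpace ℝ (Fin N) → ℝ} (hw : ContDiff ℝ (⊤ : ℕ∞) w)
    {d H : ℝ} (hd : 0 ≤ d)
    (hH : ∀ t ∈ Icc 0 d, |dirDeriv e (dirDeriv e w) (p + t • e)| ≤ H) :
    |w (p + d • e)| ≤ |w p| + d * |dirDeriv e w p| + d ^ 2 * H := by
  have h1 : ∀ t ∈ Icc 0 d, |dirDeriv e w (p + t • e)| ≤ |dirDeriv e w p| + H * d := by
    intro t ht
    have := (convex_Icc 0 d).norm_image_sub_le_of_norm_hasDerivWithin_le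
      (fun t _ => (hasDerivAt_line (contDiff_dirDeriv hw e) p e t).hasDerivWithinAt) hH
      (left_mem_Icc.2 hd) ht
    simp only [zero_smul, add_zero, sub_zero, Real.norm_eq_abs, abs_of_nonneg ht.1] at this
    have hH0 := (abs_nonneg _).trans (hH t ht)
    have := abs_sub_abs_le_abs_sub (dirDeriv e w (p + t • e)) (dirDeriv e w p)
    linarith [mul_le_mul_of_nonneg_left ht.2 hH0]
  have := (convex_Icc 0 d).norm_image_sub_le_of_norm_hasDerivWithin_le
    (fun t _ => (hasDerivAt_line hw p e t).hasDerivWithinAt) h1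
    (left_mem_Icc.2 hd) (right_mem_Icc.2 hd)
  simp only [zero_smul, add_zero, sub_zero, Real.norm_eq_abs, abs_of_nonneg hd] at this
  have := abs_sub_abs_le_abs_sub (w (p + d • e)) (w p)
  linarith [show (|dirDeriv e w p| + H * d) * d = d * |dirDeriv e w p| + d ^ 2 * H by ring]

/-- Dyadic quadratic growth away from a point outside `Ω`. -/
lemma MemP.abs_le_of_norm_sub_le (hu : MemP N r z M Ω u) (h : IsMollifierKernel N k ρ)
    (hB : IsKernelBound k ρ B) (hs : 0 < s) (hM : 0 ≤ M)
    (hp : closedBall p (2 / s) ⊆ ball z r) (hpΩ : p ∉ Ω) (n : ℕ)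
    (hx : ‖x - p‖ ≤ 1 / (s * 2 ^ n)) :
    |u x| ≤ ((5 * s ^ 2 * M + 5 * 2 ^ N + 6) *
      (B * volume.real (ball (0 : EuclideanSpace ℝ (Fin N)) 1)) + 2 ^ (N + 1)) /
        (s * 2 ^ n) ^ 2 := by
  set V := volume.real (ball (0 : EuclideanSpace ℝ (Fin N)) 1)
  have hB0 := hB.pos
  have hV : 0 ≤ V := measureReal_nonneg
  obtain ⟨hup, hgp⟩ := hu.2.2.2.1 p ⟨hp (mem_closedBall_self (by positivity)), hpΩ⟩
  rcases eq_or_ne x p with rfl | hxp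
  · rw [hup, abs_zero]
    positivity
  have hdp : HasFDerivAt u (0 : EuclideanSpace ℝ (Fin N) →L[ℝ] ℝ) p := by
    have := ((hu.2.1.differentiable one_ne_zero) p).hasGradientAt.hasFDerivAt
    simpa [hgp] using this
  set σ := s * 2 ^ n with hσ
  have hσ0 : 0 < σ := by positivity
  have hsσ : s ≤ σ := le_mul_of_one_le_right hs.le (one_le_pow₀ one_le_two)
  have hsub1 : closedBall p (1 / σ) ⊆ ball z r :=
    (closedBall_subset_closedBall (div_le_div₀ zero_le_two one_le_two hs hsσ)).trans hp
  have hsubx : closedBall x (1 / σ) ⊆ ball z r := by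
    refine (closedBall_subset_closedBall' ?_).trans hp
    rw [dist_eq_norm]
    calc 1 / σ + ‖x - p‖ ≤ 1 / σ + 1 / σ := by gcongr
      _ = 2 / σ := by ring
      _ ≤ 2 / s := div_le_div_of_nonneg_left zero_le_two hs hsσ
  set d := ‖x - p‖ with hd
  have hd0 : 0 < d := norm_pos_iff.2 (sub_ne_zero.2 hxp)
  set e := d⁻¹ • (x - p)
  have he : ‖e‖ = 1 := by
    rw [norm_smul, norm_inv, Real.norm_of_nonneg hd0.le, inv_mul_cancel₀ hd0.ne']
  have hxe : p + d • e = x := by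
    simp only [e, smul_smul, mul_inv_cancel₀ hd0.ne', one_smul, add_sub_cancel]
  have hU := contDiff_scaledConv N h.isKernelPair.right hu.continuous.locallyIntegrable hσ0
  have hUe := dirDeriv_scaledConv N h.isKernelPair.right hu.continuous.locallyIntegrable hσ0 e
  have hUee : dirDeriv e (dirDeriv e (scaledConv N ρ u σ)) =
      scaledConv (N + 2) (dirDeriv e (dirDeriv e ρ)) u σ := by
    rw [hUe, dirDeriv_scaledConv (N + 1) (h.isKernelPair.right.dirDeriv e)
        hu.continuous.locallyIntegrable hσ0]
  set H := (5 * s ^ 2 * M + 5 * 2 ^ N) * (B * V) + 2 ^ (N + 1) with hH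
  have hH0 : 0 ≤ H := by positivity
  have hline := abs_line_le (p := p) (e := e) hU hd0.le (H := H) fun t ht => by
    rw [hUee]
    refine hu.abs_hessian_le h hB hs hM hp he n ?_
    rw [add_sub_cancel_left, norm_smul, he, mul_one, Real.norm_of_nonneg ht.1]
    exact ht.2.trans hx
  rw [hxe, hUe] at hline
  have h1 := hu.abs_sub_mollifier_le h hB hσ0 hsubx
  have h2 := hu.abs_sub_mollifier_le h hB hσ0 hsub1
  have h3 := hu.abs_dirDeriv_mollifier_le h hB hσ0 hsub1 hup hdp he
  rw [hup, sub_zero] at h2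
  have h4 : d * |scaledConv (N + 1) (dirDeriv e ρ) u σ p| ≤ 1 / σ * (2 * (B * V) / σ) := by
    gcongr
  have h5 : d ^ 2 * H ≤ (1 / σ) ^ 2 * H := by gcongr
  have h6 := abs_sub_abs_le_abs_sub (u x) (scaledConv N ρ u σ x)
  rw [abs_sub_comm] at h1
  have h7 : ((5 * s ^ 2 * M + 5 * 2 ^ N + 6) * (B * V) + 2 ^ (N + 1)) / σ ^ 2 =
      2 * (B * V) / σ ^ 2 + 2 * (B * V) / σ ^ 2 + 1 / σ * (2 * (B * V) / σ) +
        (1 / σ) ^ 2 * H := by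
    rw [hH]; field_simp; ring
  rw [h7]
  linarith

end growth

section nondegeneracy

variable {z x : EuclideanSpace ℝ (Fin N)} {M r s : ℝ}
  {Ω : Set (EuclideanSpace ℝ (Fin N))} {u k ρ : EuclideanSpace ℝ (Fin N) → ℝ}

lemma IsMollifierKernel.integral_kernel_pos (h : IsMollifierKernel N k ρ) : 0 < ∫ x, k x :=
  h.smooth_kernel.continuous.integral_pos_of_hasCompactSupport_nonneg_nonzero
    (hasCompactSupport_of_norm h.kernel_eq_zero) h.kernel_nonneg h.kernel_pos.ne'

lemma MemP.add_le_mollifier (hu : MemP N r z M Ω u) (h : IsMollifierKernel N k ρ) (hs : 0 < s)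
    (hx : closedBall x (1 / s) ⊆ ball z r) :
    u x + (s ^ 2)⁻¹ * scaledConv N k (Ω.indicator fun _ => 1) s x ≤ scaledConv N ρ u s x := by
  have hstep : ∀ n : ℕ, scaledConv N ρ u (s * 2 ^ (n + 1)) x =
      scaledConv N ρ u (s * 2 ^ n) x - ((s * 2 ^ n) ^ 2)⁻¹ *
        scaledConv N k (Ω.indicator fun _ => 1) (s * 2 ^ n) x := fun n => by
    rw [← hu.scaledConv_sub h.isKernelPair (by positivity)
      ((closedBall_subset_closedBall (one_div_mul_two_pow_le hs n)).trans hx),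
      show s * 2 ^ (n + 1) = 2 * (s * 2 ^ n) by ring]
    ring
  have hanti : Antitone fun n : ℕ => scaledConv N ρ u (s * 2 ^ n) x := by
    refine antitone_nat_of_succ_le fun n => ?_
    rw [hstep, sub_le_self_iff]
    refine mul_nonneg (by positivity) (mul_nonneg (by positivity) (integral_nonneg fun y => ?_))
    exact mul_nonneg (indicator_nonneg (fun _ _ => zero_le_one) y) (h.kernel_nonneg _)
  have hlim := (tendsto_scaledConv_mollifier h hu.continuous x).comp (tendsto_mul_two_pow hs)
  have h1 := hanti.le_of_tendsto hlim 1
  have h0 := hstep 0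
  simp only [zero_add, pow_zero, mul_one, pow_one] at h0 h1
  linarith

lemma MemP.exists_pos (hu : MemP N r z M Ω u) (h : IsMollifierKernel N k ρ) (hr : 0 < r)
    {δ : ℝ} (hδ : 0 < δ) : ∃ x ∈ ball z δ, 0 < u x := by
  by_contra! hneg
  have hz : z ∉ Ω := fun hz => by
    have := hu.2.2.2.2.2.2
    rw [hu.1.interior_eq] at this
    exact this hz
  have huz : u z = 0 := (hu.2.2.2.1 z ⟨mem_ball_self hr, hz⟩).1
  set s := 2 / min r δ with hs
  have hm : 0 < min r δ := lt_min hr hδ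
  have hs0 : 0 < s := by positivity
  have h1s : 1 / s < min r δ := by
    rw [hs, one_div_div]
    linarith
  have hle := hu.add_le_mollifier h hs0
    (closedBall_subset_ball (h1s.trans_le (min_le_left r δ)))
  have hρ : scaledConv N ρ u s z ≤ 0 := by
    refine mul_nonpos_of_nonneg_of_nonpos (by positivity) (integral_nonpos fun y => ?_)
    by_cases hy : y ∈ closedBall z (1 / s)
    · exact mul_nonpos_of_nonpos_of_nonneg
        (hneg y (closedBall_subset_ball (h1s.trans_le (min_le_right r δ)) hy))
        (h.mollifier_nonneg _)
    · simp [h.isKernelPair.right.comp_smul_sub_eq_zero hs0 hy]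
  have hpos : 0 < scaledConv N k (Ω.indicator fun _ => 1) s z := by
    refine mul_pos (by positivity) ?_
    rw [integral_pos_iff_support_of_nonneg
      (fun y => mul_nonneg (indicator_nonneg (fun _ _ => zero_le_one) y) (h.kernel_nonneg _))
      (h.isKernelPair.left.integrable_mul
        (locallyIntegrable_indicator_one hu.1.measurableSet) hs0 z)]
    have hopen : IsOpen {y | 0 < k (s • (z - y))} :=
      isOpen_lt continuous_const (h.isKernelPair.left.continuous_comp_smul_sub s z)
    have hne : ({y | 0 < k (s • (z - y))} ∩ Ω).Nonempty :=
      mem_closure_iff.1 (frontier_subset_closure hu.2.2.2.2.2) _ hopen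
        (by simpa using h.kernel_pos)
    refine ((hopen.inter hu.1).measure_pos volume hne).trans_le (measure_mono fun y hy => ?_)
    rw [Function.mem_support, indicator_of_mem hy.2, one_mul]
    exact (ne_of_gt hy.1)
  have := mul_pos (by positivity : 0 < (s ^ 2)⁻¹) hpos
  linarith

lemma scaledConv_mollifier_le_of_le_quadratic (h : IsMollifierKernel N k ρ) (hu : Continuous u)
    (hs : 0 < s) {α : ℝ} (hα : 0 ≤ α) {x₀ : EuclideanSpace ℝ (Fin N)}
    (hle : ∀ y ∈ closedBall x (1 / s), u y - α * ‖y - x₀‖ ^ 2 ≤ u x - α * ‖x - x₀‖ ^ 2) :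
    scaledConv N ρ u s x ≤ u x + α * (s ^ 2)⁻¹ := by
  set c := u x + α * (s ^ 2)⁻¹
  have hodd : ∫ y, ⟪x - x₀, x - y⟫ * ρ (s • (x - y)) = 0 := by
    rw [integral_sub_left_eq_self (fun w => ⟪x - x₀, w⟫ * ρ (s • w)) volume x]
    have := integral_neg_eq_self (fun w => ⟪x - x₀, w⟫ * ρ (s • w)) volume
    simp only [inner_neg_right, smul_neg, h.mollifier_neg, neg_mul, integral_neg] at this
    linarith
  have hi0 := h.isKernelPair.right.integrable_mul (locallyIntegrable_const c) hs x
  have hi1 : Integrable fun y => ⟪x - x₀, x - y⟫ * ρ (s • (x - y)) :=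
    h.isKernelPair.right.integrable_mul
      (v := fun y => ⟪x - x₀, x - y⟫) (Continuous.locallyIntegrable (by fun_prop)) hs x
  have hcomp : ∫ y, u y * ρ (s • (x - y)) ≤
      ∫ y, (c * ρ (s • (x - y)) - 2 * α * (⟪x - x₀, x - y⟫ * ρ (s • (x - y)))) := by
    refine integral_mono (h.isKernelPair.right.integrable_mul hu.locallyIntegrable hs x)
      (hi0.sub (hi1.const_mul _)) fun y => ?_
    by_cases hy : y ∈ closedBall x (1 / s)
    · have h1 := hle y hy
      have h2 : ‖y - x₀‖ ^ 2 = ‖x - x₀‖ ^ 2 - 2 * ⟪x - x₀, x - y⟫ + ‖x - y‖ ^ 2 := by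
        rw [← norm_sub_sq_real]
        congr 2
        abel
      have h3 : ‖x - y‖ ^ 2 ≤ (s ^ 2)⁻¹ := by
        rw [← one_div, ← one_div_pow, ← dist_eq_norm, dist_comm]
        exact pow_le_pow_left₀ dist_nonneg hy 2
      have h4 : u y ≤ c - 2 * α * ⟪x - x₀, x - y⟫ := by
        rw [h2] at h1
        have := mul_le_mul_of_nonneg_left h3 hα
        simp only [c]
        linarith
      have := mul_le_mul_of_nonneg_right h4 (h.mollifier_nonneg (s • (x - y)))
      simp only
      linarith
    · simp [h.isKernelPair.right.comp_smul_sub_eq_zero hs hy]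
  rw [integral_sub hi0 (hi1.const_mul _), integral_const_mul, integral_const_mul, hodd, mul_zero,
    sub_zero] at hcomp
  have := mul_le_mul_of_nonneg_left hcomp (by positivity : 0 ≤ s ^ N)
  rw [mul_left_comm, scaledConv_mollifier_const h hs, mul_one] at this
  exact this

/-- Nondegeneracy: the bound `M` cannot be too small. -/
lemma MemP.integral_kernel_le (hu : MemP N 1 z M Ω u) (h : IsMollifierKernel N k ρ) :
    (∫ y, k y) / 8 ≤ M := by
  obtain ⟨x₀, hx₀, hpos⟩ := hu.exists_pos h one_pos (δ := 1 / 4) (by norm_num)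
  set I := ∫ y, k y
  have hI : 0 < I := h.integral_kernel_pos
  have hsub : closedBall x₀ (1 / 2) ⊆ ball z 1 := by
    refine closedBall_subset_ball' ?_
    linarith [mem_ball.1 hx₀]
  have hcont : Continuous fun y => u y - I / 2 * ‖y - x₀‖ ^ 2 := by
    have := hu.continuous
    fun_prop
  obtain ⟨x₁, hx₁, hmax⟩ := (isCompact_closedBall x₀ (1 / 2)).exists_isMaxOn
    ⟨x₀, mem_closedBall_self (by norm_num)⟩ hcont.continuousOn
  have h0 : u x₀ ≤ u x₁ - I / 2 * ‖x₁ - x₀‖ ^ 2 := by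
    simpa using hmax (mem_closedBall_self (by norm_num) : x₀ ∈ closedBall x₀ (1 / 2))
  have hu1 : 0 < u x₁ := by
    have : 0 ≤ I / 2 * ‖x₁ - x₀‖ ^ 2 := by positivity
    linarith
  have hx₁Ω : x₁ ∈ Ω := by
    by_contra hx
    exact hu1.ne' (hu.2.2.2.1 x₁ ⟨hsub hx₁, hx⟩).1
  rcases (mem_closedBall.1 hx₁).lt_or_eq with hlt | heq
  · exfalso
    obtain ⟨ε, hε, hεsub⟩ := Metric.isOpen_iff.1 (hu.1.inter (isOpen_ball (x := x₀) (ε := 1 / 2)))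
      x₁ ⟨hx₁Ω, hlt⟩
    set s := 2 / ε with hs
    have hs0 : 0 < s := by positivity
    have hball : closedBall x₁ (1 / s) ⊆ Ω ∩ ball x₀ (1 / 2) := by
      refine (closedBall_subset_ball ?_).trans hεsub
      rw [hs, one_div_div]
      linarith
    have hball' : closedBall x₁ (1 / s) ⊆ closedBall x₀ (1 / 2) := fun y hy =>
      ball_subset_closedBall (hball hy).2
    have h1 := scaledConv_mollifier_le_of_le_quadratic h hu.continuous hs0
      (by positivity : 0 ≤ I / 2) (x₀ := x₀) fun y hy => hmax (hball' hy)
    have h2 := hu.add_le_mollifier h hs0 (hball'.trans hsub)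
    have h3 : scaledConv N k (Ω.indicator fun _ => 1) s x₁ = I := by
      have : (fun y => Ω.indicator (fun _ => (1 : ℝ)) y * k (s • (x₁ - y))) =
          fun y => k (s • (x₁ - y)) := by
        funext y
        by_cases hy : y ∈ closedBall x₁ (1 / s)
        · rw [indicator_of_mem (hball hy).1, one_mul]
        · rw [h.isKernelPair.left.comp_smul_sub_eq_zero hs0 hy, mul_zero]
      rw [scaledConv, this, integral_sub_left_eq_self (fun y => k (s • y)) volume x₁,
        Measure.integral_comp_smul_of_nonneg volume k s (hR := hs0.le),
        finrank_euclideanSpace_fin, smul_eq_mul, mul_inv_cancel_left₀ (by positivity)]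
    rw [h3] at h2
    have h4 : 0 < (s ^ 2)⁻¹ * I := by positivity
    linarith
  · rw [dist_eq_norm] at heq
    rw [heq] at h0
    have := (abs_le.1 (hu.2.2.2.2.1 x₁ (hsub hx₁))).2
    linarith

end nondegeneracy

end

/-- quadratic growth of `u` away from the free boundary. -/
theorem quadratic_growth_dist (N : ℕ) (hN : 2 ≤ N) :
    ∃ C : ℝ, 0 < C ∧
      ∀ (M : ℝ), 0 < M →
        ∀ (Ω : Set (EuclideanSpace ℝ (Fin N))) (z : EuclideanSpace ℝ (Fin N))
          (u : EuclideanSpace ℝ (Fin N) → ℝ),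
          MemP N 1 z M Ω u →
            ∀ x ∈ ball z (1 / 2), |u x| ≤ C * M * Metric.infDist x (frontier Ω) ^ 2 := by
  have : NeZero N := ⟨by omega⟩
  obtain ⟨k, ρ, h⟩ := exists_isMollifierKernel hN
  obtain ⟨B, hB⟩ := h.exists_isKernelBound
  have hB0 := hB.pos
  have hI := h.integral_kernel_pos
  set I := ∫ y, k y
  set V := volume.real (ball (0 : EuclideanSpace ℝ (Fin N)) 1) with hV
  have hV0 : 0 ≤ V := measureReal_nonneg
  set A : ℝ := (5 * 2 ^ N + 6) * (B * V) + 2 ^ (N + 1) with hA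
  have hA0 : 0 ≤ A := by positivity
  refine ⟨4 * (320 * (B * V) + A * (8 / I)) + 64, by positivity, fun M hM Ω z u hu x hx => ?_⟩
  have hMI : 1 ≤ 8 / I * M := by
    have := hu.integral_kernel_le h
    rw [div_mul_eq_mul_div, one_le_div hI]
    linarith
  by_cases hxΩ : x ∈ Ω
  swap
  · rw [(hu.2.2.2.1 x ⟨ball_subset_ball (by norm_num) hx, hxΩ⟩).1, abs_zero]
    positivity
  have hne : (frontier Ω).Nonempty := ⟨z, hu.2.2.2.2.2⟩
  have hd0 : 0 < infDist x (frontier Ω) :=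
    (isClosed_frontier.notMem_iff_infDist_pos hne).1 fun hx' => by
      rw [hu.1.frontier_eq] at hx'
      exact hx'.2 hxΩ
  obtain ⟨p, hp, hxp⟩ := isClosed_frontier.exists_infDist_eq_dist hne x
  set d := infDist x (frontier Ω)
  rcases lt_or_ge (1 / 8) d with hd | hd
  · have h1 := hu.2.2.2.2.1 x (ball_subset_ball (by norm_num) hx)
    have h2 : (1 / 8) ^ 2 ≤ d ^ 2 := pow_le_pow_left₀ (by norm_num) hd.le 2
    have h3 : 0 ≤ 4 * (320 * (B * V) + A * (8 / I)) * (M * d ^ 2) := by positivity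
    linarith [mul_le_mul_of_nonneg_left h2 hM.le]
  · have hpΩ : p ∉ Ω := by
      rw [hu.1.frontier_eq] at hp
      exact hp.2
    have hpz : closedBall p (2 / 8) ⊆ ball z 1 := by
      refine closedBall_subset_ball' ?_
      have := dist_triangle p x z
      rw [dist_comm p x, ← hxp] at this
      linarith [mem_ball.1 hx]
    obtain ⟨n, hn1, hn2⟩ := exists_nat_pow_near (x := 1 / (8 * d)) (y := (2 : ℝ))
      (by rw [one_le_div (by positivity)]; linarith) one_lt_two
    rw [le_div_iff₀ (by positivity)] at hn1
    rw [div_lt_iff₀ (by positivity)] at hn2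
    have hgrow := hu.abs_le_of_norm_sub_le h hB (by norm_num) hM.le hpz hpΩ n (x := x) (by
      rw [← dist_eq_norm, ← hxp, le_div_iff₀ (by positivity)]
      linarith)
    refine hgrow.trans ?_
    rw [← hV, div_le_iff₀ (by positivity)]
    have h1 : 1 ≤ 4 * (d ^ 2 * (8 * 2 ^ n) ^ 2) := by
      have : 1 ≤ (8 * d * 2 ^ n * 2) ^ 2 := by
        refine one_le_pow₀ ?_
        rw [pow_succ] at hn2
        linarith
      linarith
    have h2 : A ≤ A * (8 / I) * M := by
      rw [mul_assoc]
      exact le_mul_of_one_le_right hA0 hMI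
    have h3 : (5 * 8 ^ 2 * M + 5 * 2 ^ N + 6) * (B * V) + 2 ^ (N + 1) ≤
        (320 * (B * V) + A * (8 / I)) * M := by
      linarith
    have h4 := le_mul_of_one_le_right
      (by positivity : 0 ≤ (320 * (B * V) + A * (8 / I)) * M) h1
    have h5 : 0 ≤ 64 * M * (d ^ 2 * (8 * 2 ^ n) ^ 2) := by positivity
    linarith
end
end

section
/- There exists a constant c_N > 0 depending only on N such that: if u ∈ P₁(0,M), x⁰ belongs to the closure of Ω, and r > 0 satisfies B(x⁰,r) ⊆ B(0,1), then sup_{B(x⁰,r)} u ≥ u(x⁰) + c_N·r² (nondegeneracy). -/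
open MeasureTheory Metric Set Filter
open scoped RealInnerProductSpace

noncomputable section

open scoped Convolution Topology ContDiff

/-- Second derivative test: a parabola touching `f` from above at `0` bounds its second derivative there. -/
lemma second_deriv_le_of_le_parabola {f f' : ℝ → ℝ} {a b k : ℝ}
    (hf : ∀ t, HasDerivAt f (f' t) t) (hf' : HasDerivAt f' a 0)
    (hle : ∀ᶠ t in 𝓝 (0 : ℝ), f t ≤ f 0 + b * t + k * t ^ 2) : a ≤ 2 * k := by
  by_contra! hlt
  set g : ℝ → ℝ := fun t => f t - b * t - k * t ^ 2 with hg
  have hgd : ∀ t, HasDerivAt g (f' t - b - k * (2 * t)) t := fun t =>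
    (((hf t).sub ((hasDerivAt_id t).const_mul b)).sub
      ((hasDerivAt_pow 2 t).const_mul k)).congr_deriv (by simp)
  have hderiv : deriv g = fun t => f' t - b - k * (2 * t) := funext fun t => (hgd t).deriv
  have hgd2 : HasDerivAt (deriv g) (a - k * 2) 0 := by
    rw [hderiv]
    exact ((hf'.sub_const b).sub
      (((hasDerivAt_id (0 : ℝ)).const_mul 2).const_mul k)).congr_deriv (by simp)
  have hmax : IsLocalMax g 0 := by
    filter_upwards [hle] with t ht
    simp only [hg]
    linarith
  have hmin : IsLocalMin g 0 :=
    isLocalMin_of_deriv_deriv_pos (by rw [hgd2.deriv]; linarith) hmax.deriv_eq_zero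
      (hgd 0).continuousAt
  have hconst : g =ᶠ[𝓝 0] fun _ => g 0 := by
    filter_upwards [hmax, hmin] with t h1 h2 using le_antisymm h1 h2
  have hzero : deriv (deriv g) 0 = 0 := by
    rw [hconst.deriv.deriv_eq]
    simp
  rw [hgd2.deriv] at hzero
  linarith

section Mollification

variable {N : ℕ} {ρ u : EuclideanSpace ℝ (Fin N) → ℝ}

local notation "E" => EuclideanSpace ℝ (Fin N)

lemma hasFDerivAt_mollification (hρ : ContDiff ℝ ∞ ρ) (hc : HasCompactSupport ρ)
    (hu : Continuous u) (x : E) :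
    HasFDerivAt (ρ ⋆[ContinuousLinearMap.lsmul ℝ ℝ, volume] u)
      ((fderiv ℝ ρ ⋆[(ContinuousLinearMap.lsmul ℝ ℝ).precompL E, volume] u) x) x :=
  hc.hasFDerivAt_convolution_left _ (hρ.of_le (by simp)) hu.locallyIntegrable x

lemma fderiv_mollification_apply (hρ : ContDiff ℝ ∞ ρ) (hc : HasCompactSupport ρ)
    (hu : Continuous u) (x e : E) :
    fderiv ℝ (ρ ⋆[ContinuousLinearMap.lsmul ℝ ℝ, volume] u) x e =
      ((fun y => fderiv ℝ ρ y e) ⋆[ContinuousLinearMap.lsmul ℝ ℝ, volume] u) x := by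
  rw [(hasFDerivAt_mollification hρ hc hu x).fderiv]
  have hex := (hc.fderiv ℝ).convolutionExists_left
    ((ContinuousLinearMap.lsmul ℝ ℝ).precompL E)
    (hρ.continuous_fderiv (by simp)) hu.locallyIntegrable (μ := volume) x
  simp only [convolution_def]
  rw [ContinuousLinearMap.integral_apply hex]
  rfl

lemma lap_mollification (hρ : ContDiff ℝ ∞ ρ) (hc : HasCompactSupport ρ)
    (hu : Continuous u) (x : E) :
    lap N (ρ ⋆[ContinuousLinearMap.lsmul ℝ ℝ, volume] u) x =
      ∫ y, u y * lap N (fun y => ρ (x - y)) y := by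
  have hdc : ∀ e : E, HasCompactSupport fun y => fderiv ℝ ρ y e := fun e => hc.fderiv_apply ℝ e
  have hds : ∀ e : E, ContDiff ℝ ∞ fun y => fderiv ℝ ρ y e := fun e =>
    (hρ.fderiv_right (m := ∞) (by simp)).clm_apply contDiff_const
  have hflip : ∀ f : E → ℝ, Differentiable ℝ f → ∀ e y : E,
      fderiv ℝ (fun y => f (x - y)) y e = - fderiv ℝ f (x - y) e := fun f hf e y => by
    have h : HasFDerivAt (fun y => f (x - y)) _ y :=
      (hf (x - y)).hasFDerivAt.comp y ((hasFDerivAt_id y).const_sub x)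
    rw [h.fderiv]
    simp
  have hlap : ∀ y, lap N (fun y => ρ (x - y)) y = lap N ρ (x - y) := fun y => by
    unfold lap
    refine Finset.sum_congr rfl fun i _ => ?_
    simp only [hflip ρ (hρ.differentiable (by simp)), fderiv_fun_neg, neg_apply]
    rw [hflip _ ((hds (EuclideanSpace.single i 1)).differentiable (by simp)), neg_neg]
  simp only [hlap]
  have hconv : lap N (ρ ⋆[ContinuousLinearMap.lsmul ℝ ℝ, volume] u) x = ∑ i : Fin N,
      ∫ y, fderiv ℝ (fun y => fderiv ℝ ρ y (EuclideanSpace.single i 1)) (x - y)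
        (EuclideanSpace.single i 1) * u y := by
    unfold lap
    refine Finset.sum_congr rfl fun i _ => ?_
    rw [funext fun y => fderiv_mollification_apply hρ hc hu y (EuclideanSpace.single i 1),
      fderiv_mollification_apply (hds _) (hdc _) hu, convolution_eq_swap]
    rfl
  rw [hconv, ← integral_finsetSum]
  · refine integral_congr_ae (ae_of_all _ fun y => ?_)
    simp only [lap, Finset.mul_sum, mul_comm]
  · intro i _
    have h := ((hdc (EuclideanSpace.single i 1)).fderiv_apply ℝ
      (EuclideanSpace.single i 1)).comp_homeomorph (Homeomorph.subLeft x)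
    refine Continuous.integrable_of_hasCompactSupport ?_ (h.mul_right (f' := u))
    refine Continuous.mul ?_ hu
    exact (((hds _).continuous_fderiv (by simp)).comp (continuous_const.sub continuous_id)).clm_apply
      continuous_const

lemma lap_le_of_isLocalMax_sub_sq (hρ : ContDiff ℝ ∞ ρ) (hc : HasCompactSupport ρ)
    (hu : Continuous u) {c η : ℝ} {x₀ x₁ z : E}
    (hmax : IsLocalMax (fun x => (ρ ⋆[ContinuousLinearMap.lsmul ℝ ℝ, volume] u) x
      - c * ‖x - x₀‖ ^ 2 - η * ‖x - x₁‖ ^ 2) z) :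
    lap N (ρ ⋆[ContinuousLinearMap.lsmul ℝ ℝ, volume] u) z ≤ N * (2 * (c + η)) := by
  set U := ρ ⋆[ContinuousLinearMap.lsmul ℝ ℝ, volume] u with hU
  have hUs : ContDiff ℝ ∞ U := hc.contDiff_convolution_left _ hρ hu.locallyIntegrable
  have hcoord : ∀ i : Fin N, fderiv ℝ (fun y => fderiv ℝ U y (EuclideanSpace.single i 1)) z
      (EuclideanSpace.single i 1) ≤ 2 * (c + η) := fun i => by
    set e : E := EuclideanSpace.single i 1 with he
    have hnorm : ‖e‖ = 1 := by simp [he]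
    have hline : ∀ t : ℝ, HasDerivAt (fun t : ℝ => z + t • e) e t := fun t => by
      simpa using ((hasDerivAt_id t).smul_const e).const_add z
    have hd : Differentiable ℝ fun y => fderiv ℝ U y e :=
      ((hUs.fderiv_right (m := ∞) (by simp)).clm_apply contDiff_const).differentiable (by simp)
    have h1 : ∀ t : ℝ, HasDerivAt (fun t : ℝ => U (z + t • e)) (fderiv ℝ U (z + t • e) e) t :=
      fun t => ((hUs.differentiable (by simp) _).hasFDerivAt).comp_hasDerivAt t (hline t)
    have h2 : HasDerivAt (fun t : ℝ => fderiv ℝ U (z + t • e) e)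
        (fderiv ℝ (fun y => fderiv ℝ U y e) z e) 0 := by
      have h := ((hd (z + (0 : ℝ) • e)).hasFDerivAt).comp_hasDerivAt (0 : ℝ) (hline 0)
      rw [zero_smul, add_zero] at h
      exact h
    refine second_deriv_le_of_le_parabola (b := 2 * c * ⟪z - x₀, e⟫ + 2 * η * ⟪z - x₁, e⟫)
      h1 h2 ?_
    have hsq : ∀ (t : ℝ) (p : E),
        ‖z + t • e - p‖ ^ 2 = ‖z - p‖ ^ 2 + 2 * t * ⟪z - p, e⟫ + t ^ 2 := fun t p => by
      rw [add_sub_right_comm, norm_add_sq_real, inner_smul_right, norm_smul, hnorm]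
      simp
      ring
    have htend : Tendsto (fun t : ℝ => z + t • e) (𝓝 0) (𝓝 z) := by
      simpa using (hline 0).continuousAt.tendsto
    filter_upwards [htend.eventually hmax] with t ht
    simp only [hsq] at ht
    simp only [zero_smul, add_zero]
    linarith
  calc lap N U z ≤ ∑ _i : Fin N, 2 * (c + η) := Finset.sum_le_sum fun i _ => hcoord i
    _ = N * (2 * (c + η)) := by simp

/-- If `Δu = 1` in `D` in the sense of distributions, then `u - c ‖· - x₀‖²` has no local maximum
in `D` when `c < 1 / (2 N)`. -/
lemma not_isLocalMax_sub_sq {D : Set E} (hD : IsOpen D) (hu : Continuous u)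
    (hΔ : ∀ φ : E → ℝ, ContDiff ℝ ∞ φ → tsupport φ ⊆ D → ∫ x, u x * lap N φ x = ∫ x, φ x)
    {c η : ℝ} (hη : 0 < η) (hc : N * (2 * (c + η)) < 1) {x₀ x₁ : E} (hx₁ : x₁ ∈ D) :
    ¬ IsLocalMax (fun x => u x - c * ‖x - x₀‖ ^ 2) x₁ := by
  intro hmax
  obtain ⟨R, hR, hball⟩ : ∃ R > 0, ball x₁ R ⊆ D ∩
      {x | u x - c * ‖x - x₀‖ ^ 2 ≤ u x₁ - c * ‖x₁ - x₀‖ ^ 2} :=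
    Metric.mem_nhds_iff.1 (inter_mem (hD.mem_nhds hx₁) hmax)
  set s := R / 3 with hs
  have hs0 : 0 < s := by positivity
  have huc := (isCompact_closedBall x₁ (2 * s)).uniformContinuousOn_of_continuous hu.continuousOn
  rw [Metric.uniformContinuousOn_iff_le] at huc
  obtain ⟨δ, hδ, hclose⟩ := huc (η * s ^ 2 / 3) (by positivity)
  set ε := min δ s with hε
  have hε0 : 0 < ε := lt_min hδ hs0
  let B : ContDiffBump (0 : E) := ⟨ε / 2, ε, by positivity, by linarith⟩
  set U := B.normed volume ⋆[ContinuousLinearMap.lsmul ℝ ℝ, volume] u with hU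
  have hρ : ContDiff ℝ ∞ (B.normed volume) := B.contDiff_normed
  have hρc : HasCompactSupport (B.normed volume) := B.hasCompactSupport_normed
  have hUc : Continuous U :=
    (hρc.contDiff_convolution_left _ hρ hu.locallyIntegrable).continuous
  have happrox : ∀ x ∈ closedBall x₁ s, |U x - u x| ≤ η * s ^ 2 / 3 := fun x hx => by
    rw [mem_closedBall] at hx
    refine B.dist_normed_convolution_le hu.aestronglyMeasurable fun y hy => ?_
    have hy' : dist y x < ε := hy
    refine hclose y ?_ x ?_ (hy'.le.trans (min_le_left _ _)) <;> rw [mem_closedBall]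
    · linarith [dist_triangle y x x₁, min_le_right δ s]
    · linarith
  set v : E → ℝ := fun x => U x - c * ‖x - x₀‖ ^ 2 - η * ‖x - x₁‖ ^ 2 with hv
  have hvc : Continuous v := by fun_prop
  obtain ⟨z, hz, hzmax⟩ := (isCompact_closedBall x₁ s).exists_isMaxOn
    ⟨x₁, mem_closedBall_self hs0.le⟩ hvc.continuousOn
  have hzs : dist z x₁ < s := by
    refine lt_of_le_of_ne hz fun heq => ?_
    have h1 : v x₁ ≤ v z := hzmax (mem_closedBall_self hs0.le)
    have h2 := abs_le.1 (happrox x₁ (mem_closedBall_self hs0.le))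
    have h3 := abs_le.1 (happrox z hz)
    have h4 : u z - c * ‖z - x₀‖ ^ 2 ≤ u x₁ - c * ‖x₁ - x₀‖ ^ 2 :=
      (hball (mem_ball.2 (by linarith))).2
    rw [dist_eq_norm] at heq
    simp only [hv, heq, sub_self, norm_zero] at h1
    have : 0 < η * s ^ 2 := by positivity
    linarith
  have hle := lap_le_of_isLocalMax_sub_sq hρ hρc hu (c := c) (η := η) (x₀ := x₀) (x₁ := x₁)
    (hzmax.isLocalMax (closedBall_mem_nhds_of_mem hzs))
  have hsupp : tsupport (fun y => B.normed volume (z - y)) ⊆ D := by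
    have hsub : tsupport (fun y => B.normed volume (z - y)) ⊆ closedBall z ε := by
      refine closure_minimal (fun y hy => ?_) isClosed_closedBall
      have : z - y ∈ Function.support (B.normed volume) := hy
      rw [B.support_normed_eq, mem_ball_zero_iff] at this
      rw [mem_closedBall, dist_comm, dist_eq_norm]
      exact this.le
    intro y hy
    have hy' : dist y z ≤ ε := hsub hy
    refine (hball (mem_ball.2 ?_)).1
    linarith [dist_triangle y z x₁, min_le_right δ s]
  have hone : lap N U z = 1 := by
    rw [hU, lap_mollification hρ hρc hu, hΔ (fun y => B.normed volume (z - y))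
      (hρ.comp (contDiff_const.sub contDiff_id)) hsupp,
      integral_sub_left_eq_self, B.integral_normed]
  linarith

end Mollification

/-- In the closed ball around a point of `Ω`, `u` grows at least quadratically. -/
lemma MemP.exists_mem_closedBall_add_sq_le {N : ℕ} {M : ℝ} {Ω : Set (EuclideanSpace ℝ (Fin N))}
    {u : EuclideanSpace ℝ (Fin N) → ℝ} (h : MemP N 1 0 M Ω u) {c η : ℝ} (hc0 : 0 < c)
    (hη : 0 < η) (hc : N * (2 * (c + η)) < 1) {x₀ : EuclideanSpace ℝ (Fin N)} (hx₀ : x₀ ∈ Ω)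
    {s : ℝ} (hs : 0 ≤ s) (hsub : closedBall x₀ s ⊆ ball 0 1) :
    ∃ x ∈ closedBall x₀ s, u x₀ + c * s ^ 2 ≤ u x := by
  obtain ⟨hΩ, hu, hΔ, hzero, -, -⟩ := h
  have huc : Continuous u := hu.continuous
  have hwc : Continuous fun x => u x - c * ‖x - x₀‖ ^ 2 := by fun_prop
  obtain ⟨z, hz, hzmax⟩ := (isCompact_closedBall x₀ s).exists_isMaxOn
    ⟨x₀, mem_closedBall_self hs⟩ hwc.continuousOn
  refine ⟨z, hz, ?_⟩
  rcases (mem_closedBall.1 hz).lt_or_eq with hlt | heq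
  · have hloc : IsLocalMax (fun x => u x - c * ‖x - x₀‖ ^ 2) z :=
      hzmax.isLocalMax (closedBall_mem_nhds_of_mem hlt)
    by_cases hzΩ : z ∈ Ω
    · refine absurd hloc (not_isLocalMax_sub_sq (hΩ.inter isOpen_ball) huc (fun φ hφ hsupp => ?_)
        hη hc ⟨hzΩ, hsub hz⟩)
      rw [hΔ φ hφ (hsupp.trans inter_subset_right)]
      exact setIntegral_eq_integral_of_forall_compl_eq_zero fun x hx =>
        image_eq_zero_of_notMem_tsupport fun hx' => hx (hsupp hx').1
    · have hgrad : fderiv ℝ u z = 0 := by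
        have := (hzero z ⟨hsub hz, hzΩ⟩).2
        rwa [gradient, map_eq_zero_iff _ (LinearIsometryEquiv.injective _)] at this
      have hd : HasFDerivAt (fun x => u x - c * ‖x - x₀‖ ^ 2)
          (fderiv ℝ u z - c • (2 • innerSL ℝ (z - x₀))) z := by
        have hsq : HasFDerivAt (fun x => ‖x - x₀‖ ^ 2) (2 • innerSL ℝ (z - x₀)) z := by
          simpa using ((hasFDerivAt_id z).sub_const x₀).norm_sq
        exact ((hu.differentiable (by simp) z).hasFDerivAt).sub (hsq.const_mul c)
      have heq := DFunLike.congr_fun (hloc.hasFDerivAt_eq_zero hd) (z - x₀)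
      have hinner : ⟪z, z - x₀⟫ - ⟪x₀, z - x₀⟫ = 0 := by
        simpa [hgrad, hc0.ne'] using heq
      have hzx : z = x₀ := sub_eq_zero.1 
        (inner_self_eq_zero (𝕜 := ℝ).1 (by rwa [inner_sub_left]))
      exact absurd (hzx ▸ hx₀) hzΩ
  · have h1 : u x₀ - c * ‖x₀ - x₀‖ ^ 2 ≤ u z - c * ‖z - x₀‖ ^ 2 :=
      hzmax (mem_closedBall_self hs)
    rw [← dist_eq_norm z, heq] at h1
    simp only [sub_self, norm_zero] at h1
    linarith

/-- nondegeneracy, `sup_{B(x⁰,r)} u ≥ u(x⁰) + c_N r²`. -/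
theorem nondegeneracy (N : ℕ) (hN : 2 ≤ N) :
    ∃ c : ℝ, 0 < c ∧
      ∀ (M : ℝ), 0 < M →
        ∀ (Ω : Set (EuclideanSpace ℝ (Fin N))) (u : EuclideanSpace ℝ (Fin N) → ℝ),
          MemP N 1 0 M Ω u →
            ∀ x0 ∈ closure Ω, ∀ r : ℝ, 0 < r → ball x0 r ⊆ ball 0 1 →
              u x0 + c * r ^ 2 ≤ sSup (u '' ball x0 r) := by
  have hN0 : (0 : ℝ) < N := by positivity
  refine ⟨1 / (8 * N), by positivity, fun M _ Ω u h x0 hx0 r hr hsub => ?_⟩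
  set c : ℝ := 1 / (8 * N) with hc
  have hc0 : 0 < c := by positivity
  have hcN : N * (2 * (c + c)) < 1 := by
    rw [hc]
    field_simp
    norm_num
  have hbdd : BddAbove (u '' ball x0 r) := by
    refine ⟨M, ?_⟩
    rintro _ ⟨x, hx, rfl⟩
    exact (le_abs_self _).trans (h.2.2.2.2.1 x (hsub hx))
  have huc : Continuous u := h.2.1.continuous
  have hlt : ∀ s, 0 < s → s < r → u x0 + c * s ^ 2 ≤ sSup (u '' ball x0 r) := by
    intro s hs hsr
    refine le_of_forall_pos_sub_le fun δ hδ => ?_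
    have hnhds : ball x0 (r - s) ∩ {x | u x0 - δ < u x} ∈ 𝓝 x0 :=
      inter_mem (ball_mem_nhds x0 (by linarith))
        (huc.continuousAt.eventually (lt_mem_nhds (by linarith)))
    obtain ⟨y, ⟨hy1, hy2⟩, hyΩ⟩ := mem_closure_iff_nhds.1 hx0 _ hnhds
    have hballs : closedBall y s ⊆ ball x0 r := fun x hx => by
      rw [mem_closedBall] at hx
      rw [mem_ball] at hy1 ⊢
      linarith [dist_triangle x y x0]
    obtain ⟨x, hx, hux⟩ := h.exists_mem_closedBall_add_sq_le hc0 hc0 hcN hyΩ hs.le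
      (hballs.trans hsub)
    have hsup := le_csSup hbdd (mem_image_of_mem u (hballs hx))
    have hy2' : u x0 - δ < u y := hy2
    linarith
  have htend : Tendsto (fun s => u x0 + c * s ^ 2) (𝓝[<] r) (𝓝 (u x0 + c * r ^ 2)) :=
    (Continuous.tendsto (by fun_prop) r).mono_left nhdsWithin_le_nhds
  refine le_of_tendsto htend ?_
  filter_upwards [Ioo_mem_nhdsLT hr] with s hs using hlt s hs.1 hs.2
end
end

section
/- There is a constant C > 0 depending only on N such that: if u ∈ P₁(0,M), e is a unit vector, ε > 0, and sup_{x ∈ B(0,1)} |u(x) − (max(⟨x,e⟩,0))²/2| < ε, then u(x) = 0 for every x ∈ B(0,1/2) with ⟨x,e⟩ < −C·√ε. -/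
open MeasureTheory Metric Set Filter
open scoped RealInnerProductSpace

noncomputable section

/-- At an interior local maximum of a smooth function the Laplacian is nonpositive. -/
theorem lap_nonpos_of_isLocalMax {N : ℕ} {f : EuclideanSpace ℝ (Fin N) → ℝ}
    (hf : ContDiff ℝ 2 f) {z : EuclideanSpace ℝ (Fin N)} (hz : IsLocalMax f z) :
    lap N f z ≤ 0 := by
  refine Finset.sum_nonpos fun i _ => ?_
  set v : EuclideanSpace ℝ (Fin N) := EuclideanSpace.single i 1
  set g : ℝ → ℝ := fun t => f (z + t • v)
  have hline : ∀ t : ℝ, HasDerivAt (fun t : ℝ => z + t • v) v t := fun t => by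
    simpa using ((hasDerivAt_id t).smul_const v).const_add z
  have hg : deriv g = fun t => fderiv ℝ f (z + t • v) v := by
    ext t
    exact (((hf.differentiable (by norm_num)) _).hasFDerivAt.comp_hasDerivAt t (hline t)).deriv
  have hdiff : Differentiable ℝ (fun y => fderiv ℝ f y v) :=
    ((hf.fderiv_right (m := 1) (by norm_num)).differentiable (by norm_num)).clm_apply
      (differentiable_const v)
  have hgg : ∀ t, deriv (deriv g) t = fderiv ℝ (fun y => fderiv ℝ f y v) (z + t • v) v := by
    intro t
    rw [hg]
    exact ((hdiff _).hasFDerivAt.comp_hasDerivAt t (hline t)).deriv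
  have hcont : ContinuousAt (fun t : ℝ => z + t • v) 0 := by fun_prop
  have hmax : IsLocalMax g 0 := by
    have h0 : Tendsto (fun t : ℝ => z + t • v) (nhds 0) (nhds z) := by
      simpa [ContinuousAt] using hcont
    have := h0.eventually hz
    filter_upwards [this] with t ht
    simpa [g] using ht
  by_contra! hpos
  have h1 : deriv (deriv g) 0 > 0 := by simpa [hgg] using hpos
  have hmin : IsLocalMin g 0 := by
    refine isLocalMin_of_deriv_deriv_pos h1 hmax.deriv_eq_zero ?_
    exact (hf.continuous.continuousAt).comp hcont
  have hconst : g =ᶠ[nhds 0] fun _ => g 0 := by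
    filter_upwards [hmax, hmin] with t h h'
    exact le_antisymm h h'
  have h2 : deriv (deriv g) 0 = 0 := by
    rw [hconst.deriv.deriv_eq]
    simp
  exact h1.ne' h2

theorem lap_add {N : ℕ} {f g : EuclideanSpace ℝ (Fin N) → ℝ}
    (hf : ContDiff ℝ 2 f) (hg : ContDiff ℝ 2 g) (x : EuclideanSpace ℝ (Fin N)) :
    lap N (fun y => f y + g y) x = lap N f x + lap N g x := by
  have hd : ∀ h : EuclideanSpace ℝ (Fin N) → ℝ, ContDiff ℝ 2 h →
      ∀ v, Differentiable ℝ (fun y => fderiv ℝ h y v) := fun h hh v =>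
    ((hh.fderiv_right (m := 1) (by norm_num)).differentiable (by norm_num)).clm_apply
      (differentiable_const v)
  unfold lap
  rw [← Finset.sum_add_distrib]
  refine Finset.sum_congr rfl fun i _ => ?_
  have : (fun y => fderiv ℝ (fun y => f y + g y) y (EuclideanSpace.single i 1)) =
      fun y => fderiv ℝ f y (EuclideanSpace.single i 1) +
        fderiv ℝ g y (EuclideanSpace.single i 1) := by
    ext y
    rw [fderiv_fun_add (hf.differentiable (by norm_num) y) (hg.differentiable (by norm_num) y)]
    rfl
  rw [this, fderiv_fun_add (hd f hf _ x) (hd g hg _ x)]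
  rfl

/-- The quadratic polynomial `a⟪x-p,d⟫ + A⟪x-p,d⟫² - B‖x-p‖²`. -/
def quadPoly (N : ℕ) (p d : EuclideanSpace ℝ (Fin N)) (a A B : ℝ)
    (x : EuclideanSpace ℝ (Fin N)) : ℝ :=
  a * ⟪x - p, d⟫ + A * ⟪x - p, d⟫ ^ 2 - B * ‖x - p‖ ^ 2

theorem contDiff_quadPoly {N : ℕ} (p d : EuclideanSpace ℝ (Fin N)) (a A B : ℝ) {n : WithTop ℕ∞} :
    ContDiff ℝ n (quadPoly N p d a A B) := by
  unfold quadPoly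
  have h1 : ContDiff ℝ n fun x : EuclideanSpace ℝ (Fin N) => ⟪x - p, d⟫ :=
    (contDiff_id.sub contDiff_const).inner ℝ contDiff_const
  have h2 : ContDiff ℝ n fun x : EuclideanSpace ℝ (Fin N) => ‖x - p‖ ^ 2 :=
    (contDiff_id.sub contDiff_const).norm_sq ℝ
  fun_prop

theorem lap_quadPoly {N : ℕ} (p d : EuclideanSpace ℝ (Fin N)) (a A B : ℝ)
    (x : EuclideanSpace ℝ (Fin N)) :
    lap N (quadPoly N p d a A B) x = 2 * A * ‖d‖ ^ 2 - 2 * N * B := by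
  have hinner : ∀ w y : EuclideanSpace ℝ (Fin N),
      HasFDerivAt (fun y : EuclideanSpace ℝ (Fin N) => ⟪y - p, w⟫) (innerSL ℝ w) y := by
    intro w y
    have := ((innerSL ℝ w).hasFDerivAt (x := y - p)).comp y ((hasFDerivAt_id y).sub_const p)
    refine this.congr_of_eventuallyEq (Eventually.of_forall fun z => ?_)
    simp [real_inner_comm]
  have h1 : ∀ (v y : EuclideanSpace ℝ (Fin N)), fderiv ℝ (quadPoly N p d a A B) y v =
      a * ⟪d, v⟫ + 2 * A * ⟪d, v⟫ * ⟪y - p, d⟫ - 2 * B * ⟪y - p, v⟫ := by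
    intro v y
    have hn := ((hasFDerivAt_id y).sub_const p).norm_sq
    have := (((hinner d y).const_mul a).add (((hinner d y).pow 2).const_mul A)).sub
      (hn.const_mul B)
    have h := this.fderiv
    change fderiv ℝ (quadPoly N p d a A B) y = _ at h
    rw [h]
    simp [inner_sub_left]
    ring
  have h2 : ∀ (v : EuclideanSpace ℝ (Fin N)),
      fderiv ℝ (fun y => fderiv ℝ (quadPoly N p d a A B) y v) x v =
      2 * A * ⟪d, v⟫ ^ 2 - 2 * B * ⟪v, v⟫ := by
    intro v
    simp_rw [h1]
    have := ((((hinner d x).const_mul (2 * A * ⟪d, v⟫)).const_add (a * ⟪d, v⟫))).sub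
      ((hinner v x).const_mul (2 * B))
    have h := this.fderiv
    refine (congrArg (fun L => L v) h).trans ?_
    simp
    ring
  unfold lap
  simp_rw [h2]
  rw [EuclideanSpace.real_norm_sq_eq]
  simp [Finset.sum_sub_distrib, EuclideanSpace.inner_single_right, ← Finset.mul_sum]
  ring

theorem fderiv_convolution_apply {N : ℕ} {u ρ : EuclideanSpace ℝ (Fin N) → ℝ}
    (hu : Continuous u) (hρ : ContDiff ℝ 1 ρ) (hc : HasCompactSupport ρ)
    (x v : EuclideanSpace ℝ (Fin N)) :
    fderiv ℝ (convolution u ρ (ContinuousLinearMap.lsmul ℝ ℝ) volume) x v =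
      convolution u (fun y => fderiv ℝ ρ y v) (ContinuousLinearMap.lsmul ℝ ℝ) volume x := by
  rw [(hc.hasFDerivAt_convolution_right (ContinuousLinearMap.lsmul ℝ ℝ)
    hu.locallyIntegrable hρ x).fderiv]
  exact convolution_precompR_apply _ hu.locallyIntegrable (hc.fderiv ℝ)
    (hρ.continuous_fderiv one_ne_zero) _ _

/-- The Laplacian is invariant under the point reflection `y ↦ x - y`. -/
theorem lap_comp_sub_left {N : ℕ} {ρ : EuclideanSpace ℝ (Fin N) → ℝ} (hρ : ContDiff ℝ 2 ρ)
    (x t : EuclideanSpace ℝ (Fin N)) : lap N (fun y => ρ (x - y)) t = lap N ρ (x - t) := by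
  have hsub : ∀ y : EuclideanSpace ℝ (Fin N), HasFDerivAt (fun y => x - y)
      (-(ContinuousLinearMap.id ℝ (EuclideanSpace ℝ (Fin N)))) y := fun y =>
    (hasFDerivAt_id y).const_sub x
  unfold lap
  refine Finset.sum_congr rfl fun i _ => ?_
  set v : EuclideanSpace ℝ (Fin N) := EuclideanSpace.single i 1
  have h1 : (fun y => fderiv ℝ (fun y => ρ (x - y)) y v) = fun y => -fderiv ℝ ρ (x - y) v := by
    ext y
    have := ((hρ.differentiable (by norm_num) (x - y)).hasFDerivAt.comp y (hsub y)).fderiv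
    refine (congrArg (fun L => L v) this).trans ?_
    simp
  have hdiff : Differentiable ℝ (fun y => fderiv ℝ ρ y v) :=
    ((hρ.fderiv_right (m := 1) (by norm_num)).differentiable (by norm_num)).clm_apply
      (differentiable_const v)
  rw [h1]
  have := (((hdiff (x - t)).hasFDerivAt.comp t (hsub t)).neg).fderiv
  refine (congrArg (fun L => L v) this).trans ?_
  simp

theorem lap_convolution {N : ℕ} {u ρ : EuclideanSpace ℝ (Fin N) → ℝ}
    (hu : Continuous u) (hρ : ContDiff ℝ 2 ρ) (hc : HasCompactSupport ρ)
    (x : EuclideanSpace ℝ (Fin N)) :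
    lap N (convolution u ρ (ContinuousLinearMap.lsmul ℝ ℝ) volume) x =
      ∫ t, u t * lap N (fun y => ρ (x - y)) t := by
  have hd : ∀ v, ContDiff ℝ 1 (fun y => fderiv ℝ ρ y v) := fun v =>
    (hρ.fderiv_right (m := 1) (by norm_num)).clm_apply contDiff_const
  simp_rw [lap_comp_sub_left hρ]
  unfold lap
  simp_rw [fun v => funext fun y => fderiv_convolution_apply hu (hρ.of_le (by norm_num)) hc y v,
    Finset.mul_sum]
  rw [integral_finsetSum]
  · refine Finset.sum_congr rfl fun i _ => ?_
    rw [fderiv_convolution_apply hu (hd _) (hc.fderiv_apply ℝ _)]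
    rfl
  · intro i _
    have hcc := ((hc.fderiv_apply ℝ (EuclideanSpace.single i (1 : ℝ))).fderiv_apply ℝ
      (EuclideanSpace.single i (1 : ℝ)))
    have := hcc.convolutionExists_right (μ := volume) (ContinuousLinearMap.lsmul ℝ ℝ)
      hu.locallyIntegrable (((hd _).continuous_fderiv one_ne_zero).clm_apply continuous_const) x
    exact this

/-- A continuous function with `Δu = χ_Ω` in the unit ball is a viscosity subsolution, tested
against smooth functions of constant Laplacian. -/
theorem add_nonpos_of_isLocalMax {N : ℕ} {Ω : Set (EuclideanSpace ℝ (Fin N))}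
    {u : EuclideanSpace ℝ (Fin N) → ℝ} (hΩ : IsOpen Ω) (hu : Continuous u)
    (hw : ∀ φ : EuclideanSpace ℝ (Fin N) → ℝ, ContDiff ℝ (⊤ : ℕ∞) φ → tsupport φ ⊆ ball 0 1 →
      ∫ x, u x * lap N φ x = ∫ x in Ω, φ x)
    {q : EuclideanSpace ℝ (Fin N) → ℝ} (hq : ContDiff ℝ 2 q) {L : ℝ} (hL : ∀ x, lap N q x = L)
    {y : EuclideanSpace ℝ (Fin N)} (hy : y ∈ ball (0 : EuclideanSpace ℝ (Fin N)) 1)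
    {c : ℝ} (hc : c = 0 ∨ c = 1 ∧ y ∈ Ω) (hmax : IsLocalMax (fun x => u x + q x) y) :
    c + L ≤ 0 := by
  by_contra! hpos
  obtain ⟨κ, hκ, hκL⟩ : ∃ κ : ℝ, 0 < κ ∧ 0 < c + (L - 2 * N * κ) := by
    refine ⟨(c + L) / (4 * (N + 1)), by positivity, ?_⟩
    have : 2 * N * ((c + L) / (4 * (N + 1))) ≤ (c + L) / 2 := by
      rw [mul_div_assoc', div_le_div_iff₀ (by positivity) (by norm_num)]
      nlinarith
    linarith
  have hev : ∀ᶠ x in nhds y, x ∈ ball (0 : EuclideanSpace ℝ (Fin N)) 1 ∧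
      (u x + q x ≤ u y + q y) ∧ (c = 0 ∨ c = 1 ∧ x ∈ Ω) := by
    refine (isOpen_ball.eventually_mem hy).and (Eventually.and hmax ?_)
    rcases hc with h | ⟨h, h'⟩
    · exact Eventually.of_forall fun _ => Or.inl h
    · exact (hΩ.eventually_mem h').mono fun x hx => Or.inr ⟨h, hx⟩
  obtain ⟨r, hr, hball⟩ := Metric.eventually_nhds_iff_ball.1 hev
  set s := r / 2 with hs
  have hs0 : 0 < s := by positivity
  have huc : UniformContinuousOn u (closedBall y (s + 1)) :=
    (isCompact_closedBall y (s + 1)).uniformContinuousOn_of_continuous hu.continuousOn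
  obtain ⟨δ₀, hδ₀, hδu⟩ := Metric.uniformContinuousOn_iff_le.1 huc (κ * s ^ 2 / 4) (by positivity)
  set δ := min δ₀ (min (s / 2) 1) with hδ
  have hδpos : 0 < δ := by positivity
  have hδ1 : δ ≤ δ₀ := min_le_left _ _
  have hδ2 : δ ≤ s / 2 := (min_le_right _ _).trans (min_le_left _ _)
  have hδ3 : δ ≤ 1 := (min_le_right _ _).trans (min_le_right _ _)
  let b : ContDiffBump (0 : EuclideanSpace ℝ (Fin N)) := ⟨δ / 2, δ, by positivity, by linarith⟩
  set ρ : EuclideanSpace ℝ (Fin N) → ℝ := b.normed volume with hρdef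
  have hρ : ContDiff ℝ (⊤ : ℕ∞) ρ := b.contDiff_normed
  have hρ2 : ContDiff ℝ 2 ρ := b.contDiff_normed (n := 2)
  have hρc : HasCompactSupport ρ := b.hasCompactSupport_normed
  set U := convolution u ρ (ContinuousLinearMap.lsmul ℝ ℝ) volume with hU
  have hUsmooth : ContDiff ℝ 2 U :=
    hρc.contDiff_convolution_right (n := 2) (ContinuousLinearMap.lsmul ℝ ℝ)
      hu.locallyIntegrable hρ2
  have hUclose : ∀ z ∈ closedBall y s, |U z - u z| ≤ κ * s ^ 2 / 4 := by
    intro z hz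
    have hsw : U z = convolution ρ u (ContinuousLinearMap.lsmul ℝ ℝ) volume z := by
      rw [convolution_lsmul_swap, hU, convolution_def]
      simp [mul_comm]
    rw [hsw, ← Real.dist_eq]
    refine b.dist_normed_convolution_le hu.aestronglyMeasurable fun x hx => ?_
    have hxz : dist x z < δ := hx
    rw [mem_closedBall] at hz
    refine hδu x ?_ z ?_ (by linarith)
    · rw [mem_closedBall]
      linarith [dist_triangle x z y]
    · rw [mem_closedBall]
      linarith
  set F : EuclideanSpace ℝ (Fin N) → ℝ := fun x => U x + (q x + quadPoly N y 0 0 0 κ x) with hF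
  have hq' : ContDiff ℝ 2 fun x => q x + quadPoly N y 0 0 0 κ x :=
    hq.add (contDiff_quadPoly _ _ _ _ _)
  have hFs : ContDiff ℝ 2 F := hUsmooth.add hq'
  obtain ⟨z, hz, hzmax⟩ := (isCompact_closedBall y s).exists_isMaxOn
    ⟨y, mem_closedBall_self hs0.le⟩ hFs.continuous.continuousOn
  have hzy : dist z y < s := by
    by_contra! hge
    have hzs : ‖z - y‖ = s := by
      rw [← dist_eq_norm]
      exact le_antisymm hz hge
    have h1 : F y ≤ F z := hzmax (mem_closedBall_self hs0.le)
    have h2 := abs_le.1 (hUclose z hz)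
    have h3 := abs_le.1 (hUclose y (mem_closedBall_self hs0.le))
    have h4 := (hball z (by rw [mem_ball]; rw [mem_closedBall] at hz; linarith)).2.1
    simp only [hF, quadPoly, hzs] at h1
    simp at h1
    have : 0 < κ * s ^ 2 := by positivity
    linarith
  have hzloc : IsLocalMax F z :=
    hzmax.isLocalMax (closedBall_mem_nhds_of_mem hzy)
  have hlap := lap_nonpos_of_isLocalMax hFs hzloc
  rw [hF, lap_add hUsmooth hq', lap_add hq (contDiff_quadPoly _ _ _ _ _), hL,
    lap_quadPoly, hU, lap_convolution hu hρ2 hρc] at hlap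
  have hφ : ContDiff ℝ (⊤ : ℕ∞) fun t => ρ (z - t) := hρ.comp (contDiff_const.sub contDiff_id)
  have hsub : ∀ t, ρ (z - t) ≠ 0 → t ∈ closedBall z δ := by
    intro t ht
    have : z - t ∈ tsupport ρ := subset_tsupport _ ht
    rw [hρdef, b.tsupport_normed_eq] at this
    simpa [dist_eq_norm, norm_sub_rev] using this
  have hballr : closedBall z δ ⊆ ball y r := by
    intro t ht
    rw [mem_closedBall] at ht
    rw [mem_ball]
    linarith [dist_triangle t z y]
  rw [hw _ hφ ((closure_minimal (fun t ht => hsub t ht) isClosed_closedBall).trans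
    fun t ht => (hball t (hballr ht)).1)] at hlap
  have hint : c ≤ ∫ t in Ω, ρ (z - t) := by
    rcases hc with h | ⟨h, -⟩
    · rw [h]
      exact integral_nonneg fun t => b.nonneg_normed _
    · rw [setIntegral_eq_integral_of_forall_compl_eq_zero, integral_sub_left_eq_self,
        b.integral_normed, h]
      intro t ht
      by_contra hne
      rcases (hball t (hballr (hsub t hne))).2.2 with h' | ⟨-, h'⟩
      · linarith
      · exact ht h'
  simp at hlap
  linarith

/-- Quadratic growth from a point whose superlevel set lies in `Ω`. -/
theorem exists_quadratic_growth {N : ℕ} (hN : 0 < N) {Ω : Set (EuclideanSpace ℝ (Fin N))}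
    {u : EuclideanSpace ℝ (Fin N) → ℝ} (hΩ : IsOpen Ω) (hu : Continuous u)
    (hw : ∀ φ : EuclideanSpace ℝ (Fin N) → ℝ, ContDiff ℝ (⊤ : ℕ∞) φ → tsupport φ ⊆ ball 0 1 →
      ∫ x, u x * lap N φ x = ∫ x in Ω, φ x)
    {x : EuclideanSpace ℝ (Fin N)} {r : ℝ} (hr : 0 < r)
    (hsub : closedBall x r ⊆ ball (0 : EuclideanSpace ℝ (Fin N)) 1)
    (hpos : ∀ y ∈ ball x r, u x ≤ u y → y ∈ Ω) :
    ∃ z ∈ closedBall x r, u x + r ^ 2 / (4 * N) ≤ u z := by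
  have hN' : (0 : ℝ) < N := by exact_mod_cast hN
  set q := quadPoly N x 0 0 0 (1 / (4 * N)) with hq
  have hqs : ContDiff ℝ 2 q := contDiff_quadPoly _ _ _ _ _
  obtain ⟨z, hz, hzmax⟩ := (isCompact_closedBall x r).exists_isMaxOn
    ⟨x, mem_closedBall_self hr.le⟩ (hu.add hqs.continuous).continuousOn
  have h1 : u x + q x ≤ u z + q z := hzmax (mem_closedBall_self hr.le)
  simp [hq, quadPoly] at h1
  refine ⟨z, hz, ?_⟩
  rcases lt_or_ge (dist z x) r with hlt | hge
  · exfalso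
    have hzloc : IsLocalMax (fun y => u y + q y) z :=
      hzmax.isLocalMax (closedBall_mem_nhds_of_mem hlt)
    have hzΩ : z ∈ Ω := hpos z hlt (by
      have : 0 ≤ (N : ℝ)⁻¹ * 4⁻¹ * ‖z - x‖ ^ 2 := by positivity
      linarith)
    have := add_nonpos_of_isLocalMax hΩ hu hw hqs (lap_quadPoly _ _ _ _ _) (hsub hz)
      (Or.inr ⟨rfl, hzΩ⟩) hzloc
    field_simp at this
    simp at this
    linarith
  · have hzr : ‖z - x‖ = r := by
      rw [← dist_eq_norm]
      exact le_antisymm hz hge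
    rw [hzr] at h1
    have : r ^ 2 / (4 * N) = (N : ℝ)⁻¹ * 4⁻¹ * r ^ 2 := by field_simp
    linarith

/-- Strong maximum principle on a ball. -/
theorem neg_of_nonpos_of_neg_center {N : ℕ} (hN : 0 < N) {Ω : Set (EuclideanSpace ℝ (Fin N))}
    {u : EuclideanSpace ℝ (Fin N) → ℝ} (hΩ : IsOpen Ω) (hu : Continuous u)
    (hw : ∀ φ : EuclideanSpace ℝ (Fin N) → ℝ, ContDiff ℝ (⊤ : ℕ∞) φ → tsupport φ ⊆ ball 0 1 →
      ∫ x, u x * lap N φ x = ∫ x in Ω, φ x)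
    {x₀ : EuclideanSpace ℝ (Fin N)} {r : ℝ}
    (hsub : ball x₀ r ⊆ ball (0 : EuclideanSpace ℝ (Fin N)) 1)
    (hle : ∀ x ∈ ball x₀ r, u x ≤ 0) (hneg : u x₀ < 0) : ∀ x ∈ ball x₀ r, u x < 0 := by
  by_contra! hcon
  obtain ⟨y', hy', hy'0⟩ := hcon
  have hN' : (0 : ℝ) < N := by exact_mod_cast hN
  have hZc : IsCompact (closedBall x₀ (dist y' x₀) ∩ {x | 0 ≤ u x}) :=
    (isCompact_closedBall _ _).inter_right (isClosed_le continuous_const hu)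
  obtain ⟨y, ⟨hyb, hy0⟩, hymin⟩ := hZc.exists_isMinOn
    ⟨y', mem_closedBall.2 le_rfl, hy'0⟩
    (continuous_id.dist (continuous_const (y := x₀))).continuousOn
  have hyr : dist y x₀ < r := lt_of_le_of_lt hyb hy'
  have hy0 : 0 ≤ u y := hy0
  have hyu : u y = 0 := le_antisymm (hle y hyr) hy0
  set d := y - x₀ with hd
  have hdpos : 0 < ‖d‖ := by
    rw [norm_pos_iff, sub_ne_zero]
    rintro rfl
    linarith
  have hinside : ∀ x, dist x x₀ < ‖d‖ → u x < 0 := by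
    intro x hx
    by_contra! hx0
    rw [hd, ← dist_eq_norm] at hx
    have := hymin (show x ∈ closedBall x₀ (dist y' x₀) ∩ {x | 0 ≤ u x} from
      ⟨mem_closedBall.2 (hx.le.trans hyb), hx0⟩)
    simp at this
    linarith
  set A := 2 * N / ‖d‖ ^ 2 with hA
  have hApos : 0 < A := by positivity
  set g := quadPoly N y d (-1) A 1 with hg
  have hgs : ContDiff ℝ 2 g := contDiff_quadPoly _ _ _ _ _
  obtain ⟨s, hs, hsr, hsA, hsA'⟩ : ∃ s : ℝ, 0 < s ∧ s < r - dist y x₀ ∧ A * (s * ‖d‖) ≤ 1 ∧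
      A * s ^ 2 < 2 := by
    have hev : ∀ᶠ s in nhds (0 : ℝ), s < r - dist y x₀ ∧ A * (s * ‖d‖) < 1 ∧ A * s ^ 2 < 2 := by
      refine (eventually_lt_nhds (by linarith)).and (Eventually.and ?_ ?_)
      · exact (by fun_prop : ContinuousAt (fun s : ℝ => A * (s * ‖d‖)) 0).eventually_lt_const
          (by simp)
      · exact (by fun_prop : ContinuousAt (fun s : ℝ => A * s ^ 2) 0).eventually_lt_const
          (by simp)
    obtain ⟨s, h, hs⟩ := ((hev.filter_mono nhdsWithin_le_nhds).and
      (self_mem_nhdsWithin : Ioi (0 : ℝ) ∈ nhdsWithin 0 (Ioi 0))).exists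
    exact ⟨s, hs, h.1, h.2.1.le, h.2.2⟩
  have hballs : closedBall y s ⊆ ball x₀ r := by
    intro x hx
    rw [mem_closedBall] at hx
    rw [mem_ball]
    linarith [dist_triangle x y x₀]
  -- On the sphere around `y`, the barrier is nonnegative only inside the ball around `x₀`.
  have hbar : ∀ x ∈ sphere y s, 0 ≤ g x → u x < 0 := by
    intro x hx hgx
    apply hinside
    have hxs : ‖x - y‖ = s := by rw [← dist_eq_norm]; exact hx
    by_contra! hge
    have hexp : ‖x - x₀‖ ^ 2 = s ^ 2 + 2 * ⟪x - y, d⟫ + ‖d‖ ^ 2 := by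
      rw [← hxs, ← norm_add_sq_real, hd]
      congr 2
      abel
    rw [dist_eq_norm] at hge
    have hge2 : ‖d‖ ^ 2 ≤ ‖x - x₀‖ ^ 2 := by gcongr
    have hcs : |⟪x - y, d⟫| ≤ s * ‖d‖ := by
      rw [← hxs]
      exact abs_real_inner_le_norm _ _
    simp only [hg, quadPoly, hxs] at hgx
    set T := ⟪x - y, d⟫
    have hT : -(s ^ 2) ≤ 2 * T := by linarith
    have hs2 : 0 < s ^ 2 := by positivity
    rcases le_or_gt 0 T with h | h
    · have hTs : A * T ≤ 1 := by
        have := (abs_le.1 hcs).2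
        nlinarith
      nlinarith
    · have hT2 : T ^ 2 ≤ (s ^ 2) ^ 2 / 4 := by nlinarith
      have h1 : A * T ^ 2 ≤ A * ((s ^ 2) ^ 2 / 4) := by gcongr
      have h2 : A * ((s ^ 2) ^ 2 / 4) < s ^ 2 / 2 := by nlinarith
      linarith
  set K := sphere y s ∩ {x | 0 ≤ g x} with hK
  have hKc : IsCompact K :=
    (isCompact_sphere y s).inter_right (isClosed_le continuous_const hgs.continuous)
  obtain ⟨m, hm, hmK⟩ := hKc.exists_forall_le' (f := fun x => -u x) hu.neg.continuousOn (a := 0)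
    fun x hx => by linarith [hbar x hx.1 hx.2]
  obtain ⟨G, hG⟩ := (hKc.image hgs.continuous).bddAbove
  have hGK : ∀ x ∈ K, g x ≤ |G| := fun x hx =>
    (hG (mem_image_of_mem _ hx)).trans (le_abs_self _)
  set c := m / (|G| + 1) with hc
  have hcpos : 0 < c := by positivity
  have hcm : c * |G| < m := by
    rw [hc, div_mul_eq_mul_div, div_lt_iff₀ (by positivity)]
    nlinarith
  have hcg : (fun x => c * g x) = quadPoly N y d (-c) (c * A) c := by
    ext x
    simp only [hg, quadPoly]
    ring
  have hcgs : ContDiff ℝ 2 fun x => c * g x := contDiff_const.mul hgs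
  have hgy : g y = 0 := by simp [hg, quadPoly]
  have hsph : ∀ x ∈ sphere y s, u x + c * g x < 0 := by
    intro x hx
    rcases lt_or_ge (g x) 0 with h | h
    · have := hle x (hballs (sphere_subset_closedBall hx))
      nlinarith
    · have h1 : m ≤ -u x := hmK x ⟨hx, h⟩
      have h2 := mul_le_mul_of_nonneg_left (hGK x ⟨hx, h⟩) hcpos.le
      linarith
  obtain ⟨z, hz, hzmax⟩ := (isCompact_closedBall y s).exists_isMaxOn
    ⟨y, mem_closedBall_self hs.le⟩ (hu.add hcgs.continuous).continuousOn
  have hzy : dist z y < s := by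
    refine lt_of_le_of_ne hz fun h => ?_
    have h1 := hsph z h
    have h2 := hzmax (mem_closedBall_self hs.le : y ∈ closedBall y s)
    simp [hyu, hgy] at h2
    linarith
  have hzloc : IsLocalMax (fun x => u x + c * g x) z :=
    hzmax.isLocalMax (closedBall_mem_nhds_of_mem hzy)
  have := add_nonpos_of_isLocalMax hΩ hu hw hcgs
    (L := 2 * (c * A) * ‖d‖ ^ 2 - 2 * N * c) (fun x => by rw [hcg, lap_quadPoly])
    (hsub (hballs hz)) (Or.inl rfl) hzloc
  have hAd : A * ‖d‖ ^ 2 = 2 * N := by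
    rw [hA]
    field_simp
  have h3 : 2 * (c * A) * ‖d‖ ^ 2 = 2 * c * (2 * N) := by rw [← hAd]; ring
  have : 0 < c * N := by positivity
  linarith

/-- a solution close to a half-space solution vanishes well inside
the corresponding half-space. -/
theorem vanish_near_halfspace (N : ℕ) (hN : 2 ≤ N) :
    ∃ C : ℝ, 0 < C ∧
      ∀ (M : ℝ), 0 < M →
        ∀ (Ω : Set (EuclideanSpace ℝ (Fin N))) (u : EuclideanSpace ℝ (Fin N) → ℝ)
          (e : EuclideanSpace ℝ (Fin N)) (ε : ℝ),
          MemP N 1 0 M Ω u → ‖e‖ = 1 → 0 < ε →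
            (∀ x ∈ ball (0 : EuclideanSpace ℝ (Fin N)) 1,
              |u x - (max ⟪x, e⟫ 0) ^ 2 / 2| < ε) →
            ∀ x ∈ ball (0 : EuclideanSpace ℝ (Fin N)) (1 / 2),
              ⟪x, e⟫ < -(C * Real.sqrt ε) → u x = 0 := by
  have hN' : (2 : ℝ) ≤ N := by exact_mod_cast hN
  refine ⟨12 * N, by positivity, ?_⟩
  rintro M - Ω u e ε ⟨hΩ, hu1, hw, hzero, -, -⟩ he hε hclose x₀ hx₀ hx₀e
  have hu : Continuous u := hu1.continuous
  set R := 12 * N * Real.sqrt ε with hR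
  have hsq : 0 < Real.sqrt ε := Real.sqrt_pos.2 hε
  have hRpos : 0 < R := by positivity
  have hR2 : R ^ 2 = 144 * N ^ 2 * ε := by
    rw [hR, mul_pow, Real.sq_sqrt hε.le]
    ring
  have hx₀n : ‖x₀‖ < 1 / 2 := by simpa using hx₀
  have hcs : ∀ x : EuclideanSpace ℝ (Fin N), |⟪x, e⟫| ≤ ‖x‖ := fun x => by
    simpa [he] using abs_real_inner_le_norm x e
  have hsub : ball x₀ R ⊆ ball (0 : EuclideanSpace ℝ (Fin N)) 1 := by
    intro x hx
    have h1 := (abs_le.1 (hcs x₀)).1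
    rw [mem_ball] at hx
    rw [mem_ball]
    have h2 := dist_triangle x x₀ 0
    rw [dist_zero_right x₀] at h2
    linarith
  have hsmall : ∀ x ∈ ball x₀ R, |u x| < ε := by
    intro x hx
    have h := hclose x (hsub hx)
    have hxe : ⟪x, e⟫ < 0 := by
      have h1 := (abs_le.1 (hcs (x - x₀))).2
      rw [inner_sub_left] at h1
      rw [mem_ball, dist_eq_norm] at hx
      linarith
    simpa [max_eq_right hxe.le] using h
  have hΩ' : ∀ x ∈ ball x₀ R, u x ≠ 0 → x ∈ Ω := fun x hx hne => by
    by_contra hxΩ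
    exact hne (hzero x ⟨hsub hx, hxΩ⟩).1
  -- Quadratic growth is incompatible with `|u| < ε` on `B(x₀, R)`.
  have hno : ∀ x₁ ∈ ball x₀ (R / 2), ¬ ∀ y ∈ ball x₁ (R / 4), u x₁ ≤ u y → y ∈ Ω := by
    intro x₁ hx₁ h
    rw [mem_ball] at hx₁
    have hcb : closedBall x₁ (R / 4) ⊆ ball x₀ R := by
      intro x hx
      rw [mem_closedBall] at hx
      rw [mem_ball]
      linarith [dist_triangle x x₁ x₀]
    obtain ⟨z, hz, hzu⟩ := exists_quadratic_growth (by omega) hΩ hu hw (by positivity)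
      (hcb.trans hsub) h
    have h1 := abs_lt.1 (hsmall z (hcb hz))
    have h2 := abs_lt.1 (hsmall x₁ (hcb (mem_closedBall_self (by positivity))))
    have h3 : (R / 4) ^ 2 / (4 * N) = 9 / 4 * N * ε := by
      rw [div_pow, hR2]
      field_simp
      ring
    nlinarith
  have hle : ∀ x ∈ ball x₀ (R / 2), u x ≤ 0 := by
    intro x₁ hx₁
    by_contra! hpos
    refine hno x₁ hx₁ fun y hy hle => hΩ' y ?_ (by linarith)
    rw [mem_ball] at *
    linarith [dist_triangle y x₁ x₀]
  by_contra hne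
  have hneg : u x₀ < 0 := lt_of_le_of_ne (hle x₀ (mem_ball_self (by positivity))) hne
  have hall := neg_of_nonpos_of_neg_center (by omega) hΩ hu hw
    ((ball_subset_ball (by linarith)).trans hsub) hle hneg
  refine hno x₀ (mem_ball_self (by positivity)) fun y hy _ => hΩ' y ?_ (hall y ?_).ne
  · exact ball_subset_ball (by linarith) hy
  · exact ball_subset_ball (by linarith) hy
end
end
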